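/- There exists an absolute constant c > 0 such that: for each n, if the martingale differences (X_i)_{1≤i≤n} satisfy conditions (A1), (A2) with exponent ρ = 1, and (A4) with ρ = 1, and (x_n) is a sequence with x_n ≥ 0 and x_n γ_n → 0 (i.e. x_n = o(γ_n^{-1})), then for all sufficiently large n there exists θ_n with |θ_n| ≤ 1 such that P(W_n ≥ x_n)/(1 − Φ(x_n)) = exp{ θ_n c ( x_n³ ε_n + x_n² δ_n² + (1 + x_n)( x_n γ_n + γ_n |ln γ_n| + δ_n + ε̂_n(x_n, 1) ) ) }, where ε̂_n(x, 1) = ε_n^{1/4} / (1 + x^{3/4}). The same equality (with possibly different θ_n, |θ_n| ≤ 1) holds with P(W_n ≥ x_n)/(1 − Φ(x_n)) replaced by P(W_n ≤ −x_n)/Φ(−x_n). -/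

import Mathlib

open MeasureTheory Filter
open scoped Topology ENNReal

noncomputable def stdNormalCDF (x : ℝ) : ℝ :=
  (Real.sqrt (2 * Real.pi))⁻¹ * ∫ t in Set.Iic x, Real.exp (-(t ^ 2) / 2)

/-- A finite sequence of square-integrable martingale differences
`X 1, ..., X n` adapted to a filtration `F 0 ⊆ F 1 ⊆ ... ⊆ F n`, with
`F 0` trivial, `E[X i | F (i-1)] = 0` and `0 < E[(X i)^2] < ∞`. -/
structure MDS (Ω : Type) [mΩ : MeasurableSpace Ω] (P : Measure Ω) where
  n : ℕ
  npos : 0 < n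
  F : ℕ → MeasurableSpace Ω
  F_mono : Monotone F
  F_le : ∀ i, F i ≤ mΩ
  F_zero : F 0 = ⊥
  X : ℕ → Ω → ℝ
  meas : ∀ i, 1 ≤ i → i ≤ n → StronglyMeasurable[F i] (X i)
  sq_int : ∀ i, 1 ≤ i → i ≤ n → Integrable (fun ω => (X i ω) ^ 2) P
  mean_zero : ∀ i, 1 ≤ i → i ≤ n → P[X i|F (i - 1)] =ᵐ[P] 0
  var_pos : ∀ i, 1 ≤ i → i ≤ n → 0 < ∫ ω, (X i ω) ^ 2 ∂P

namespace MDS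

variable {Ω : Type} [mΩ : MeasurableSpace Ω] {P : Measure Ω}

/-- `S_n = ∑_{i=1}^n X_i`. -/
noncomputable def S (A : MDS Ω P) : Ω → ℝ := fun ω => ∑ i ∈ Finset.Icc 1 A.n, A.X i ω

/-- `B_n² = ∑_{i=1}^n E[X_i²]`. -/
noncomputable def Bsq (A : MDS Ω P) : ℝ := ∑ i ∈ Finset.Icc 1 A.n, ∫ ω, (A.X i ω) ^ 2 ∂P

/-- `[S]_n = ∑_{i=1}^n X_i²`. -/
noncomputable def QV (A : MDS Ω P) : Ω → ℝ := fun ω => ∑ i ∈ Finset.Icc 1 A.n, (A.X i ω) ^ 2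

/-- `⟨S⟩_n = ∑_{i=1}^n E[X_i² | F_{i-1}]`. -/
noncomputable def CV (A : MDS Ω P) : Ω → ℝ :=
  fun ω => ∑ i ∈ Finset.Icc 1 A.n, (P[fun ω' => (A.X i ω') ^ 2|A.F (i - 1)]) ω

/-- `W_n = S_n / √[S]_n`. -/
noncomputable def W (A : MDS Ω P) : Ω → ℝ := fun ω => A.S ω / Real.sqrt (A.QV ω)

/-- Condition (A1): `|⟨S⟩_n − B_n²| ≤ δ² B_n²` a.s., with `δ ∈ [0, 1/4]`. -/
def CondA1 (A : MDS Ω P) (δ : ℝ) : Prop :=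
  0 ≤ δ ∧ δ ≤ 1 / 4 ∧ ∀ᵐ ω ∂P, |A.CV ω - A.Bsq| ≤ δ ^ 2 * A.Bsq

/-- Condition (A2): `∑_{i=1}^n E[|X_i|^{2+ρ} | F_{i-1}] ≤ ε^ρ B_n^{2+ρ}` a.s.,
with `ε ∈ (0, 1/4]`. -/
def CondA2 (A : MDS Ω P) (ρ ε : ℝ) : Prop :=
  0 < ε ∧ ε ≤ 1 / 4 ∧
    (∀ i, 1 ≤ i → i ≤ A.n → Integrable (fun ω => |A.X i ω| ^ (2 + ρ)) P) ∧
    ∀ᵐ ω ∂P,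
      ∑ i ∈ Finset.Icc 1 A.n, (P[fun ω' => |A.X i ω'| ^ (2 + ρ)|A.F (i - 1)]) ω ≤
        ε ^ ρ * A.Bsq ^ ((2 + ρ) / 2)

/-- Condition (A3): `E[X_i² | F_{i-1}] ≤ κ² B_n²` a.s. for each `i`, with `κ ∈ (0, 1/4]`. -/
def CondA3 (A : MDS Ω P) (κ : ℝ) : Prop :=
  0 < κ ∧ κ ≤ 1 / 4 ∧
    ∀ i, 1 ≤ i → i ≤ A.n →
      ∀ᵐ ω ∂P, (P[fun ω' => (A.X i ω') ^ 2|A.F (i - 1)]) ω ≤ κ ^ 2 * A.Bsq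

/-- Condition (A4): `E[|X_i|^{2+ρ} | F_{i-1}] ≤ (γ B_n)^ρ E[X_i² | F_{i-1}]` a.s.
for each `i`, with `γ ∈ (0, 1/4]`. -/
def CondA4 (A : MDS Ω P) (ρ γ : ℝ) : Prop :=
  0 < γ ∧ γ ≤ 1 / 4 ∧
    (∀ i, 1 ≤ i → i ≤ A.n → Integrable (fun ω => |A.X i ω| ^ (2 + ρ)) P) ∧
    ∀ i, 1 ≤ i → i ≤ A.n →
      ∀ᵐ ω ∂P,
        (P[fun ω' => |A.X i ω'| ^ (2 + ρ)|A.F (i - 1)]) ω ≤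
          (γ * Real.sqrt A.Bsq) ^ ρ * (P[fun ω' => (A.X i ω') ^ 2|A.F (i - 1)]) ω

end MDS



namespace Cram
open ProbabilityTheory Set

/-- standard normal density -/
noncomputable def phi (y : ℝ) : ℝ := (Real.sqrt (2 * Real.pi))⁻¹ * Real.exp (-(y ^ 2) / 2)

/-- standard normal measure -/
noncomputable def nu : Measure ℝ := gaussianReal 0 1

instance : IsProbabilityMeasure nu := by unfold nu; infer_instance

lemma phi_eq : phi = gaussianPDFReal 0 1 := by
  funext y; simp [phi, gaussianPDFReal_def]

lemma phi_pos (y : ℝ) : 0 < phi y := by unfold phi; positivity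

lemma phi_nonneg (y : ℝ) : 0 ≤ phi y := (phi_pos y).le

lemma sqrt_two_pi_ge : (1:ℝ) ≤ Real.sqrt (2 * Real.pi) := by
  rw [Real.one_le_sqrt]; nlinarith [Real.pi_gt_three]

lemma sqrt_two_pi_le : Real.sqrt (2 * Real.pi) ≤ 3 := by
  rw [Real.sqrt_le_left (by norm_num)]; nlinarith [Real.pi_lt_d2]

lemma phi_le (y : ℝ) : phi y ≤ Real.exp (-(y ^ 2) / 2) := by
  unfold phi
  have := inv_le_one_of_one_le₀ sqrt_two_pi_ge
  exact mul_le_of_le_one_left (Real.exp_pos _).le this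

lemma phi_le_one (y : ℝ) : phi y ≤ 1 := by
  refine (phi_le y).trans ?_
  rw [Real.exp_le_one_iff]; nlinarith [sq_nonneg y]

lemma phi_ge (y : ℝ) : Real.exp (-(y ^ 2) / 2) / 3 ≤ phi y := by
  unfold phi
  have h : (3:ℝ)⁻¹ ≤ (Real.sqrt (2 * Real.pi))⁻¹ :=
    inv_anti₀ (by linarith [sqrt_two_pi_ge]) sqrt_two_pi_le
  have := Real.exp_pos (-(y ^ 2) / 2)
  rw [div_eq_inv_mul]; gcongr

lemma phi_continuous : Continuous phi := by unfold phi; fun_prop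

lemma phi_integrable : Integrable phi := by rw [phi_eq]; exact integrable_gaussianPDFReal 0 1

lemma phi_integral : ∫ y, phi y = 1 := by
  rw [phi_eq]; exact integral_gaussianPDFReal_eq_one 0 one_ne_zero

lemma nu_real (s : Set ℝ) : nu.real s = ∫ y in s, phi y := by
  unfold nu
  rw [measureReal_def, gaussianReal_apply_eq_integral 0 one_ne_zero, phi_eq, ENNReal.toReal_ofReal]
  exact integral_nonneg fun y => gaussianPDFReal_nonneg 0 1 y

lemma integral_nu (f : ℝ → ℝ) : ∫ y, f y ∂nu = ∫ y, phi y * f y := by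
  unfold nu
  rw [integral_gaussianReal_eq_integral_smul one_ne_zero, phi_eq]; rfl

lemma Phi_eq (x : ℝ) : stdNormalCDF x = ∫ y in Iic x, phi y := by
  unfold stdNormalCDF phi; rw [integral_const_mul]

lemma Phi_eq_nu (x : ℝ) : stdNormalCDF x = nu.real (Iic x) := by rw [nu_real, Phi_eq]

lemma Phi_nonneg (x : ℝ) : 0 ≤ stdNormalCDF x := by rw [Phi_eq_nu]; positivity

lemma Phi_le_one (x : ℝ) : stdNormalCDF x ≤ 1 := by rw [Phi_eq_nu]; exact measureReal_le_one

lemma Phi_mono : Monotone stdNormalCDF := by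
  intro x y h; rw [Phi_eq_nu, Phi_eq_nu]
  exact measureReal_mono (Iic_subset_Iic.2 h)

lemma one_sub_Phi_Ioi (x : ℝ) : 1 - stdNormalCDF x = ∫ y in Ioi x, phi y := by
  have := integral_add_compl (μ := volume) (s := Iic x) measurableSet_Iic phi_integrable
  rw [compl_Iic, phi_integral, ← Phi_eq] at this
  linarith

lemma one_sub_Phi_Ici (x : ℝ) : 1 - stdNormalCDF x = ∫ y in Ici x, phi y := by
  rw [one_sub_Phi_Ioi, integral_Ici_eq_integral_Ioi]

lemma phi_neg (y : ℝ) : phi (-y) = phi y := by simp [phi]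

lemma Phi_neg (x : ℝ) : stdNormalCDF (-x) = 1 - stdNormalCDF x := by
  rw [one_sub_Phi_Ioi, Phi_eq, ← integral_comp_neg_Ioi]
  simp [phi_neg]

lemma Phi_hasDeriv (x : ℝ) : HasDerivAt stdNormalCDF (phi x) x := by
  have h : stdNormalCDF = fun x => stdNormalCDF 0 + ∫ y in (0:ℝ)..x, phi y := by
    funext z
    rw [← intervalIntegral.integral_Iic_sub_Iic phi_integrable.integrableOn
      phi_integrable.integrableOn, ← Phi_eq, ← Phi_eq]; ring
  rw [h]
  exact (intervalIntegral.integral_hasDerivAt_right (phi_continuous.intervalIntegrable _ _)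
    (phi_continuous.stronglyMeasurableAtFilter _ _) phi_continuous.continuousAt).const_add _

lemma phi_hasDeriv (x : ℝ) : HasDerivAt phi (-x * phi x) x := by
  have h1 : HasDerivAt (fun y : ℝ => -(y ^ 2) / 2) (-x) x := by
    have := ((hasDerivAt_pow 2 x).neg).div_const 2
    refine this.congr_deriv ?_
    norm_num; ring
  have := (h1.exp).const_mul ((Real.sqrt (2 * Real.pi))⁻¹)
  refine this.congr_deriv ?_
  unfold phi; ring

lemma Phi_continuous : Continuous stdNormalCDF :=
  continuous_iff_continuousAt.2 fun x => (Phi_hasDeriv x).continuousAt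

lemma Phi_lipschitz (s t : ℝ) : |stdNormalCDF t - stdNormalCDF s| ≤ |t - s| := by
  have := Convex.norm_image_sub_le_of_norm_hasDerivWithin_le (f := stdNormalCDF) (f' := phi)
    (s := univ) (C := 1) (x := s) (y := t) (fun x _ => (Phi_hasDeriv x).hasDerivWithinAt)
    (fun x _ => by rw [Real.norm_eq_abs, abs_of_nonneg (phi_nonneg x)]; exact phi_le_one x)
    convex_univ (mem_univ _) (mem_univ _)
  simpa using this

lemma integral_shift_Ioi (f : ℝ → ℝ) (h x : ℝ) :
    ∫ y in Ioi h, f (y + x) = ∫ y in Ioi (h + x), f y := by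
  rw [← integral_indicator measurableSet_Ioi, ← integral_indicator measurableSet_Ioi]
  rw [← integral_add_right_eq_self ((Ioi (h + x)).indicator fun y => f y) x]
  congr 1; funext y
  by_cases hy : h < y
  · rw [indicator_of_mem (by exact hy), indicator_of_mem (by simpa using hy)]
  · rw [indicator_of_notMem (by exact hy), indicator_of_notMem (by simpa using hy)]

/-- upper tail -/
lemma tail_le (y : ℝ) (hy : 0 ≤ y) : 1 - stdNormalCDF y ≤ Real.exp (-(y ^ 2) / 2) := by
  rw [one_sub_Phi_Ioi]
  have h1 : ∫ t in Ioi y, phi t = ∫ t in Ioi (0:ℝ), phi (t + y) := by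
    have := integral_shift_Ioi phi 0 y
    simpa using this.symm
  rw [h1]
  have h2 : ∀ t ∈ Ioi (0:ℝ), phi (t + y) ≤ Real.exp (-(y ^ 2) / 2) * phi t := by
    intro t ht
    have ht : 0 < t := ht
    unfold phi
    rw [mul_left_comm]
    gcongr
    rw [← Real.exp_add, Real.exp_le_exp]
    nlinarith [mul_nonneg ht.le hy]
  calc _ ≤ ∫ t in Ioi (0:ℝ), Real.exp (-(y ^ 2) / 2) * phi t := by
        apply setIntegral_mono_on _ _ measurableSet_Ioi h2
        · exact (phi_integrable.comp_add_right y).integrableOn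
        · exact (phi_integrable.const_mul _).integrableOn
    _ ≤ Real.exp (-(y ^ 2) / 2) * 1 := by
        rw [integral_const_mul, ← one_sub_Phi_Ioi]
        gcongr; linarith [Phi_nonneg 0]
    _ = _ := mul_one _

/-- Mills-type lower bound -/
lemma tail_ge (x : ℝ) (hx : 0 ≤ x) :
    Real.exp (-(x ^ 2) / 2) / (15 * (1 + x)) ≤ 1 - stdNormalCDF x := by
  have hx1 : 0 < 1 + x := by linarith
  set h := 1 / (1 + x) with hh
  have hpos : 0 < h := by positivity
  have hxh : x * h ≤ 1 := by rw [hh, mul_one_div, div_le_one hx1]; linarith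
  have hh1 : h ≤ 1 := by rw [hh, div_le_one hx1]; linarith
  have key : ∀ t ∈ Ioc x (x + h), Real.exp (-(x ^ 2) / 2) / 15 ≤ phi t := by
    intro t ht
    refine le_trans ?_ (phi_ge t)
    have : Real.exp (-(x ^ 2) / 2) * Real.exp (-(3/2)) ≤ Real.exp (-(t ^ 2) / 2) := by
      rw [← Real.exp_add, Real.exp_le_exp]
      nlinarith [ht.1, ht.2, mul_nonneg hx hpos.le]
    have h5 : (1:ℝ)/5 ≤ Real.exp (-(3/2)) := by
      rw [Real.exp_neg, ← one_div]
      apply one_div_le_one_div_of_le (Real.exp_pos _)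
      have : Real.exp (3/2) = Real.exp 1 * Real.exp (1/2) := by rw [← Real.exp_add]; norm_num
      have h2 : Real.exp (1/2) ≤ 1.7 := by
        have : Real.exp (1/2) ^ 2 = Real.exp 1 := by rw [← Real.exp_nat_mul]; norm_num
        have := Real.exp_one_lt_d9
        by_contra hc; push Not at hc
        nlinarith [Real.exp_pos (1/2)]
      rw [this]; nlinarith [Real.exp_one_lt_d9, Real.exp_pos 1, Real.exp_pos (1/2)]
    have := Real.exp_pos (-(x ^ 2) / 2)
    nlinarith
  rw [one_sub_Phi_Ioi]
  calc _ = ∫ t in Ioc x (x + h), Real.exp (-(x ^ 2) / 2) / 15 := by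
        simp [max_eq_left hpos.le]; rw [hh]; field_simp
    _ ≤ ∫ t in Ioc x (x + h), phi t := by
        apply setIntegral_mono_on _ phi_integrable.integrableOn measurableSet_Ioc key
        simp
    _ ≤ _ := by
        apply setIntegral_mono_set phi_integrable.integrableOn
        · exact Eventually.of_forall fun t => phi_nonneg t
        · exact (Ioc_subset_Ioi_self).eventuallyLE

lemma tail_pos (x : ℝ) : 0 < 1 - stdNormalCDF x := by
  rcases le_total 0 x with h | h
  · refine lt_of_lt_of_le ?_ (tail_ge x h); positivity
  · have := tail_ge 0 le_rfl
    have h2 := Phi_mono h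
    simp at this; linarith

lemma hazard (b t : ℝ) (hb : 0 ≤ b) (ht : t ≤ b) : phi t ≤ 15 * (1 + b) * (1 - stdNormalCDF t) := by
  rcases le_total 0 t with h | h
  · have := tail_ge t h
    rw [div_le_iff₀ (by positivity)] at this
    have h2 := phi_le t
    have h3 := tail_pos t
    nlinarith
  · have := tail_ge 0 le_rfl
    have h2 := Phi_mono h
    have h3 := phi_le_one t
    simp at this
    nlinarith

lemma tail_shift (b s t : ℝ) (hb : 0 ≤ b) (hst : s ≤ t) (ht : t ≤ b) :
    1 - stdNormalCDF s ≤ (1 - stdNormalCDF t) * Real.exp (15 * (1 + b) * (t - s)) := by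
  set K := 15 * (1 + b)
  have hmono : MonotoneOn (fun u => (1 - stdNormalCDF u) * Real.exp (K * u)) (Iic b) := by
    apply monotoneOn_of_deriv_nonneg (convex_Iic b)
    · have := Phi_continuous; fun_prop
    · intro u _
      exact ((((Phi_hasDeriv u).const_sub 1).mul
        (((hasDerivAt_id u).const_mul K).exp)).differentiableAt).differentiableWithinAt
    · intro u hu
      have hu : u ≤ b := by simpa using interior_subset hu
      have := ((((Phi_hasDeriv u).const_sub 1).mul
        (((hasDerivAt_id u).const_mul K).exp)))
      have hd := this.deriv
      have e : deriv (fun u => (1 - stdNormalCDF u) * Real.exp (K * u)) u = _ := hd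
      rw [e]
      simp only [id, mul_one]
      have := hazard b u hb hu
      have hE := Real.exp_pos (K * u)
      nlinarith
  have := hmono (mem_Iic.2 (hst.trans ht)) (mem_Iic.2 ht) hst
  simp only at this
  rw [mul_sub, Real.exp_sub, ← mul_div_assoc, le_div_iff₀ (Real.exp_pos _)]
  exact this

/-- exponential integral -/
lemma exp_tail (x h : ℝ) : ∫ y, (Ici h).indicator (fun y => Real.exp (-x * y)) y ∂nu
    = Real.exp (x ^ 2 / 2) * (1 - stdNormalCDF (x + h)) := by
  rw [integral_nu, one_sub_Phi_Ici, ← integral_const_mul]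
  have h1 : (fun y => phi y * (Ici h).indicator (fun y => Real.exp (-x * y)) y)
      = (Ici h).indicator (fun y => Real.exp (x ^ 2 / 2) * phi (y + x)) := by
    funext y
    by_cases hy : y ∈ Ici h
    · simp only [indicator_of_mem hy, phi]
      rw [mul_assoc, ← Real.exp_add, mul_left_comm, ← Real.exp_add]
      congr 2; ring
    · simp [indicator_of_notMem hy]
  rw [h1, integral_indicator measurableSet_Ici, integral_Ici_eq_integral_Ioi,
    integral_Ici_eq_integral_Ioi]
  have := integral_shift_Ioi (fun y => Real.exp (x ^ 2 / 2) * phi y) h x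
  rw [this, add_comm x h]

lemma kernel_nu (ρ t : ℝ) (hρ : 0 < ρ) :
    ∫ y, (ρ ^ 2 + (y - t) ^ 2)⁻¹ ∂nu ≤ 4 / ρ := by
  rw [integral_nu]
  have hbase : ∀ y : ℝ, (ρ ^ 2 + (y - t) ^ 2)⁻¹ = (ρ^2)⁻¹ * (1 + ((y - t) / ρ) ^ 2)⁻¹ := by
    intro y; rw [← mul_inv]; congr 1; field_simp
  have hint0 : Integrable (fun y : ℝ => (1 + ((y - t) / ρ) ^ 2)⁻¹) := by
    exact ((integrable_inv_one_add_sq).comp_div hρ.ne').comp_sub_right t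
  have hInt : Integrable (fun y : ℝ => (ρ ^ 2 + (y - t) ^ 2)⁻¹) := by
    simp_rw [hbase]; exact hint0.const_mul _
  calc _ ≤ ∫ y, (ρ ^ 2 + (y - t) ^ 2)⁻¹ := by
        apply integral_mono_of_nonneg _ hInt
        · refine Eventually.of_forall fun y => ?_
          exact mul_le_of_le_one_left (by positivity) (phi_le_one y)
        · exact Eventually.of_forall fun y => mul_nonneg (phi_nonneg y) (by positivity)
    _ = (ρ^2)⁻¹ * (ρ * Real.pi) := by
        simp_rw [hbase]
        rw [integral_const_mul]
        have e1 := integral_sub_right_eq_self (μ := volume) (fun y : ℝ => (1 + (y / ρ) ^ 2)⁻¹) t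
        rw [e1]
        have e2 := Measure.integral_comp_div (fun y : ℝ => (1 + y ^ 2)⁻¹) ρ
        rw [e2, integral_univ_inv_one_add_sq, abs_of_pos hρ]; rfl
    _ ≤ 4 / ρ := by
        rw [show (ρ^2)⁻¹ * (ρ * Real.pi) = Real.pi / ρ by field_simp]
        gcongr; linarith [Real.pi_lt_d2]

end Cram


namespace Cram
open ProbabilityTheory Set

lemma cubic_le_exp (s : ℝ) (hs : 0 ≤ s) : 1 + s + s ^ 2 / 2 + s ^ 3 / 6 ≤ Real.exp s := by
  have := Real.sum_le_exp_of_nonneg hs 4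
  simp [Finset.sum_range_succ, Nat.factorial] at this
  linarith

lemma mvt_aux (f f' : ℝ → ℝ) (K h : ℝ) (hf : ∀ s, HasDerivAt f (f' s) s)
    (hK : ∀ s, |s| ≤ |h| → s * h ≥ 0 → |f' s| ≤ K) (h0 : f 0 = 0) :
    ∀ s, |s| ≤ |h| → s * h ≥ 0 → |f s| ≤ K * |s| := by
  intro s hs hsh
  have key := Convex.norm_image_sub_le_of_norm_hasDerivWithin_le (f := f) (f' := f')
    (s := uIcc 0 s) (C := K) (x := 0) (y := s) (fun x _ => (hf x).hasDerivWithinAt)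
    (fun x hx => by
      rw [Real.norm_eq_abs]
      rcases le_total 0 s with h1 | h1
      · rw [uIcc_of_le h1] at hx
        rcases eq_or_lt_of_le h1 with h2 | h2
        · have : x = 0 := le_antisymm (by linarith [hx.2]) hx.1
          apply hK <;> simp [this]
        · have hh : 0 ≤ h := by by_contra hc; push Not at hc; nlinarith
          apply hK
          · rw [abs_of_nonneg hx.1]; rw [abs_of_nonneg h1] at hs; linarith [hx.2]
          · exact mul_nonneg hx.1 hh
      · rw [uIcc_of_ge h1] at hx
        rcases eq_or_lt_of_le h1 with h2 | h2
        · have : x = 0 := le_antisymm hx.2 (by linarith [hx.1])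
          apply hK <;> simp [this]
        · have hh : h ≤ 0 := by by_contra hc; push Not at hc; nlinarith
          apply hK
          · rw [abs_of_nonpos hx.2]; rw [abs_of_nonpos h1] at hs; linarith [hx.1]
          · exact mul_nonneg_of_nonpos_of_nonpos hx.2 hh)
    (convex_uIcc 0 s) left_mem_uIcc right_mem_uIcc
  simpa [h0] using key

/-- Third order Taylor with localized remainder -/
lemma taylor_Phi (z h : ℝ) :
    |stdNormalCDF (z + h) - stdNormalCDF z - phi z * h + z * phi z * h ^ 2 / 2|
      ≤ 64 * |h| ^ 3 / (1 + z ^ 2) := by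
  have hz2 : 0 < 1 + z ^ 2 := by positivity
  rcases le_or_gt (2 * |h|) (1 + |z|) with hc | hc
  · set K := 64 / (1 + z ^ 2) with hK
    have hder2 : ∀ y, HasDerivAt (fun y => -y * phi y) ((y ^ 2 - 1) * phi y) y := by
      intro y
      refine (((hasDerivAt_id y).neg).mul (phi_hasDeriv y)).congr_deriv ?_
      simp; ring
    have hb : ∀ s, |s| ≤ |h| → s * h ≥ 0 → |((z + s) ^ 2 - 1) * phi (z + s)| ≤ K := by
      intro s hs _
      set p := z + s
      have hzp : |z| ≤ 2 * |p| + 1 := by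
        have : |z| ≤ |p| + |s| := by
          have := abs_sub p s; simpa [p] using this
        linarith
      rw [hK, le_div_iff₀ hz2, abs_mul, abs_of_nonneg (phi_nonneg p)]
      have h1 : |p ^ 2 - 1| ≤ p ^ 2 + 1 := by rw [abs_le]; constructor <;> nlinarith [sq_nonneg p]
      have h2 : 1 + z ^ 2 ≤ 3 + 8 * p ^ 2 := by
        rw [← sq_abs z, ← sq_abs p]; nlinarith [abs_nonneg z, abs_nonneg p, sq_nonneg (|p| - 1), sq_nonneg (2 * |p| - 1)]
      have h3 := Real.quadratic_le_exp_of_nonneg (x := p ^ 2 / 2) (by positivity)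
      have h4 : phi p * Real.exp (p ^ 2 / 2) ≤ 1 := by
        calc _ ≤ Real.exp (-(p ^ 2) / 2) * Real.exp (p ^ 2 / 2) := by gcongr; exact phi_le p
          _ = 1 := by rw [← Real.exp_add]; simp; ring
      have h5 := phi_nonneg p
      calc |p ^ 2 - 1| * phi p * (1 + z ^ 2) ≤ (p ^ 2 + 1) * phi p * (3 + 8 * p ^ 2) := by gcongr
        _ = phi p * ((p ^ 2 + 1) * (3 + 8 * p ^ 2)) := by ring
        _ ≤ phi p * (64 * Real.exp (p ^ 2 / 2)) := by
            exact mul_le_mul_of_nonneg_left (by nlinarith [sq_nonneg p, sq_nonneg (p^2)]) h5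
        _ ≤ 64 := by linarith
    have r2 := mvt_aux (fun s => -(z + s) * phi (z + s) - (-z * phi z))
      (fun s => ((z + s) ^ 2 - 1) * phi (z + s)) K h
      (fun s => ((hder2 (z + s)).comp_const_add z s).sub_const _) hb (by simp)
    have r1 := mvt_aux (fun s => phi (z + s) - phi z - (-z * phi z) * s)
      (fun s => -(z + s) * phi (z + s) - (-z * phi z)) (K * |h|) h
      (fun s => by
        have := (((phi_hasDeriv (z + s)).comp_const_add z s).sub_const (phi z)).sub
          ((hasDerivAt_id s).const_mul (-z * phi z))
        refine this.congr_deriv ?_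
        simp)
      (fun s hs hs' => (r2 s hs hs').trans (by gcongr)) (by simp)
    have r0 := mvt_aux (fun s => stdNormalCDF (z + s) - stdNormalCDF z - phi z * s
        + z * phi z * s ^ 2 / 2)
      (fun s => phi (z + s) - phi z - (-z * phi z) * s) (K * |h| * |h|) h
      (fun s => by
        have := ((((Phi_hasDeriv (z + s)).comp_const_add z s).sub_const (stdNormalCDF z)).sub
          ((hasDerivAt_id s).const_mul (phi z))).add
          (((hasDerivAt_pow 2 s).const_mul (z * phi z)).div_const 2)
        refine this.congr_deriv ?_
        simp; ring)
      (fun s hs hs' => (r1 s hs hs').trans (by gcongr)) (by simp)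
    have := r0 h le_rfl (mul_self_nonneg h)
    refine this.trans (le_of_eq ?_)
    rw [hK]; ring
  · rw [le_div_iff₀ hz2]
    have hz := abs_nonneg z
    have hh : 0 < |h| := by linarith
    have hzs : z ^ 2 = |z| ^ 2 := (sq_abs z).symm
    have a1 : |stdNormalCDF (z + h) - stdNormalCDF z| ≤ 1 := by
      rw [abs_le]; constructor <;> linarith [Phi_nonneg z, Phi_nonneg (z+h), Phi_le_one z, Phi_le_one (z+h)]
    have a2 : |phi z * h| ≤ |h| := by
      rw [abs_mul, abs_of_nonneg (phi_nonneg z)]; exact mul_le_of_le_one_left (abs_nonneg _) (phi_le_one z)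
    have a3 : |z * phi z * h ^ 2 / 2| = |z| * phi z * |h| ^ 2 / 2 := by
      rw [abs_div, abs_mul, abs_mul, abs_of_nonneg (phi_nonneg z), abs_pow]; norm_num
    have a4 : phi z * (1 + z ^ 2) ≤ 2 := by
      have h3 := Real.add_one_le_exp (z ^ 2 / 2)
      have h4 : phi z * Real.exp (z ^ 2 / 2) ≤ 1 := by
        calc _ ≤ Real.exp (-(z ^ 2) / 2) * Real.exp (z ^ 2 / 2) := by gcongr; exact phi_le z
          _ = 1 := by rw [← Real.exp_add]; simp; ring
      nlinarith [phi_nonneg z, sq_nonneg z]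
    have tri : |stdNormalCDF (z + h) - stdNormalCDF z - phi z * h + z * phi z * h ^ 2 / 2|
        ≤ 1 + |h| + |z| * phi z * |h| ^ 2 / 2 := by
      rw [← a3]
      refine (abs_add_le _ _).trans ?_
      have := abs_sub (stdNormalCDF (z + h) - stdNormalCDF z) (phi z * h)
      linarith
    have b1 : 1 + z ^ 2 ≤ 8 * |h| ^ 3 := by
      have : (1 + |z|) ^ 3 ≤ (2 * |h|) ^ 3 := by gcongr
      rw [hzs]; nlinarith [mul_nonneg hz (mul_nonneg hz hz), mul_nonneg hz hz]
    have b2 : |h| * (1 + z ^ 2) ≤ 4 * |h| ^ 3 := by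
      have : (1 + |z|) ^ 2 ≤ (2 * |h|) ^ 2 := by gcongr
      have : 1 + z ^ 2 ≤ 4 * |h| ^ 2 := by rw [hzs]; nlinarith
      nlinarith
    have b3 : |z| * phi z * |h| ^ 2 / 2 * (1 + z ^ 2) ≤ 2 * |h| ^ 3 := by
      have : |z| ≤ 2 * |h| := by linarith
      calc _ = |z| * |h| ^ 2 / 2 * (phi z * (1 + z ^ 2)) := by ring
        _ ≤ (2 * |h|) * |h| ^ 2 / 2 * 2 := by
            gcongr; exact mul_nonneg (phi_nonneg z) (by positivity)
        _ = _ := by ring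
    calc _ ≤ (1 + |h| + |z| * phi z * |h| ^ 2 / 2) * (1 + z ^ 2) := by gcongr
      _ ≤ _ := by nlinarith [pow_pos hh 3]

lemma scale_aux (p : ℝ) (s : ℝ) (hs : -1 < s) :
    HasDerivAt (fun s => p / Real.sqrt (1 + s)) (-(p / Real.sqrt (1 + s)) / (2 * (1 + s))) s := by
  have h1 : 0 < 1 + s := by linarith
  have := (((hasDerivAt_id s).const_add 1).sqrt (by simpa using h1.ne'))
  have h2 := (hasDerivAt_const s p).div this (by simpa using (Real.sqrt_pos.2 h1).ne')
  refine h2.congr_deriv ?_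
  have h3 := Real.sq_sqrt h1.le
  have h4 := Real.sqrt_pos.2 h1
  simp only [id]
  field_simp
  rw [h3]; ring

lemma scale_d1 (p : ℝ) (s : ℝ) (hs : -1 < s) :
    HasDerivAt (fun s => stdNormalCDF (p / Real.sqrt (1 + s)))
      (-(p / Real.sqrt (1 + s)) * phi (p / Real.sqrt (1 + s)) / (2 * (1 + s))) s := by
  refine ((Phi_hasDeriv _).comp s (scale_aux p s hs)).congr_deriv ?_
  ring

lemma phi_mul_exp (p : ℝ) : phi p * Real.exp (p ^ 2 / 2) ≤ 1 := by
  calc _ ≤ Real.exp (-(p ^ 2) / 2) * Real.exp (p ^ 2 / 2) := by gcongr; exact phi_le p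
    _ = 1 := by rw [← Real.exp_add]; simp; ring

lemma scale_first (p s : ℝ) (hs : 0 ≤ s) :
    |stdNormalCDF (p / Real.sqrt (1 + s)) - stdNormalCDF p| ≤ s := by
  have := Convex.norm_image_sub_le_of_norm_hasDerivWithin_le
    (f := fun s => stdNormalCDF (p / Real.sqrt (1 + s)))
    (f' := fun s => -(p / Real.sqrt (1 + s)) * phi (p / Real.sqrt (1 + s)) / (2 * (1 + s)))
    (s := Ici 0) (C := 1) (x := 0) (y := s)
    (fun x hx => (scale_d1 p x (by have : 0 ≤ x := hx; linarith)).hasDerivWithinAt)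
    (fun x hx => by
      have hx : 0 ≤ x := hx
      set q := p / Real.sqrt (1 + x)
      rw [Real.norm_eq_abs, abs_div, abs_mul, abs_neg, abs_of_nonneg (phi_nonneg q),
        abs_of_nonneg (by linarith : 0 ≤ 2 * (1 + x)), div_le_iff₀ (by linarith)]
      have h3 := Real.add_one_le_exp (q ^ 2 / 2)
      have h4 := phi_mul_exp q
      have h5 : |q| ≤ 2 * (q ^ 2 / 2 + 1) := by
        rw [← sq_abs]; nlinarith [abs_nonneg q, sq_nonneg (|q| - 1)]
      have : |q| * phi q ≤ 2 := by
        have := phi_nonneg q; nlinarith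
      linarith)
    (convex_Ici 0) (by simp) hs
  simpa [abs_of_nonneg hs] using this

lemma scale_second (p s : ℝ) (hs : 0 ≤ s) (hs1 : s ≤ 1) :
    |stdNormalCDF (p / Real.sqrt (1 + s)) - stdNormalCDF p + s * (p * phi p) / 2|
      ≤ 48 * s ^ 2 / (1 + p ^ 2) := by
  set K := 48 / (1 + p ^ 2) with hK
  set g1 : ℝ → ℝ := fun s => -(p / Real.sqrt (1 + s)) * phi (p / Real.sqrt (1 + s)) / (2 * (1 + s))
  have hd2 : ∀ x, 0 ≤ x → HasDerivAt g1 (let q := p / Real.sqrt (1 + x);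
      ((1 - q ^ 2) * q / 4 + q / 2) * phi q / (1 + x) ^ 2) x := by
    intro x hx
    have h1 : 0 < 1 + x := by linarith
    have a := scale_aux p x (by linarith)
    have b := (phi_hasDeriv (p / Real.sqrt (1 + x))).comp x a
    have c := ((a.neg).mul b).div (((hasDerivAt_id x).const_add 1).const_mul 2)
      (by simpa using h1.ne')
    refine c.congr_deriv ?_
    simp only [id, Function.comp, Pi.neg_apply, Pi.mul_apply, Function.comp_apply]
    field_simp
    ring
  have hb : ∀ x ∈ Icc (0:ℝ) s, ‖(let q := p / Real.sqrt (1 + x);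
      ((1 - q ^ 2) * q / 4 + q / 2) * phi q / (1 + x) ^ 2)‖ ≤ K := by
    intro x hx
    have h1 : 0 < 1 + x := by linarith [hx.1]
    simp only
    set q := p / Real.sqrt (1 + x) with hq
    have hpq : p ^ 2 ≤ 2 * q ^ 2 := by
      rw [hq, div_pow, Real.sq_sqrt h1.le, ← mul_div_assoc, le_div_iff₀ h1]
      nlinarith [sq_nonneg p, hx.2]
    rw [Real.norm_eq_abs, abs_div, abs_mul, abs_of_nonneg (phi_nonneg q), abs_of_nonneg (by positivity : 0 ≤ (1 + x) ^ 2), hK]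
    have h2 : |(1 - q ^ 2) * q / 4 + q / 2| ≤ (q ^ 2 + 1) * (1 + q ^ 2) / 2 := by
      have e : (1 - q ^ 2) * q / 4 + q / 2 = q * (3 - q ^ 2) / 4 := by ring
      rw [e, abs_div, abs_mul]
      have h3 : |q| ≤ (1 + q ^ 2) / 2 := by
        rw [← sq_abs]; nlinarith [sq_nonneg (|q| - 1)]
      have h4 : |3 - q ^ 2| ≤ 3 * (q ^ 2 + 1) := by rw [abs_le]; constructor <;> nlinarith [sq_nonneg q]
      calc |q| * |3 - q ^ 2| / |4| ≤ (1 + q ^ 2) / 2 * (3 * (q ^ 2 + 1)) / |4| := by gcongr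
        _ ≤ _ := by norm_num; nlinarith [sq_nonneg q, sq_nonneg (q^2)]
    have h5 := cubic_le_exp (q ^ 2 / 2) (by positivity)
    have h6 := phi_mul_exp q
    have h7 := phi_nonneg q
    have h8 : (1:ℝ) ≤ (1 + x) ^ 2 := by nlinarith [hx.1]
    refine (div_le_self (by positivity) h8).trans ?_
    rw [le_div_iff₀ (by positivity)]
    calc _ ≤ (q ^ 2 + 1) * (1 + q ^ 2) / 2 * phi q * (1 + 2 * q ^ 2) := by gcongr
      _ = phi q * ((q ^ 2 + 1) * (1 + q ^ 2) / 2 * (1 + 2 * q ^ 2)) := by ring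
      _ ≤ phi q * (48 * Real.exp (q ^ 2 / 2)) := by
          exact mul_le_mul_of_nonneg_left (by nlinarith [sq_nonneg q, pow_nonneg (sq_nonneg q) 2, pow_nonneg (sq_nonneg q) 3]) h7
      _ ≤ 48 := by linarith
  have g10 : g1 0 = -(p * phi p) / 2 := by simp [g1]
  have r1 : ∀ x ∈ Icc (0:ℝ) s, ‖g1 x - g1 0‖ ≤ K * s := by
    intro x hx
    have := Convex.norm_image_sub_le_of_norm_hasDerivWithin_le (f := g1)
      (s := Icc 0 s) (C := K) (x := 0) (y := x)
      (fun y hy => (hd2 y hy.1).hasDerivWithinAt) hb (convex_Icc 0 s) (by simp [hs]) hx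
    refine this.trans ?_
    rw [sub_zero, Real.norm_eq_abs, abs_of_nonneg hx.1]
    gcongr; exact hx.2
  have := Convex.norm_image_sub_le_of_norm_hasDerivWithin_le
    (f := fun s => stdNormalCDF (p / Real.sqrt (1 + s)) - g1 0 * s)
    (f' := fun s => g1 s - g1 0)
    (s := Icc 0 s) (C := K * s) (x := 0) (y := s)
    (fun x hx => by
      have := (scale_d1 p x (by linarith [hx.1])).sub ((hasDerivAt_id x).const_mul (g1 0))
      simp only [mul_one] at this
      exact this.hasDerivWithinAt) r1 (convex_Icc 0 s) (by simp [hs]) (by simp [hs])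
  rw [Real.norm_eq_abs, Real.norm_eq_abs, sub_zero, abs_of_nonneg hs, g10] at this
  refine le_trans (le_of_eq ?_) (this.trans (le_of_eq ?_))
  · congr 1; simp; ring
  · rw [hK]; ring

end Cram


namespace Cram
open ProbabilityTheory Set

lemma lower_diff (ν1 ν2 : Measure ℝ) [IsProbabilityMeasure ν1] [IsProbabilityMeasure ν2] (D : ℝ)
    (hD : ∀ t, |ν1.real (Iic t) - ν2.real (Iic t)| ≤ D) (L : Set ℝ) (hL : IsLowerSet L) :
    |ν1.real L - ν2.real L| ≤ D := by
  have hD0 : 0 ≤ D := (abs_nonneg _).trans (hD 0)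
  rcases L.eq_empty_or_nonempty with h | hne
  · simp [h, hD0]
  by_cases hb : BddAbove L
  · by_cases hm : sSup L ∈ L
    · have : L = Iic (sSup L) := by
        ext y; exact ⟨fun hy => le_csSup hb hy, fun hy => hL hy hm⟩
      rw [this]; exact hD _
    · have hE : L = Iio (sSup L) := by
        ext y
        refine ⟨fun hy => lt_of_le_of_ne (le_csSup hb hy) (fun h => hm (h ▸ hy)), fun hy => ?_⟩
        obtain ⟨z, hz, hyz⟩ := exists_lt_of_lt_csSup hne hy
        exact hL hyz.le hz
      rw [hE]
      set a := sSup L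
      obtain ⟨u, hu1, hu2, hu3⟩ := exists_seq_strictMono_tendsto a
      have hU : ⋃ n, Iic (u n) = Iio a := iUnion_Iic_eq_Iio_of_lt_of_tendsto hu2 hu3
      have hm : Monotone fun n => Iic (u n) := fun i j h => Iic_subset_Iic.2 (hu1.monotone h)
      have T1 : ∀ ν : Measure ℝ, IsProbabilityMeasure ν →
          Tendsto (fun n => ν.real (Iic (u n))) atTop (𝓝 (ν.real (Iio a))) := by
        intro ν _
        have := tendsto_measure_iUnion_atTop (μ := ν) hm
        rw [hU] at this
        exact (ENNReal.tendsto_toReal (measure_ne_top ν _)).comp this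
      have T := ((T1 ν1 inferInstance).sub (T1 ν2 inferInstance)).abs
      exact le_of_tendsto T (Eventually.of_forall fun n => hD _)
  · have : L = univ := by
      rw [eq_univ_iff_forall]; intro y
      rw [not_bddAbove_iff] at hb
      obtain ⟨z, hz, hyz⟩ := hb y
      exact hL hyz.le hz
    simp [this, hD0]

lemma interval_diff (ν1 ν2 : Measure ℝ) [IsProbabilityMeasure ν1] [IsProbabilityMeasure ν2] (D : ℝ)
    (hD : ∀ t, |ν1.real (Iic t) - ν2.real (Iic t)| ≤ D) (I : Set ℝ) (hI : OrdConnected I) :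
    ν1.real I ≤ ν2.real I + 2 * D := by
  set A : Set ℝ := {y | ∃ z ∈ I, y ≤ z}
  set B : Set ℝ := {y | ∀ z ∈ I, y < z}
  have hA : IsLowerSet A := fun a b hab ⟨z, hz, h⟩ => ⟨z, hz, hab.trans h⟩
  have hB : IsLowerSet B := fun a b hab h z hz => hab.trans_lt (h z hz)
  rcases I.eq_empty_or_nonempty with h | ⟨w, hw⟩
  · have : 0 ≤ D := (abs_nonneg _).trans (hD 0)
    simp [h, this]
  have hBA : B ⊆ A := fun y hy => ⟨w, hw, (hy w hw).le⟩
  have hIe : I = A \ B := by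
    ext y; constructor
    · intro hy; exact ⟨⟨y, hy, le_rfl⟩, fun h => lt_irrefl _ (h y hy)⟩
    · rintro ⟨⟨z, hz, hyz⟩, h⟩
      have : ∃ z' ∈ I, z' ≤ y := by
        by_contra hc; push Not at hc; exact h fun z hz => hc z hz
      obtain ⟨z', hz', hz'y⟩ := this
      exact hI.out hz' hz ⟨hz'y, hyz⟩
  have hBm : MeasurableSet B := hB.ordConnected.measurableSet
  have e1 : ν1.real I = ν1.real A - ν1.real B := by rw [hIe]; exact measureReal_sdiff hBA hBm
  have e2 : ν2.real I = ν2.real A - ν2.real B := by rw [hIe]; exact measureReal_sdiff hBA hBm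
  have := abs_le.1 (lower_diff ν1 ν2 D hD A hA)
  have := abs_le.1 (lower_diff ν1 ν2 D hD B hB)
  rw [e1, e2]; linarith

lemma unimodal (ν1 ν2 : Measure ℝ) [IsProbabilityMeasure ν1] [IsProbabilityMeasure ν2] (D : ℝ)
    (hD : ∀ t, |ν1.real (Iic t) - ν2.real (Iic t)| ≤ D) (g : ℝ → ℝ) (G : ℝ)
    (hg : Measurable g) (h0 : ∀ y, 0 ≤ g y) (hG : ∀ y, g y ≤ G)
    (hu : ∀ s, OrdConnected {y | s ≤ g y}) :
    ∫ y, g y ∂ν1 ≤ ∫ y, g y ∂ν2 + 2 * D * G := by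
  have hG0 : 0 ≤ G := (h0 0).trans (hG 0)
  have int : ∀ ν : Measure ℝ, IsProbabilityMeasure ν → Integrable g ν := fun ν _ =>
    Integrable.of_bound hg.aestronglyMeasurable G (Eventually.of_forall fun y => by
      rw [Real.norm_eq_abs, abs_of_nonneg (h0 y)]; exact hG y)
  rw [(int ν1 inferInstance).integral_eq_integral_Ioc_meas_le (Eventually.of_forall h0)
      (Eventually.of_forall hG),
    (int ν2 inferInstance).integral_eq_integral_Ioc_meas_le (Eventually.of_forall h0)
      (Eventually.of_forall hG)]
  have anti : ∀ ν : Measure ℝ, IsProbabilityMeasure ν →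
      IntegrableOn (fun t => ν.real {a | t ≤ g a}) (Ioc 0 G) := by
    intro ν _
    have : Antitone (fun t => ν.real {a | t ≤ g a}) := fun s t hst =>
      measureReal_mono (fun a (ha : t ≤ g a) => (hst.trans ha : s ≤ g a))
    exact ((this.antitoneOn _).integrableOn_isCompact (isCompact_Icc (a := 0) (b := G))).mono_set Ioc_subset_Icc_self
  calc _ ≤ ∫ t in Ioc 0 G, (ν2.real {a | t ≤ g a} + 2 * D) := by
        apply setIntegral_mono (anti ν1 inferInstance)
          ((anti ν2 inferInstance).add (integrable_const _))
        intro t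
        exact interval_diff ν1 ν2 D hD _ (hu t)
    _ = _ := by
        rw [integral_add (anti ν2 inferInstance) (integrable_const _)]
        simp [hG0]; ring

lemma kernel_bound (ν1 : Measure ℝ) [IsProbabilityMeasure ν1] (D : ℝ)
    (hD : ∀ t, |ν1.real (Iic t) - stdNormalCDF t| ≤ D) (ρ t : ℝ) (hρ : 0 < ρ) :
    ∫ y, (ρ + (y - t) ^ 2)⁻¹ ∂ν1 ≤ 4 / Real.sqrt ρ + 2 * D / ρ := by
  have h := unimodal ν1 nu D (fun t => by rw [← Phi_eq_nu]; exact hD t)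
    (fun y => (ρ + (y - t) ^ 2)⁻¹) ρ⁻¹ (by fun_prop) (fun y => by positivity)
    (fun y => by
      apply inv_anti₀ hρ; nlinarith [sq_nonneg (y - t)])
    (fun s => ⟨fun a ha b hb z hz => by
      simp only [mem_setOf_eq] at *
      rcases le_total s 0 with h | h
      · exact h.trans (by positivity)
      rcases eq_or_lt_of_le h with h0 | h0
      · rw [← h0]; positivity
      · rw [le_inv_comm₀ h0 (by positivity)] at *
        rcases le_total z t with h1 | h1
        · nlinarith [hz.1, hz.2]
        · nlinarith [hz.1, hz.2]⟩)
  have h2 := kernel_nu (Real.sqrt ρ) t (Real.sqrt_pos.2 hρ)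
  rw [Real.sq_sqrt hρ.le] at h2
  have : 2 * D * ρ⁻¹ = 2 * D / ρ := by ring
  linarith

lemma exptail_cmp (ν1 ν2 : Measure ℝ) [IsProbabilityMeasure ν1] [IsProbabilityMeasure ν2] (D : ℝ)
    (hD : ∀ t, |ν1.real (Iic t) - ν2.real (Iic t)| ≤ D) (x h : ℝ) (hx : 0 ≤ x) :
    ∫ y, (Ici h).indicator (fun y => Real.exp (-x * y)) y ∂ν1
      ≤ ∫ y, (Ici h).indicator (fun y => Real.exp (-x * y)) y ∂ν2 + 2 * D * Real.exp (-x * h) := by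
  apply unimodal ν1 ν2 D hD
  · exact (by fun_prop : Measurable fun y : ℝ => Real.exp (-x * y)).indicator measurableSet_Ici
  · intro y; exact indicator_nonneg (fun _ _ => (Real.exp_pos _).le) y
  · intro y
    by_cases hy : y ∈ Ici h
    · rw [indicator_of_mem hy]; apply Real.exp_le_exp.2
      have : h ≤ y := hy
      nlinarith
    · rw [indicator_of_notMem hy]; positivity
  · intro s
    refine ⟨fun a ha b hb z hz => ?_⟩
    simp only [mem_setOf_eq] at *
    rcases le_total s 0 with h | h0
    · exact h.trans (indicator_nonneg (fun _ _ => (Real.exp_pos _).le) z)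
    rcases eq_or_lt_of_le h0 with h1 | h1
    · rw [← h1]; exact (indicator_nonneg (fun _ _ => (Real.exp_pos _).le) z)
    · have ha' : a ∈ Ici h := by
        by_contra hc; rw [indicator_of_notMem hc] at ha; linarith
      have ha2 : h ≤ a := ha'
      have hb' : b ∈ Ici h := (ha2.trans (hz.1.trans hz.2) : h ≤ b)
      have hz' : z ∈ Ici h := (ha2.trans hz.1 : h ≤ z)
      rw [indicator_of_mem hb'] at hb
      rw [indicator_of_mem hz']
      refine hb.trans (Real.exp_le_exp.2 ?_)
      nlinarith [hz.2]

lemma exptail_upper (ν1 : Measure ℝ) [IsProbabilityMeasure ν1] (D : ℝ)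
    (hD : ∀ t, |ν1.real (Iic t) - stdNormalCDF t| ≤ D) (x h : ℝ) (hx : 0 ≤ x) :
    ∫ y, (Ici h).indicator (fun y => Real.exp (-x * y)) y ∂ν1
      ≤ Real.exp (x ^ 2 / 2) * (1 - stdNormalCDF (x + h)) + 2 * D * Real.exp (-x * h) := by
  rw [← exp_tail]
  exact exptail_cmp ν1 nu D (fun t => by rw [← Phi_eq_nu]; exact hD t) x h hx

lemma exptail_lower (ν1 : Measure ℝ) [IsProbabilityMeasure ν1] (D : ℝ)
    (hD : ∀ t, |ν1.real (Iic t) - stdNormalCDF t| ≤ D) (x h : ℝ) (hx : 0 ≤ x) :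
    Real.exp (x ^ 2 / 2) * (1 - stdNormalCDF (x + h)) ≤
    ∫ y, (Ici h).indicator (fun y => Real.exp (-x * y)) y ∂ν1 + 2 * D * Real.exp (-x * h) := by
  rw [← exp_tail]
  exact exptail_cmp nu ν1 D (fun t => by rw [← Phi_eq_nu, abs_sub_comm]; exact hD t) x h hx

end Cram


namespace Cram
open ProbabilityTheory Set

lemma zphi_bound (z : ℝ) : |z * phi z / 2| ≤ 2 / (1 + z ^ 2) := by
  rw [le_div_iff₀ (by positivity), abs_div, abs_mul, abs_of_nonneg (phi_nonneg z)]
  have h3 := Real.quadratic_le_exp_of_nonneg (x := z ^ 2 / 2) (by positivity)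
  have h4 := phi_mul_exp z
  have h5 := phi_nonneg z
  have h6 : |z| ≤ (1 + z ^ 2) / 2 := by
    rw [← sq_abs]; nlinarith [sq_nonneg (|z| - 1)]
  have h7 : |z| * (1 + z ^ 2) / 2 ≤ 2 * Real.exp (z ^ 2 / 2) := by
    calc _ ≤ (1 + z ^ 2) / 2 * (1 + z ^ 2) / 2 := by gcongr
      _ ≤ _ := by nlinarith [sq_nonneg z]
  have h8 : |(2:ℝ)| = 2 := by norm_num
  rw [h8]
  calc |z| * phi z / 2 * (1 + z ^ 2) = phi z * (|z| * (1 + z ^ 2) / 2) := by ring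
    _ ≤ phi z * (2 * Real.exp (z ^ 2 / 2)) := mul_le_mul_of_nonneg_left h7 h5
    _ ≤ 2 := by linarith

lemma step_real (m ξ t r v γ : ℝ) (hγ : 0 < γ) (hr : γ ^ 2 ≤ r) (hv0 : 0 ≤ v) (hv : v ≤ γ ^ 2) :
    |stdNormalCDF ((t - (m + ξ)) / Real.sqrt r) - stdNormalCDF ((t - m) / Real.sqrt (r + v))
      + phi ((t - m) / Real.sqrt r) / Real.sqrt r * ξ
      + ((t - m) / Real.sqrt r) * phi ((t - m) / Real.sqrt r) / 2 / r * (ξ ^ 2 - v)|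
     ≤ 64 * ((1 / Real.sqrt r / (r + (t - m) ^ 2)) * |ξ| ^ 3) +
        48 * γ * ((1 / Real.sqrt r / (r + (t - m) ^ 2)) * v) := by
  have hr0 : 0 < r := lt_of_lt_of_le (by positivity) hr
  set q := Real.sqrt r with hq
  have hq0 : 0 < q := Real.sqrt_pos.2 hr0
  have hqq : q ^ 2 = r := Real.sq_sqrt hr0.le
  set z := (t - m) / q with hz
  have hγq : γ ≤ q := by rw [hq]; exact Real.le_sqrt_of_sq_le hr
  have e1 := taylor_Phi z (-ξ / q)
  have hs1 : v / r ≤ 1 := by rw [div_le_one hr0]; linarith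
  have e2 := scale_second z (v / r) (by positivity) hs1
  have a1 : (t - (m + ξ)) / q = z + -ξ / q := by rw [hz]; ring
  have a2 : (t - m) / Real.sqrt (r + v) = z / Real.sqrt (1 + v / r) := by
    have : r + v = r * (1 + v / r) := by field_simp
    rw [this, Real.sqrt_mul hr0.le, ← hq, hz, div_div]
  rw [a1, a2]
  have tm : r + (t - m) ^ 2 = q ^ 2 * (1 + z ^ 2) := by
    rw [hz, ← hqq]; field_simp
  have b1 : 64 * |(-ξ / q)| ^ 3 / (1 + z ^ 2) = 64 * ((1 / q / (r + (t - m) ^ 2)) * |ξ| ^ 3) := by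
    rw [tm, abs_div, abs_neg, abs_of_pos hq0]; field_simp
  have b2 : 48 * (v / r) ^ 2 / (1 + z ^ 2) ≤ 48 * γ * ((1 / q / (r + (t - m) ^ 2)) * v) := by
    rw [tm, ← hqq]
    have : 48 * (v / q ^ 2) ^ 2 / (1 + z ^ 2) = 48 * v * v / q ^ 4 / (1 + z ^ 2) := by
      field_simp
    rw [this]
    have h2 : 48 * γ * ((1 / q / (q ^ 2 * (1 + z ^ 2))) * v) = 48 * v * (γ * q) / q ^ 4 / (1 + z ^ 2) := by
      field_simp
    rw [h2]
    have : v ≤ γ * q := by nlinarith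
    gcongr
  rw [b1] at e1
  have e3 := e2.trans b2
  have eq : stdNormalCDF (z + -ξ / q) - stdNormalCDF (z / Real.sqrt (1 + v / r)) + phi z / q * ξ
      + z * phi z / 2 / r * (ξ ^ 2 - v)
      = (stdNormalCDF (z + -ξ / q) - stdNormalCDF z - phi z * (-ξ / q) + z * phi z * (-ξ / q) ^ 2 / 2)
       - (stdNormalCDF (z / Real.sqrt (1 + v / r)) - stdNormalCDF z + v / r * (z * phi z) / 2) := by
    rw [← hqq]; field_simp; ring
  rw [eq]
  exact (abs_sub _ _).trans (add_le_add e1 e3)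

/-- Hypotheses for the martingale Berry-Esseen bound, in integrated form. -/
structure BE {Ω : Type} [mΩ : MeasurableSpace Ω] (μ : Measure Ω) (F : ℕ → MeasurableSpace Ω)
    (n : ℕ) (ξ v : ℕ → Ω → ℝ) (γ κ δ : ℝ) : Prop where
  Fm : Monotone F
  Fle : ∀ i, F i ≤ mΩ
  γ0 : 0 < γ
  κ0 : 0 ≤ κ
  κ1 : κ ≤ 1
  ξm : ∀ i < n, Measurable[F (i + 1)] (ξ i)
  vm : ∀ i < n, Measurable[F i] (v i)
  v0 : ∀ i < n, ∀ ω, 0 ≤ v i ω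
  vγ : ∀ i < n, ∀ ω, v i ω ≤ γ ^ 2
  i3 : ∀ i < n, Integrable (fun ω => |ξ i ω| ^ 3) μ
  H1 : ∀ i < n, ∀ f : Ω → ℝ, Measurable[F i] f → ∀ C, (∀ ω, |f ω| ≤ C) → ∫ ω, f ω * ξ i ω ∂μ = 0
  H2 : ∀ i < n, ∀ f : Ω → ℝ, Measurable[F i] f → ∀ C, (∀ ω, |f ω| ≤ C) →
    |∫ ω, f ω * (ξ i ω ^ 2 - v i ω) ∂μ| ≤ κ * ∫ ω, |f ω| * v i ω ∂μ
  H3 : ∀ i < n, ∀ f : Ω → ℝ, Measurable[F i] f → ∀ C, (∀ ω, |f ω| ≤ C) → (∀ ω, 0 ≤ f ω) →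
    ∫ ω, f ω * |ξ i ω| ^ 3 ∂μ ≤ γ * ∫ ω, f ω * v i ω ∂μ
  HV : ∀ᵐ ω ∂μ, |∑ i ∈ Finset.range n, v i ω - 1| ≤ δ ^ 2

section
variable {Ω : Type} [mΩ : MeasurableSpace Ω] {μ : Measure Ω} [IsProbabilityMeasure μ]
  {F : ℕ → MeasurableSpace Ω} {n : ℕ} {ξ v : ℕ → Ω → ℝ} {γ κ δ : ℝ}

/-- partial sums -/
noncomputable def psum (ξ : ℕ → Ω → ℝ) (i : ℕ) (ω : Ω) : ℝ := ∑ j ∈ Finset.range i, ξ j ω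

lemma psum_meas' (m : MeasurableSpace Ω) (ξ : ℕ → Ω → ℝ) (i : ℕ) (h : ∀ j < i, Measurable[m] (ξ j)) :
    Measurable[m] (psum ξ i) := by
  unfold psum
  exact Finset.measurable_fun_sum _ (fun j hj => h j (Finset.mem_range.1 hj))

namespace BE

lemma Mm (H : BE μ F n ξ v γ κ δ) {i : ℕ} (hi : i ≤ n) : Measurable[F i] (psum ξ i) :=
  psum_meas' _ _ _ fun j hj => (H.ξm j (by omega)).mono (H.Fm (by omega)) le_rfl

lemma Vm (H : BE μ F n ξ v γ κ δ) {i k : ℕ} (hi : i ≤ n) (hk : i ≤ k + 1) : Measurable[F k] (psum v i) :=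
  psum_meas' _ _ _ fun j hj => (H.vm j (by omega)).mono (H.Fm (by omega)) le_rfl

lemma int1 (H : BE μ F n ξ v γ κ δ) {i : ℕ} (hi : i < n) : Integrable (ξ i) μ := by
  refine Integrable.mono' ((integrable_const (1:ℝ)).add (H.i3 i hi))
    ((H.ξm i hi).mono (H.Fle _) le_rfl).aestronglyMeasurable (Eventually.of_forall fun ω => ?_)
  simp only [Pi.add_apply, Real.norm_eq_abs]
  have := abs_nonneg (ξ i ω)
  nlinarith [sq_nonneg (|ξ i ω| - 1), mul_nonneg this (sq_nonneg (|ξ i ω| - 1))]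

lemma int2 (H : BE μ F n ξ v γ κ δ) {i : ℕ} (hi : i < n) : Integrable (fun ω => ξ i ω ^ 2) μ := by
  refine Integrable.mono' ((integrable_const (1:ℝ)).add (H.i3 i hi))
    (((H.ξm i hi).mono (H.Fle _) le_rfl).pow_const 2).aestronglyMeasurable
    (Eventually.of_forall fun ω => ?_)
  simp only [Pi.add_apply, Real.norm_eq_abs, abs_pow]
  have := abs_nonneg (ξ i ω)
  nlinarith [sq_nonneg (|ξ i ω| - 1), mul_nonneg this (sq_nonneg (|ξ i ω| - 1))]

lemma intv (H : BE μ F n ξ v γ κ δ) {i : ℕ} (hi : i < n) : Integrable (v i) μ :=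
  Integrable.of_bound ((H.vm i hi).mono (H.Fle _) le_rfl).aestronglyMeasurable (γ ^ 2)
    (Eventually.of_forall fun ω => by
      rw [Real.norm_eq_abs, abs_of_nonneg (H.v0 i hi ω)]; exact H.vγ i hi ω)

/-- unbounded multipliers -/
lemma H1' (H : BE μ F n ξ v γ κ δ) {i : ℕ} (hi : i < n) (f : Ω → ℝ) (hf : Measurable[F i] f)
    (hInt : Integrable (fun ω => f ω * ξ i ω) μ) : ∫ ω, f ω * ξ i ω ∂μ = 0 := by
  have T := tendsto_integral_of_dominated_convergence (μ := μ)
    (F := fun N : ℕ => fun ω => (max (-(N:ℝ)) (min (f ω) N)) * ξ i ω) (f := fun ω => f ω * ξ i ω)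
    (fun ω => ‖f ω * ξ i ω‖)
    (fun N => ((Measurable.max measurable_const ((hf.mono (H.Fle _) le_rfl).min measurable_const)).mul
      ((H.ξm i hi).mono (H.Fle _) le_rfl)).aestronglyMeasurable)
    hInt.norm
    (fun N => Eventually.of_forall fun ω => by
      simp only [norm_mul, Real.norm_eq_abs]
      refine mul_le_mul_of_nonneg_right ?_ (abs_nonneg _)
      have hN : (0:ℝ) ≤ N := Nat.cast_nonneg N
      rw [abs_le]
      constructor
      · rcases le_total 0 (f ω) with h | h
        · rw [abs_of_nonneg h]; apply le_max_of_le_right; apply le_min <;> linarith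
        · rw [abs_of_nonpos h]; apply le_max_of_le_right; apply le_min <;> linarith
      · apply max_le
        · linarith [abs_nonneg (f ω)]
        · exact (min_le_left _ _).trans (le_abs_self _))
    (Eventually.of_forall fun ω => by
      apply tendsto_const_nhds.congr'
      obtain ⟨N0, hN0⟩ := exists_nat_ge (|f ω|)
      filter_upwards [eventually_ge_atTop N0] with N hN
      have : |f ω| ≤ (N:ℝ) := hN0.trans (by exact_mod_cast hN)
      obtain ⟨h1, h2⟩ := abs_le.1 this
      rw [min_eq_left h2, max_eq_right h1])
  have hz : ∀ N : ℕ, ∫ ω, (max (-(N:ℝ)) (min (f ω) N)) * ξ i ω ∂μ = 0 := by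
    intro N
    refine H.H1 i hi _ (Measurable.max measurable_const (hf.min measurable_const)) N fun ω => ?_
    have hN : (0:ℝ) ≤ N := Nat.cast_nonneg N
    rw [abs_le]
    exact ⟨le_max_left _ _, max_le (by linarith) (min_le_right _ _)⟩
  simp only [hz] at T
  exact (tendsto_nhds_unique T tendsto_const_nhds)

end BE
end
end Cram


namespace Cram
open ProbabilityTheory Set

lemma int_bdd {Ω : Type} [mΩ : MeasurableSpace Ω] {μ : Measure Ω} {f g : Ω → ℝ}
    (hf : Measurable f) (C : ℝ) (hC : ∀ ω, |f ω| ≤ C) (hg : Integrable g μ) :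
    Integrable (fun ω => f ω * g ω) μ :=
  hg.bdd_mul (c := C) hf.aestronglyMeasurable (Eventually.of_forall hC)

lemma int_bdd' {Ω : Type} [mΩ : MeasurableSpace Ω] {μ : Measure Ω} [IsFiniteMeasure μ] {f : Ω → ℝ}
    (hf : Measurable f) (C : ℝ) (hC : ∀ ω, |f ω| ≤ C) : Integrable f μ :=
  Integrable.of_bound hf.aestronglyMeasurable C (Eventually.of_forall hC)

lemma addI {Ω : Type} [mΩ : MeasurableSpace Ω] {μ : Measure Ω} {f g : Ω → ℝ}
    (hf : Integrable f μ) (hg : Integrable g μ) : Integrable (fun ω => f ω + g ω) μ := hf.add hg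

lemma subI {Ω : Type} [mΩ : MeasurableSpace Ω] {μ : Measure Ω} {f g : Ω → ℝ}
    (hf : Integrable f μ) (hg : Integrable g μ) : Integrable (fun ω => f ω - g ω) μ := hf.sub hg

/-- remaining variance -/
noncomputable def rho {Ω : Type} (v : ℕ → Ω → ℝ) (a δ : ℝ) (i : ℕ) (ω : Ω) : ℝ :=
  max (1 + δ ^ 2 - psum v i ω) 0 + a ^ 2

/-- local error term -/
noncomputable def errA {Ω : Type} (ξ v : ℕ → Ω → ℝ) (γ κ a δ t : ℝ) (i : ℕ) (ω : Ω) : ℝ :=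
  v i ω * (κ + γ / Real.sqrt (rho v a δ (i + 1) ω)) /
    (rho v a δ (i + 1) ω + (t - psum ξ i ω) ^ 2)

lemma rho_ge {Ω : Type} (v : ℕ → Ω → ℝ) (a δ : ℝ) (i : ℕ) (ω : Ω) : a ^ 2 ≤ rho v a δ i ω := by
  unfold rho; linarith [le_max_right (1 + δ ^ 2 - psum v i ω) 0]

namespace BE
variable {Ω : Type} [mΩ : MeasurableSpace Ω] {μ : Measure Ω} [IsProbabilityMeasure μ]
  {F : ℕ → MeasurableSpace Ω} {n : ℕ} {ξ v : ℕ → Ω → ℝ} {γ κ δ : ℝ}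

lemma ML2 (H : BE μ F n ξ v γ κ δ) {k : ℕ} (hk : k ≤ n) : MemLp (psum ξ k) 2 μ := by
  have : psum ξ k = fun ω => ∑ j ∈ Finset.range k, ξ j ω := rfl
  rw [this]
  refine memLp_finsetSum _ fun j hj => ?_
  have hj' : j < n := by have := Finset.mem_range.1 hj; omega
  rw [memLp_two_iff_integrable_sq ((H.ξm j hj').mono (H.Fle _) le_rfl).aestronglyMeasurable]
  exact H.int2 hj'

lemma xL2 (H : BE μ F n ξ v γ κ δ) {k : ℕ} (hk : k < n) : MemLp (ξ k) 2 μ := by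
  rw [memLp_two_iff_integrable_sq ((H.ξm k hk).mono (H.Fle _) le_rfl).aestronglyMeasurable]
  exact H.int2 hk

lemma Msq_int (H : BE μ F n ξ v γ κ δ) {k : ℕ} (hk : k ≤ n) (t : ℝ) :
    Integrable (fun ω => (psum ξ k ω - t) ^ 2) μ :=
  ((H.ML2 hk).sub (memLp_const t)).integrable_sq

lemma intV (H : BE μ F n ξ v γ κ δ) {k : ℕ} (hk : k ≤ n) : Integrable (psum v k) μ :=
  integrable_finsetSum _ fun j hj => H.intv (by have := Finset.mem_range.1 hj; omega)

lemma mom2 (H : BE μ F n ξ v γ κ δ) (t : ℝ) {i k : ℕ} (hik : i ≤ k) (hk : k ≤ n) (f : Ω → ℝ)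
    (hf : Measurable[F i] f) (C : ℝ) (hC : ∀ ω, |f ω| ≤ C) (hf0 : ∀ ω, 0 ≤ f ω) :
    ∫ ω, f ω * (psum ξ k ω - t) ^ 2 ∂μ ≤
      ∫ ω, f ω * (psum ξ i ω - t) ^ 2 ∂μ + 2 * ∫ ω, f ω * (psum v k ω - psum v i ω) ∂μ := by
  induction k, hik using Nat.le_induction with
  | base => simp
  | succ k hik ih =>
    have hkn : k < n := by omega
    have ih := ih hkn.le
    have hfm : Measurable f := hf.mono (H.Fle _) le_rfl
    have hfk : Measurable[F k] f := hf.mono (H.Fm hik) le_rfl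
    have e1 : ∀ ω, f ω * (psum ξ (k + 1) ω - t) ^ 2 = f ω * (psum ξ k ω - t) ^ 2 +
        ((2 * f ω * (psum ξ k ω - t)) * ξ k ω + (f ω * (ξ k ω ^ 2 - v k ω) + f ω * v k ω)) := by
      intro ω; simp only [psum, Finset.sum_range_succ]; ring
    have e2 : ∀ ω, f ω * (psum v (k + 1) ω - psum v i ω) =
        f ω * (psum v k ω - psum v i ω) + f ω * v k ω := by
      intro ω; simp only [psum, Finset.sum_range_succ]; ring
    have i0 : Integrable (fun ω => f ω * (psum ξ k ω - t) ^ 2) μ :=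
      int_bdd hfm C hC (H.Msq_int hkn.le t)
    have i1 : Integrable (fun ω => (2 * f ω * (psum ξ k ω - t)) * ξ k ω) μ := by
      have : Integrable (fun ω => (psum ξ k ω - t) * ξ k ω) μ :=
        ((H.ML2 hkn.le).sub (memLp_const t)).integrable_mul (H.xL2 hkn)
      refine ((int_bdd hfm C hC this).const_mul 2).congr (Eventually.of_forall fun ω => ?_)
      simp only; ring
    have i2 : Integrable (fun ω => f ω * (ξ k ω ^ 2 - v k ω)) μ :=
      int_bdd hfm C hC ((H.int2 hkn).sub (H.intv hkn))
    have i3 : Integrable (fun ω => f ω * v k ω) μ := int_bdd hfm C hC (H.intv hkn)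
    have i4 : Integrable (fun ω => f ω * (psum v k ω - psum v i ω)) μ :=
      int_bdd hfm C hC ((H.intV hkn.le).sub (H.intV (by omega)))
    simp only [e1, e2]
    rw [integral_add i0 (addI i1 (addI i2 i3)), integral_add i1 (addI i2 i3), integral_add i2 i3,
      integral_add i4 i3]
    have z1 : ∫ ω, (2 * f ω * (psum ξ k ω - t)) * ξ k ω ∂μ = 0 :=
      H.H1' hkn _ ((hfk.const_mul 2).mul ((H.Mm hkn.le).sub_const t)) i1
    have z2 := (le_abs_self _).trans (H.H2 k hkn f hfk C hC)
    have z3 : ∫ ω, |f ω| * v k ω ∂μ = ∫ ω, f ω * v k ω ∂μ := by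
      congr 1; funext ω; rw [abs_of_nonneg (hf0 ω)]
    have z4 : 0 ≤ ∫ ω, f ω * v k ω ∂μ :=
      integral_nonneg fun ω => mul_nonneg (hf0 ω) (H.v0 k hkn ω)
    rw [z3] at z2
    have := H.κ1
    nlinarith

lemma Vle (H : BE μ F n ξ v γ κ δ) : ∀ᵐ ω ∂μ, ∀ i ≤ n, psum v i ω ≤ 1 + δ ^ 2 := by
  filter_upwards [H.HV] with ω hω i hi
  have h1 : psum v i ω ≤ psum v n ω :=
    Finset.sum_le_sum_of_subset_of_nonneg (Finset.range_mono hi)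
      (fun j hj _ => H.v0 j (Finset.mem_range.1 hj) ω)
  have := (abs_le.1 hω).2
  unfold psum at *; linarith

lemma rho_succ (H : BE μ F n ξ v γ κ δ) (a : ℝ) :
    ∀ᵐ ω ∂μ, ∀ i < n, rho v a δ i ω = rho v a δ (i + 1) ω + v i ω := by
  filter_upwards [H.Vle] with ω hω i hi
  have h1 := hω i hi.le
  have h2 := hω (i + 1) hi
  unfold rho
  rw [max_eq_left (by linarith), max_eq_left (by linarith)]
  simp only [psum, Finset.sum_range_succ]; ring

lemma rho_meas (H : BE μ F n ξ v γ κ δ) (a : ℝ) {i k : ℕ} (hi : i ≤ n) (hk : i ≤ k + 1) :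
    Measurable[F k] (rho v a δ i) := by
  unfold rho
  exact (Measurable.max (measurable_const.sub (H.Vm hi hk)) measurable_const).add_const _

lemma step (H : BE μ F n ξ v γ κ δ) (t a : ℝ) (hγa : γ ≤ a) {i : ℕ} (hi : i < n) :
    |∫ ω, stdNormalCDF ((t - psum ξ (i + 1) ω) / Real.sqrt (rho v a δ (i + 1) ω)) ∂μ -
      ∫ ω, stdNormalCDF ((t - psum ξ i ω) / Real.sqrt (rho v a δ i ω)) ∂μ| ≤
    112 * ∫ ω, errA ξ v γ κ a δ t i ω ∂μ := by
  have hγ := H.γ0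
  have ha : 0 < a := lt_of_lt_of_le hγ hγa
  set r := rho v a δ (i + 1) with hr
  have hra : ∀ ω, a ^ 2 ≤ r ω := rho_ge v a δ (i + 1)
  have hr0 : ∀ ω, 0 < r ω := fun ω => lt_of_lt_of_le (by positivity) (hra ω)
  have hsa : ∀ ω, a ≤ Real.sqrt (r ω) := fun ω => Real.le_sqrt_of_sq_le (hra ω)
  have hs0 : ∀ ω, 0 < Real.sqrt (r ω) := fun ω => lt_of_lt_of_le ha (hsa ω)
  have rm : Measurable[F i] r := H.rho_meas a (by omega) le_rfl
  have Mm : Measurable[F i] (psum ξ i) := H.Mm hi.le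
  have sm : Measurable[F i] (fun ω => Real.sqrt (r ω)) := rm.sqrt
  set z : Ω → ℝ := fun ω => (t - psum ξ i ω) / Real.sqrt (r ω) with hz
  have zm : Measurable[F i] z := (measurable_const.sub Mm).div sm
  have pm : Measurable[F i] (fun ω => phi (z ω)) := phi_continuous.measurable.comp zm
  set w : Ω → ℝ := fun ω => r ω + (t - psum ξ i ω) ^ 2 with hw
  have wm : Measurable[F i] w := rm.add ((measurable_const.sub Mm).pow_const 2)
  have hwa : ∀ ω, a ^ 2 ≤ w ω := fun ω => by have := hra ω; simp only [hw]; nlinarith [sq_nonneg (t - psum ξ i ω)]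
  have hw0 : ∀ ω, 0 < w ω := fun ω => lt_of_lt_of_le (by positivity) (hwa ω)
  set f1 : Ω → ℝ := fun ω => phi (z ω) / Real.sqrt (r ω) with hf1
  set f2 : Ω → ℝ := fun ω => z ω * phi (z ω) / 2 / r ω with hf2
  set f3 : Ω → ℝ := fun ω => 1 / Real.sqrt (r ω) / w ω with hf3
  have f1m : Measurable[F i] f1 := pm.div sm
  have f2m : Measurable[F i] f2 := ((zm.mul pm).div_const 2).div rm
  have f3m : Measurable[F i] f3 := (measurable_const.div sm).div wm
  have f1b : ∀ ω, |f1 ω| ≤ 1 / a := fun ω => by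
    rw [abs_of_nonneg (div_nonneg (phi_nonneg _) (hs0 ω).le)]
    exact div_le_div₀ zero_le_one (phi_le_one _) ha (hsa ω)
  have hwr : ∀ ω, w ω = r ω * (1 + z ω ^ 2) := fun ω => by
    simp only [hw, hz, div_pow, Real.sq_sqrt (hr0 ω).le]
    have := hr0 ω
    field_simp
  have f2w : ∀ ω, |f2 ω| ≤ 2 / w ω := fun ω => by
    have := zphi_bound (z ω)
    simp only [hf2]
    rw [abs_div, abs_of_pos (hr0 ω), hwr ω, div_le_iff₀ (hr0 ω)]
    refine this.trans (le_of_eq ?_)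
    have := hr0 ω
    field_simp
  have f2b : ∀ ω, |f2 ω| ≤ 2 / a ^ 2 := fun ω =>
    (f2w ω).trans (by gcongr; exact hwa ω)
  have f30 : ∀ ω, 0 ≤ f3 ω := fun ω => by
    have := hs0 ω; have := hw0 ω; simp only [hf3]; positivity
  have f3b : ∀ ω, |f3 ω| ≤ 1 / a / a ^ 2 := fun ω => by
    rw [abs_of_nonneg (f30 ω)]
    simp only [hf3]
    have := hsa ω; have := hwa ω
    gcongr
  have hx1 := H.int1 hi
  have hx2 := H.int2 hi
  have hvi := H.intv hi
  have up : ∀ {f : Ω → ℝ}, Measurable[F i] f → Measurable f := fun h => h.mono (H.Fle _) le_rfl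
  have j1 : Integrable (fun ω => f1 ω * ξ i ω) μ := int_bdd (up f1m) _ f1b hx1
  have j2 : Integrable (fun ω => f2 ω * (ξ i ω ^ 2 - v i ω)) μ := int_bdd (up f2m) _ f2b (hx2.sub hvi)
  have j3 : Integrable (fun ω => f3 ω * |ξ i ω| ^ 3) μ := int_bdd (up f3m) _ f3b (H.i3 i hi)
  have j4 : Integrable (fun ω => f3 ω * v i ω) μ := int_bdd (up f3m) _ f3b hvi
  have j5 : Integrable (fun ω => |f2 ω| * v i ω) μ :=
    int_bdd (up f2m).abs _ (fun ω => by rw [abs_abs]; exact f2b ω) hvi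
  have Ub : ∀ y, |stdNormalCDF y| ≤ 1 := fun y => by
    rw [abs_of_nonneg (Phi_nonneg y)]; exact Phi_le_one y
  have k1 : Integrable (fun ω => stdNormalCDF ((t - psum ξ (i + 1) ω) / Real.sqrt (r ω))) μ :=
    int_bdd' (Phi_continuous.measurable.comp ((measurable_const.sub
      ((H.Mm (i := i + 1) hi).mono (H.Fle _) le_rfl)).div (up sm))) 1 (fun ω => Ub _)
  have k0 : Integrable (fun ω => stdNormalCDF ((t - psum ξ i ω) / Real.sqrt (rho v a δ i ω))) μ :=
    int_bdd' (Phi_continuous.measurable.comp ((measurable_const.sub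
      (up Mm)).div (up (H.rho_meas a hi.le (by omega)).sqrt))) 1 (fun ω => Ub _)
  set A : Ω → ℝ := fun ω => stdNormalCDF ((t - psum ξ (i + 1) ω) / Real.sqrt (r ω)) -
    stdNormalCDF ((t - psum ξ i ω) / Real.sqrt (rho v a δ i ω)) + f1 ω * ξ i ω +
    f2 ω * (ξ i ω ^ 2 - v i ω) with hA
  have hAle : ∀ᵐ ω ∂μ, |A ω| ≤ 64 * (f3 ω * |ξ i ω| ^ 3) + 48 * γ * (f3 ω * v i ω) := by
    filter_upwards [H.rho_succ a] with ω hω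
    have e := hω i hi
    have := step_real (psum ξ i ω) (ξ i ω) t (r ω) (v i ω) γ hγ
      (le_trans (by gcongr) (hra ω)) (H.v0 i hi ω) (H.vγ i hi ω)
    simp only [hA]
    rw [e]
    have e2 : psum ξ (i + 1) ω = psum ξ i ω + ξ i ω := by simp [psum, Finset.sum_range_succ]
    rw [e2]
    exact this
  have Aint : ∫ ω, A ω ∂μ = ∫ ω, stdNormalCDF ((t - psum ξ (i + 1) ω) / Real.sqrt (r ω)) ∂μ -
      ∫ ω, stdNormalCDF ((t - psum ξ i ω) / Real.sqrt (rho v a δ i ω)) ∂μ +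
      ∫ ω, f2 ω * (ξ i ω ^ 2 - v i ω) ∂μ := by
    simp only [hA]
    rw [integral_add (addI (subI k1 k0) j1) j2, integral_add (subI k1 k0) j1, integral_sub k1 k0,
      H.H1 i hi f1 f1m _ f1b, add_zero]
  have Ab : |∫ ω, A ω ∂μ| ≤ 64 * ∫ ω, f3 ω * |ξ i ω| ^ 3 ∂μ + 48 * γ * ∫ ω, f3 ω * v i ω ∂μ := by
    rw [← integral_const_mul, ← integral_const_mul, ← integral_add (j3.const_mul _) (j4.const_mul _)]
    have := norm_integral_le_of_norm_le (f := A) ((j3.const_mul 64).add (j4.const_mul (48 * γ)))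
      (by simpa only [Real.norm_eq_abs, Pi.add_apply] using hAle)
    simpa using this
  have h3 := H.H3 i hi f3 f3m _ f3b f30
  have h2 := H.H2 i hi f2 f2m _ f2b
  have final : 112 * γ * ∫ ω, f3 ω * v i ω ∂μ + κ * ∫ ω, |f2 ω| * v i ω ∂μ ≤
      112 * ∫ ω, errA ξ v γ κ a δ t i ω ∂μ := by
    rw [← integral_const_mul, ← integral_const_mul, ← integral_const_mul,
      ← integral_add (j4.const_mul _) (j5.const_mul _)]
    have hb1 : ∀ ω, errA ξ v γ κ a δ t i ω = κ * (v i ω / w ω) + γ * (f3 ω * v i ω) := fun ω => by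
      simp only [errA, hf3, hw, ← hr]; ring
    have j6 : Integrable (fun ω => v i ω / w ω) μ := by
      have := int_bdd (μ := μ) (f := fun ω => 1 / w ω) (up (measurable_const.div wm)) (1 / a ^ 2)
        (fun ω => by rw [abs_of_nonneg (by have := hw0 ω; positivity)]
                     have := hwa ω; gcongr) hvi
      refine this.congr (Eventually.of_forall fun ω => ?_)
      simp only; ring
    have j7 : Integrable (fun ω => 112 * errA ξ v γ κ a δ t i ω) μ := by
      simp only [hb1]; exact ((j6.const_mul _).add (j4.const_mul _)).const_mul _
    refine integral_mono ((j4.const_mul _).add (j5.const_mul _)) j7 fun ω => ?_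
    simp only [Pi.add_apply]
    rw [hb1]
    have q1 : |f2 ω| * v i ω ≤ 2 * (v i ω / w ω) := by
      calc _ ≤ 2 / w ω * v i ω := mul_le_mul_of_nonneg_right (f2w ω) (H.v0 i hi ω)
        _ = _ := by ring
    have q2 : 0 ≤ v i ω / w ω := div_nonneg (H.v0 i hi ω) (hw0 ω).le
    have := H.κ0
    nlinarith
  rw [Aint] at Ab
  obtain ⟨p1, p2⟩ := abs_le.1 Ab
  obtain ⟨p3, p4⟩ := abs_le.1 h2
  refine abs_le.2 ⟨?_, ?_⟩ <;> nlinarith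

end BE
end Cram


namespace Cram
open ProbabilityTheory Set

/-- kernel integrand -/
noncomputable def ker (κ γ b ρ : ℝ) : ℝ := (κ + γ / Real.sqrt ρ) / (ρ + b)

lemma ker_nonneg {κ γ b ρ : ℝ} (hκ : 0 ≤ κ) (hγ : 0 ≤ γ) (hb : 0 ≤ b) (hρ : 0 < ρ) :
    0 ≤ ker κ γ b ρ := by
  unfold ker; have := Real.sqrt_nonneg ρ; positivity

lemma ker_anti {κ γ b : ℝ} (hκ : 0 ≤ κ) (hγ : 0 ≤ γ) (hb : 0 ≤ b) {x y : ℝ} (hx : 0 < x)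
    (hxy : x ≤ y) : ker κ γ b y ≤ ker κ γ b x := by
  unfold ker
  have h1 := Real.sqrt_pos.2 hx
  have h2 := Real.sqrt_le_sqrt hxy
  have : 0 < x + b := by linarith
  gcongr

lemma ker_int {κ γ b : ℝ} (hκ : 0 ≤ κ) (hγ : 0 ≤ γ) (hb : 0 ≤ b) {x y : ℝ} (hx : 0 < x)
    (hxy : x ≤ y) : IntervalIntegrable (ker κ γ b) volume x y := by
  apply AntitoneOn.intervalIntegrable
  intro p hp q hq hpq
  rw [uIcc_of_le hxy] at hp hq
  exact ker_anti hκ hγ hb (by linarith [hp.1]) hpq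

lemma ker_step {κ γ b : ℝ} (hκ : 0 ≤ κ) (hγ : 0 ≤ γ) (hb : 0 ≤ b) {r v : ℝ} (hr : 0 < r)
    (hv : 0 ≤ v) (hvr : v ≤ r) : v * ker κ γ b r ≤ 4 * ∫ ρ in r..(r + v), ker κ γ b ρ := by
  have h1 : v * ker κ γ b (r + v) ≤ ∫ ρ in r..(r + v), ker κ γ b ρ := by
    have := intervalIntegral.integral_mono_on (a := r) (b := r + v) (by linarith)
      (intervalIntegrable_const (c := ker κ γ b (r + v)))
      (ker_int hκ hγ hb hr (by linarith)) (fun x hx => ker_anti hκ hγ hb (by linarith [hx.1]) hx.2)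
    simpa using this
  have h2 : ker κ γ b r ≤ 4 * ker κ γ b (r + v) := by
    unfold ker
    have h1 := Real.sqrt_pos.2 hr
    have h3 : Real.sqrt (r + v) ≤ 2 * Real.sqrt r := by
      rw [Real.sqrt_le_left (by positivity), mul_pow, Real.sq_sqrt hr.le]; linarith
    have h4 : 0 < Real.sqrt (r + v) := Real.sqrt_pos.2 (by linarith)
    have h5 : γ / Real.sqrt r ≤ 2 * (γ / Real.sqrt (r + v)) := by
      rw [← mul_div_assoc, div_le_div_iff₀ h1 h4]; nlinarith
    have h6 : 0 ≤ γ / Real.sqrt (r + v) := by positivity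
    rw [← mul_div_assoc, div_le_div_iff₀ (by linarith) (by linarith)]
    calc (κ + γ / Real.sqrt r) * (r + v + b) ≤ (2 * (κ + γ / Real.sqrt (r + v))) * (2 * (r + b)) := by
          gcongr <;> linarith
      _ = _ := by ring
  nlinarith

lemma ker_sum {κ γ b a : ℝ} (hκ : 0 ≤ κ) (hγ : 0 ≤ γ) (hb : 0 ≤ b) (ha : 0 < a) (n : ℕ)
    (r v : ℕ → ℝ) (hv : ∀ i < n, 0 ≤ v i) (hva : ∀ i < n, v i ≤ a ^ 2) (hra : ∀ i ≤ n, a ^ 2 ≤ r i)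
    (hr : ∀ i < n, r i = r (i + 1) + v i) :
    ∑ i ∈ Finset.range n, v i * ker κ γ b (r (i + 1)) ≤ 4 * ∫ ρ in (a ^ 2)..(r 0), ker κ γ b ρ := by
  have ha2 : 0 < a ^ 2 := by positivity
  have key : ∀ k ≤ n, r k ≤ r 0 ∧ ∑ i ∈ Finset.range k, v i * ker κ γ b (r (i + 1)) ≤
      4 * ∫ ρ in (r k)..(r 0), ker κ γ b ρ := by
    intro k
    induction k with
    | zero => intro _; simp
    | succ k ih =>
      intro hk
      obtain ⟨i1, i2⟩ := ih (by omega)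
      have e := hr k (by omega)
      have hvk := hv k (by omega)
      have hrk := hra (k + 1) hk
      have hrk' := hra k (by omega)
      refine ⟨by linarith, ?_⟩
      rw [Finset.sum_range_succ]
      have s := ker_step hκ hγ hb (r := r (k + 1)) (by linarith) hvk ((hva k (by omega)).trans hrk)
      rw [← e] at s
      rw [← intervalIntegral.integral_add_adjacent_intervals
        (ker_int hκ hγ hb (x := r (k+1)) (y := r k) (by linarith) (by linarith))
        (ker_int hκ hγ hb (x := r k) (y := r 0) (by linarith) i1)]
      linarith
  obtain ⟨k1, k2⟩ := key n le_rfl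
  have hn := hra n le_rfl
  rw [← intervalIntegral.integral_add_adjacent_intervals
        (ker_int hκ hγ hb (x := a ^ 2) (y := r n) ha2 hn)
        (ker_int hκ hγ hb (x := r n) (y := r 0) (by linarith) k1)]
  have : 0 ≤ ∫ ρ in (a ^ 2)..(r n), ker κ γ b ρ :=
    intervalIntegral.integral_nonneg hn fun x hx => ker_nonneg hκ hγ hb (by linarith [hx.1])
  linarith

lemma final_int {κ γ D a R : ℝ} (hκ : 0 ≤ κ) (hγ : 0 ≤ γ) (hD : 0 ≤ D) (ha : 0 < a) (haR : a ^ 2 ≤ R)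
    (hR : R ≤ 3) :
    ∫ ρ in (a ^ 2)..R, (κ + γ / Real.sqrt ρ) * (4 / Real.sqrt ρ + 2 * D / ρ) ≤
      16 * κ + (4 * γ + 2 * D * κ) * (Real.log 3 - 2 * Real.log a) + 4 * D * γ / a := by
  have ha2 : 0 < a ^ 2 := by positivity
  have hR0 : 0 < R := by linarith
  rw [intervalIntegral.integral_eq_sub_of_hasDerivAt
    (f := fun ρ => 8 * κ * Real.sqrt ρ + (4 * γ + 2 * D * κ) * Real.log ρ - 4 * D * γ / Real.sqrt ρ)]
  · have e1 : Real.log (a ^ 2) = 2 * Real.log a := by rw [Real.log_pow]; norm_num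
    have e2 : Real.sqrt (a ^ 2) = a := Real.sqrt_sq ha.le
    simp only [e1, e2]
    have e3 : Real.log R ≤ Real.log 3 := Real.log_le_log hR0 hR
    have e4 : Real.sqrt R ≤ 2 := by rw [Real.sqrt_le_left (by norm_num)]; linarith
    have e5 : 0 ≤ 4 * D * γ / Real.sqrt R := by positivity
    have e6 : (4 * γ + 2 * D * κ) * Real.log R ≤ (4 * γ + 2 * D * κ) * Real.log 3 := by gcongr
    have e7 : 8 * κ * Real.sqrt R ≤ 8 * κ * 2 := by gcongr
    have e8 : 0 ≤ 8 * κ * a := by positivity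
    linarith
  · intro x hx
    rw [uIcc_of_le haR] at hx
    have hx0 : 0 < x := by linarith [hx.1]
    have hs := Real.sqrt_pos.2 hx0
    have d1 := Real.hasDerivAt_sqrt hx0.ne'
    have d2 := Real.hasDerivAt_log hx0.ne'
    have d3 := (hasDerivAt_const x (4 * D * γ)).div d1 hs.ne'
    refine (((d1.const_mul (8 * κ)).add (d2.const_mul (4 * γ + 2 * D * κ))).sub d3).congr_deriv ?_
    have hss : Real.sqrt x ^ 2 = x := Real.sq_sqrt hx0.le
    set s := Real.sqrt x
    rw [← hss]
    field_simp
    ring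
  · apply ContinuousOn.intervalIntegrable
    rw [uIcc_of_le haR]
    have : ∀ x ∈ Icc (a ^ 2) R, x ≠ 0 := fun x hx => by linarith [hx.1]
    have : ∀ x ∈ Icc (a ^ 2) R, Real.sqrt x ≠ 0 := fun x hx => (Real.sqrt_pos.2 (by linarith [hx.1])).ne'
    fun_prop (disch := assumption)

namespace BE
variable {Ω : Type} [mΩ : MeasurableSpace Ω] {μ : Measure Ω} [IsProbabilityMeasure μ]
  {F : ℕ → MeasurableSpace Ω} {n : ℕ} {ξ v : ℕ → Ω → ℝ} {γ κ δ : ℝ}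

lemma transfer (H : BE μ F n ξ v γ κ δ) (t a : ℝ) (hγa : γ ≤ a) {i : ℕ} (hi : i < n) :
    ∫ ω, errA ξ v γ κ a δ t i ω ∂μ ≤
      5 * ∫ ω, v i ω * ker κ γ ((psum ξ n ω - t) ^ 2) (rho v a δ (i + 1) ω) ∂μ := by
  have hγ := H.γ0
  have hκ := H.κ0
  have ha : 0 < a := lt_of_lt_of_le hγ hγa
  have ha2 : 0 < a ^ 2 := by positivity
  set r := rho v a δ (i + 1) with hr
  have hra : ∀ ω, a ^ 2 ≤ r ω := rho_ge v a δ (i + 1)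
  have hr0 : ∀ ω, 0 < r ω := fun ω => lt_of_lt_of_le (by positivity) (hra ω)
  have hsa : ∀ ω, a ≤ Real.sqrt (r ω) := fun ω => Real.le_sqrt_of_sq_le (hra ω)
  have rm : Measurable[F i] r := H.rho_meas a (by omega) le_rfl
  have Mm : Measurable[F i] (psum ξ i) := H.Mm hi.le
  have sm : Measurable[F i] (fun ω => Real.sqrt (r ω)) := rm.sqrt
  have up : ∀ {f : Ω → ℝ}, Measurable[F i] f → Measurable f := fun h => h.mono (H.Fle _) le_rfl
  set A : Ω → ℝ := fun ω => v i ω * (κ + γ / Real.sqrt (r ω)) with hA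
  have Am : Measurable[F i] A := (H.vm i hi).mul (measurable_const.add (measurable_const.div sm))
  have A0 : ∀ ω, 0 ≤ A ω := fun ω => mul_nonneg (H.v0 i hi ω) (by positivity)
  have Ab : ∀ ω, A ω ≤ γ ^ 2 * (κ + γ / a) := fun ω => by
    have := hsa ω; have := H.v0 i hi ω; have := H.vγ i hi ω
    simp only [hA]; gcongr
  set CA := γ ^ 2 * (κ + γ / a)
  set w0 : Ω → ℝ := fun ω => 5 * r ω + (psum ξ i ω - t) ^ 2 with hw0
  have w0m : Measurable[F i] w0 := (rm.const_mul 5).add ((Mm.sub_const t).pow_const 2)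
  have w0a : ∀ ω, a ^ 2 ≤ w0 ω := fun ω => by
    have := hra ω; simp only [hw0]; nlinarith [sq_nonneg (psum ξ i ω - t)]
  set f : Ω → ℝ := fun ω => A ω / w0 ω ^ 2 with hf
  have fm : Measurable[F i] f := Am.div (w0m.pow_const 2)
  have f0 : ∀ ω, 0 ≤ f ω := fun ω => div_nonneg (A0 ω) (by positivity)
  have fb : ∀ ω, |f ω| ≤ CA / (a ^ 2) ^ 2 := fun ω => by
    rw [abs_of_nonneg (f0 ω)]
    have := w0a ω; have := Ab ω
    have : 0 ≤ CA := by positivity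
    simp only [hf]; gcongr
  have m2 := H.mom2 t hi.le le_rfl f fm _ fb f0
  have iM := int_bdd (up fm) _ fb (H.Msq_int le_rfl t)
  have iMi := int_bdd (up fm) _ fb (H.Msq_int hi.le t)
  have iV := int_bdd (up fm) _ fb ((H.intV le_rfl).sub (H.intV hi.le))
  have ri : Integrable r μ := by
    refine int_bdd' (up rm) (1 + δ ^ 2 + a ^ 2) fun ω => ?_
    rw [abs_of_pos (hr0 ω)]
    simp only [hr, rho]
    have : 0 ≤ psum v (i + 1) ω := Finset.sum_nonneg fun j hj => H.v0 j (by have := Finset.mem_range.1 hj; omega) ω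
    have := max_le (a := 1 + δ ^ 2 - psum v (i + 1) ω) (b := 0) (c := 1 + δ ^ 2) (by linarith) (by positivity)
    linarith
  have ir := int_bdd (up fm) _ fb ri
  have nm : Measurable (psum ξ n) := (H.Mm le_rfl).mono (H.Fle _) le_rfl
  have iA0 : Integrable (fun ω => A ω / w0 ω) μ := by
    refine int_bdd' (up (Am.div w0m)) (CA / a ^ 2) fun ω => ?_
    have := w0a ω; have := Ab ω; have := A0 ω
    have : 0 ≤ CA := by positivity
    rw [abs_of_nonneg (div_nonneg (A0 ω) (by linarith))]
    gcongr
  have iAw : Integrable (fun ω => A ω / (r ω + (psum ξ n ω - t) ^ 2)) μ := by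
    refine int_bdd' ((up Am).div ((up rm).add ((nm.sub_const t).pow_const 2))) (CA / a ^ 2) fun ω => ?_
    have h1 := hra ω; have := Ab ω; have := A0 ω
    have : 0 ≤ CA := by positivity
    have h2 : a ^ 2 ≤ r ω + (psum ξ n ω - t) ^ 2 := by nlinarith [sq_nonneg (psum ξ n ω - t)]
    rw [abs_of_nonneg (div_nonneg (A0 ω) (by linarith))]
    gcongr
  have iAe : Integrable (fun ω => A ω / (r ω + (t - psum ξ i ω) ^ 2)) μ := by
    refine int_bdd' (up (Am.div (rm.add ((measurable_const.sub Mm).pow_const 2)))) (CA / a ^ 2) fun ω => ?_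
    have h1 := hra ω; have := Ab ω; have := A0 ω
    have : 0 ≤ CA := by positivity
    have h2 : a ^ 2 ≤ r ω + (t - psum ξ i ω) ^ 2 := by nlinarith [sq_nonneg (t - psum ξ i ω)]
    rw [abs_of_nonneg (div_nonneg (A0 ω) (by linarith))]
    gcongr
  -- tangent line
  have t1 : ∫ ω, (2 * (A ω / w0 ω) - (f ω * r ω + f ω * (psum ξ n ω - t) ^ 2)) ∂μ ≤
      ∫ ω, A ω / (r ω + (psum ξ n ω - t) ^ 2) ∂μ := by
    refine integral_mono (subI (iA0.const_mul 2) (addI ir iM)) iAw fun ω => ?_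
    simp only
    have hw : 0 < r ω + (psum ξ n ω - t) ^ 2 := by have := hr0 ω; positivity
    have hw0' : 0 < w0 ω := lt_of_lt_of_le ha2 (w0a ω)
    set w := r ω + (psum ξ n ω - t) ^ 2
    have e : f ω * r ω + f ω * (psum ξ n ω - t) ^ 2 = A ω / w0 ω ^ 2 * w := by
      simp only [hf, w]; ring
    rw [e, ← sub_nonneg]
    have : A ω / w - (2 * (A ω / w0 ω) - A ω / w0 ω ^ 2 * w) = A ω * (w - w0 ω) ^ 2 / (w * w0 ω ^ 2) := by
      field_simp; ring
    rw [this]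
    have := A0 ω; positivity
  rw [integral_sub (iA0.const_mul 2) (addI ir iM), integral_add ir iM, integral_const_mul] at t1
  have t2 : ∫ ω, f ω * (psum v n ω - psum v i ω) ∂μ ≤ 2 * ∫ ω, f ω * r ω ∂μ := by
    rw [← integral_const_mul]
    refine integral_mono_ae iV (ir.const_mul 2) ?_
    filter_upwards [H.Vle, H.rho_succ a] with ω h1 h2
    have h3 := h2 i hi
    have h4 := h1 n le_rfl
    have h5 : 1 + δ ^ 2 - psum v i ω + a ^ 2 ≤ rho v a δ i ω := by
      unfold rho; linarith [le_max_left (1 + δ ^ 2 - psum v i ω) 0]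
    have h6 : v i ω ≤ r ω := (H.vγ i hi ω).trans (le_trans (by gcongr) (hra ω))
    have : psum v n ω - psum v i ω ≤ 2 * r ω := by rw [h3] at h5; linarith
    calc _ ≤ f ω * (2 * r ω) := mul_le_mul_of_nonneg_left this (f0 ω)
      _ = _ := by ring
  have t3 : ∫ ω, A ω / w0 ω ∂μ = 5 * ∫ ω, f ω * r ω ∂μ + ∫ ω, f ω * (psum ξ i ω - t) ^ 2 ∂μ := by
    rw [← integral_const_mul, ← integral_add (ir.const_mul 5) iMi]
    congr 1; funext ω
    have hw0' : 0 < w0 ω := lt_of_lt_of_le ha2 (w0a ω)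
    have : A ω / w0 ω = f ω * w0 ω := by simp only [hf]; field_simp
    rw [this]; simp only [hw0]; ring
  have t4 : ∫ ω, errA ξ v γ κ a δ t i ω ∂μ ≤ 5 * ∫ ω, A ω / w0 ω ∂μ := by
    rw [← integral_const_mul]
    refine integral_mono iAe (iA0.const_mul 5) fun ω => ?_
    simp only
    have h1 := hr0 ω
    have : (5:ℝ) * (A ω / w0 ω) = A ω / (w0 ω / 5) := by field_simp
    rw [this]
    have h2 := A0 ω
    have h3 : w0 ω / 5 ≤ r ω + (t - psum ξ i ω) ^ 2 := by
      simp only [hw0]; nlinarith [sq_nonneg (t - psum ξ i ω)]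
    have h4 : 0 < w0 ω / 5 := by have := w0a ω; linarith
    exact div_le_div_of_nonneg_left h2 h4 h3
  have t5 : ∫ ω, v i ω * ker κ γ ((psum ξ n ω - t) ^ 2) (r ω) ∂μ =
      ∫ ω, A ω / (r ω + (psum ξ n ω - t) ^ 2) ∂μ := by
    congr 1; funext ω; simp only [ker, hA]; ring
  rw [t5]
  linarith

end BE
end Cram


namespace Cram
open ProbabilityTheory Set

namespace BE
variable {Ω : Type} [mΩ : MeasurableSpace Ω] {μ : Measure Ω} [IsProbabilityMeasure μ]
  {F : ℕ → MeasurableSpace Ω} {n : ℕ} {ξ v : ℕ → Ω → ℝ} {γ κ δ : ℝ}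

lemma ker_meas (κ γ : ℝ) {α : Type} [MeasurableSpace α] {f g : α → ℝ} (hf : Measurable f)
    (hg : Measurable g) : Measurable (fun x => ker κ γ (f x) (g x)) := by
  unfold ker
  exact (measurable_const.add (measurable_const.div hg.sqrt)).div (hg.add hf)

lemma ker_le {κ γ b a ρ : ℝ} (hκ : 0 ≤ κ) (hγ : 0 ≤ γ) (hb : 0 ≤ b) (ha : 0 < a) (h : a ^ 2 ≤ ρ) :
    |ker κ γ b ρ| ≤ (κ + γ / a) / a ^ 2 := by
  have hρ : 0 < ρ := lt_of_lt_of_le (by positivity) h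
  rw [abs_of_nonneg (ker_nonneg hκ hγ hb hρ)]
  refine (ker_anti hκ hγ hb (by positivity) h).trans ?_
  unfold ker
  rw [Real.sqrt_sq ha.le]
  gcongr; linarith

lemma fubini {M : Ω → ℝ} (hM : Measurable M) {κ γ D a R t : ℝ} (hκ : 0 ≤ κ) (hγ : 0 ≤ γ)
    (hD : ∀ s, |μ.real {ω | M ω ≤ s} - stdNormalCDF s| ≤ D) (ha : 0 < a) (haR : a ^ 2 ≤ R)
    (hR : R ≤ 3) :
    Integrable (fun ω => ∫ ρ in (a ^ 2)..R, ker κ γ ((M ω - t) ^ 2) ρ) μ ∧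
    ∫ ω, (∫ ρ in (a ^ 2)..R, ker κ γ ((M ω - t) ^ 2) ρ) ∂μ ≤
      16 * κ + (4 * γ + 2 * D * κ) * (Real.log 3 - 2 * Real.log a) + 4 * D * γ / a := by
  have hD0 : 0 ≤ D := (abs_nonneg _).trans (hD 0)
  have ha2 : 0 < a ^ 2 := by positivity
  set k : Ω → ℝ → ℝ := fun ω ρ => ker κ γ ((M ω - t) ^ 2) (max ρ (a ^ 2)) with hk
  have km : Measurable (Function.uncurry k) := by
    simp only [hk, Function.uncurry_def]
    exact ker_meas κ γ (((hM.comp measurable_fst).sub_const t).pow_const 2)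
      (measurable_snd.max measurable_const)
  have kint : Integrable (Function.uncurry k) (μ.prod (volume.restrict (Ioc (a ^ 2) R))) :=
    int_bdd' km ((κ + γ / a) / a ^ 2) fun p => ker_le hκ hγ (by positivity) ha (le_max_right _ _)
  have e1 : ∀ ω, ∫ ρ in (a ^ 2)..R, ker κ γ ((M ω - t) ^ 2) ρ = ∫ ρ in Ioc (a ^ 2) R, k ω ρ := by
    intro ω
    rw [intervalIntegral.integral_of_le haR]
    refine setIntegral_congr_fun measurableSet_Ioc fun ρ hρ => ?_
    simp only [hk]; rw [max_eq_left hρ.1.le]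
  simp only [e1]
  refine ⟨kint.integral_prod_left, ?_⟩
  rw [integral_integral_swap kint]
  refine le_trans ?_ (final_int hκ hγ hD0 ha haR hR)
  rw [intervalIntegral.integral_of_le haR]
  refine setIntegral_mono_on kint.integral_prod_right ?_ measurableSet_Ioc fun ρ hρ => ?_
  · have : IntervalIntegrable (fun ρ => (κ + γ / Real.sqrt ρ) * (4 / Real.sqrt ρ + 2 * D / ρ)) volume (a ^ 2) R := by
      apply ContinuousOn.intervalIntegrable
      rw [uIcc_of_le haR]
      have : ∀ x ∈ Icc (a ^ 2) R, x ≠ 0 := fun x hx => by linarith [hx.1]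
      have : ∀ x ∈ Icc (a ^ 2) R, Real.sqrt x ≠ 0 := fun x hx => (Real.sqrt_pos.2 (by linarith [hx.1])).ne'
      fun_prop (disch := assumption)
    rw [intervalIntegrable_iff_integrableOn_Ioc_of_le haR] at this
    exact this
  · have hρ0 : 0 < ρ := ha2.trans hρ.1
    have e2 : ∀ ω, k ω ρ = (κ + γ / Real.sqrt ρ) * (ρ + (M ω - t) ^ 2)⁻¹ := fun ω => by
      simp only [hk, ker]; rw [max_eq_left hρ.1.le]; rw [div_eq_mul_inv]
    simp only [e2]
    rw [integral_const_mul]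
    have : IsProbabilityMeasure (μ.map M) := Measure.isProbabilityMeasure_map hM.aemeasurable
    have kb := kernel_bound (μ.map M) D (fun s => by
      have : (μ.map M).real (Iic s) = μ.real {ω | M ω ≤ s} := by
        rw [map_measureReal_apply hM measurableSet_Iic]; rfl
      rw [this]; exact hD s) ρ t hρ0
    rw [integral_map hM.aemeasurable (by fun_prop)] at kb
    have : 0 ≤ κ + γ / Real.sqrt ρ := by positivity
    gcongr

lemma smooth_err (H : BE μ F n ξ v γ κ δ) (t a D : ℝ) (hγa : γ ≤ a) (ha1 : a ≤ 1) (hδ : δ ^ 2 ≤ 1)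
    (hD : ∀ s, |μ.real {ω | psum ξ n ω ≤ s} - stdNormalCDF s| ≤ D) :
    |∫ ω, stdNormalCDF ((t - psum ξ n ω) / Real.sqrt (rho v a δ n ω)) ∂μ -
      stdNormalCDF (t / Real.sqrt (1 + (δ ^ 2 + a ^ 2)))| ≤
      2240 * (16 * κ + (4 * γ + 2 * D * κ) * (Real.log 3 - 2 * Real.log a) + 4 * D * γ / a) := by
  have hγ := H.γ0
  have hκ := H.κ0
  have ha : 0 < a := lt_of_lt_of_le hγ hγa
  have ha2 : 0 < a ^ 2 := by positivity
  set I : ℕ → ℝ := fun i => ∫ ω, stdNormalCDF ((t - psum ξ i ω) / Real.sqrt (rho v a δ i ω)) ∂μ with hI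
  have hr0 : ∀ ω, rho v a δ 0 ω = 1 + (δ ^ 2 + a ^ 2) := fun ω => by
    simp only [rho, psum, Finset.range_zero, Finset.sum_empty, sub_zero]
    rw [max_eq_left (by positivity)]; ring
  have I0 : I 0 = stdNormalCDF (t / Real.sqrt (1 + (δ ^ 2 + a ^ 2))) := by
    simp only [hI, hr0]; simp [psum]
  have nm : Measurable (psum ξ n) := (H.Mm le_rfl).mono (H.Fle _) le_rfl
  obtain ⟨fi, fb⟩ := fubini (μ := μ) (t := t) (R := 1 + (δ ^ 2 + a ^ 2)) nm hκ hγ.le hD ha (by nlinarith [sq_nonneg δ])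
    (by nlinarith)
  rw [← I0]
  have tel : I n - I 0 = ∑ i ∈ Finset.range n, (I (i + 1) - I i) := (Finset.sum_range_sub I n).symm
  change |I n - I 0| ≤ _
  rw [tel]
  refine (Finset.abs_sum_le_sum_abs _ _).trans ?_
  have s1 : ∀ i ∈ Finset.range n, |I (i + 1) - I i| ≤
      560 * ∫ ω, v i ω * ker κ γ ((psum ξ n ω - t) ^ 2) (rho v a δ (i + 1) ω) ∂μ := by
    intro i hi
    have hi := Finset.mem_range.1 hi
    have a1 := H.step t a hγa hi
    have a2 := H.transfer t a hγa hi
    calc _ ≤ _ := a1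
      _ ≤ _ := by linarith
  refine (Finset.sum_le_sum s1).trans ?_
  rw [← Finset.mul_sum, ← integral_finsetSum]
  · have : ∫ ω, ∑ i ∈ Finset.range n, v i ω * ker κ γ ((psum ξ n ω - t) ^ 2) (rho v a δ (i + 1) ω) ∂μ
        ≤ ∫ ω, (4 * ∫ ρ in (a ^ 2)..(1 + (δ ^ 2 + a ^ 2)), ker κ γ ((psum ξ n ω - t) ^ 2) ρ) ∂μ := by
      refine integral_mono_of_nonneg ?_ (fi.const_mul 4) ?_
      · refine Eventually.of_forall fun ω => Finset.sum_nonneg fun i hi => ?_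
        exact mul_nonneg (H.v0 i (Finset.mem_range.1 hi) ω) (ker_nonneg hκ hγ.le (by positivity)
          (lt_of_lt_of_le ha2 (rho_ge v a δ (i + 1) ω)))
      · filter_upwards [H.rho_succ a] with ω hω
        have := ker_sum (b := (psum ξ n ω - t) ^ 2) hκ hγ.le (by positivity) ha n
          (fun i => rho v a δ i ω) (fun i => v i ω)
          (fun i hi => H.v0 i hi ω) (fun i hi => (H.vγ i hi ω).trans (by gcongr))
          (fun i _ => rho_ge v a δ i ω) hω
        simp only [hr0] at this
        exact this
    rw [integral_const_mul] at this
    linarith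
  · intro i hi
    have hi := Finset.mem_range.1 hi
    refine (int_bdd (f := fun ω => ker κ γ ((psum ξ n ω - t) ^ 2) (rho v a δ (i + 1) ω)) (ker_meas κ γ ((nm.sub_const t).pow_const 2)
      ((H.rho_meas a (i := i + 1) (k := i) (by omega) le_rfl).mono (H.Fle _) le_rfl)) ((κ + γ / a) / a ^ 2)
      (fun ω => ker_le hκ hγ.le (by positivity) ha (rho_ge v a δ (i + 1) ω)) (H.intv hi)).congr
      (Eventually.of_forall fun ω => mul_comm _ _)

end BE
end Cram


namespace Cram
open ProbabilityTheory Set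

lemma bump_exp (c d r : ℝ) (hc : 0 < c) (hd : 0 ≤ d) (hr : 0 < r) (hrc : r ≤ c ^ 2) :
    1 - stdNormalCDF ((d + 3 * c) / Real.sqrt r) ≤ 1 / 8 * (c ^ 2 * (c ^ 2 + d ^ 2)⁻¹) := by
  have hs : 0 < Real.sqrt r := Real.sqrt_pos.2 hr
  refine (tail_le _ (by positivity)).trans ?_
  have h1 : ((d + 3 * c) / Real.sqrt r) ^ 2 = (d + 3 * c) ^ 2 / r := by
    rw [div_pow, Real.sq_sqrt hr.le]
  have h2 : 9 + d ^ 2 / c ^ 2 ≤ (d + 3 * c) ^ 2 / r := by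
    rw [le_div_iff₀ hr]
    have : (9 + d ^ 2 / c ^ 2) * c ^ 2 = 9 * c ^ 2 + d ^ 2 := by field_simp
    calc _ ≤ (9 + d ^ 2 / c ^ 2) * c ^ 2 := by gcongr
      _ ≤ _ := by rw [this]; nlinarith
  rw [h1]
  have h3 : Real.exp (-((d + 3 * c) ^ 2 / r) / 2) ≤ Real.exp (-(9/2)) * Real.exp (-(d ^ 2 / c ^ 2 / 2)) := by
    rw [← Real.exp_add]; apply Real.exp_le_exp.2; linarith
  refine h3.trans ?_
  have h4 : Real.exp (-(9/2)) ≤ 1 / 16 := by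
    rw [Real.exp_neg, inv_eq_one_div]
    apply one_div_le_one_div_of_le (by norm_num)
    have := Real.quadratic_le_exp_of_nonneg (x := 9/2) (by norm_num)
    have h5 : Real.exp (9/2) = Real.exp (9/4) * Real.exp (9/4) := by rw [← Real.exp_add]; norm_num
    have := Real.quadratic_le_exp_of_nonneg (x := 9/4) (by norm_num)
    rw [h5]; nlinarith
  have h5 : Real.exp (-(d ^ 2 / c ^ 2 / 2)) ≤ 2 * (c ^ 2 * (c ^ 2 + d ^ 2)⁻¹) := by
    rw [Real.exp_neg]
    have : c ^ 2 * (c ^ 2 + d ^ 2)⁻¹ = (1 + d ^ 2 / c ^ 2)⁻¹ := by field_simp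
    rw [this]
    have h6 := Real.add_one_le_exp (d ^ 2 / c ^ 2 / 2)
    have h7 : 0 ≤ d ^ 2 / c ^ 2 := by positivity
    rw [← div_eq_mul_inv, inv_eq_one_div, div_le_div_iff₀ (Real.exp_pos _) (by positivity)]
    linarith
  calc _ ≤ 1 / 16 * (2 * (c ^ 2 * (c ^ 2 + d ^ 2)⁻¹)) := by gcongr
    _ = _ := by ring

section
variable {Ω : Type} [mΩ : MeasurableSpace Ω] {μ : Measure Ω} [IsProbabilityMeasure μ]
  {F : ℕ → MeasurableSpace Ω} {n : ℕ} {ξ v : ℕ → Ω → ℝ} {γ κ δ : ℝ}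

lemma desmooth {M r : Ω → ℝ} (hM : Measurable M) (hr : Measurable r) {D a c : ℝ} (ha : 0 < a) (hc : 0 < c)
    (hr1 : ∀ᵐ ω ∂μ, a ^ 2 ≤ r ω ∧ r ω ≤ c ^ 2)
    (hD : ∀ s, |μ.real {ω | M ω ≤ s} - stdNormalCDF s| ≤ D) (t : ℝ) :
    μ.real {ω | M ω ≤ t} ≤ ∫ ω, stdNormalCDF ((t + 3 * c - M ω) / Real.sqrt (r ω)) ∂μ + (c / 2 + D / 4) ∧
    ∫ ω, stdNormalCDF ((t - 3 * c - M ω) / Real.sqrt (r ω)) ∂μ ≤ μ.real {ω | M ω ≤ t} + (c / 2 + D / 4) := by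
  have hms : MeasurableSet {ω | M ω ≤ t} := hM measurableSet_Iic
  have e0 : μ.real {ω | M ω ≤ t} = ∫ ω, {ω | M ω ≤ t}.indicator (fun _ => (1:ℝ)) ω ∂μ := by
    rw [integral_indicator hms]; simp
  have iI : Integrable ({ω | M ω ≤ t}.indicator (fun _ => (1:ℝ))) μ := (integrable_const 1).indicator hms
  have iP : ∀ u, Integrable (fun ω => stdNormalCDF ((u - M ω) / Real.sqrt (r ω))) μ := fun u =>
    int_bdd' (Phi_continuous.measurable.comp ((measurable_const.sub hM).div hr.sqrt)) 1
      fun ω => abs_le.2 ⟨by linarith [Phi_nonneg ((u - M ω) / Real.sqrt (r ω))], Phi_le_one _⟩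
  have hc2 : 0 < c ^ 2 := by positivity
  have iK : Integrable (fun ω => (c ^ 2 + (M ω - t) ^ 2)⁻¹) μ := by
    refine int_bdd' (by fun_prop) (c ^ 2)⁻¹ fun ω => ?_
    rw [abs_of_nonneg (by positivity)]
    apply inv_anti₀ hc2; nlinarith [sq_nonneg (M ω - t)]
  have : IsProbabilityMeasure (μ.map M) := Measure.isProbabilityMeasure_map hM.aemeasurable
  have kb := kernel_bound (μ.map M) D (fun s => by
    have : (μ.map M).real (Iic s) = μ.real {ω | M ω ≤ s} := by
      rw [map_measureReal_apply hM measurableSet_Iic]; rfl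
    rw [this]; exact hD s) (c ^ 2) t hc2
  rw [integral_map hM.aemeasurable (by fun_prop), Real.sqrt_sq hc.le] at kb
  have kb2 : 1 / 8 * (c ^ 2 * ∫ ω, (c ^ 2 + (M ω - t) ^ 2)⁻¹ ∂μ) ≤ c / 2 + D / 4 := by
    calc _ ≤ 1 / 8 * (c ^ 2 * (4 / c + 2 * D / c ^ 2)) := by gcongr
      _ = _ := by field_simp; ring
  have iK2 : Integrable (fun ω => 1 / 8 * (c ^ 2 * (c ^ 2 + (M ω - t) ^ 2)⁻¹)) μ := (iK.const_mul _).const_mul _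
  have eK : ∫ ω, 1 / 8 * (c ^ 2 * (c ^ 2 + (M ω - t) ^ 2)⁻¹) ∂μ = 1 / 8 * (c ^ 2 * ∫ ω, (c ^ 2 + (M ω - t) ^ 2)⁻¹ ∂μ) := by
    rw [integral_const_mul, integral_const_mul]
  rw [e0]
  constructor
  · refine le_trans ?_ (add_le_add_right kb2 _)
    rw [← eK, ← integral_add (iP _) iK2]
    refine integral_mono_ae iI (addI (iP _) iK2) ?_
    filter_upwards [hr1] with ω hω
    have hr0 : 0 < r ω := lt_of_lt_of_le (by positivity) hω.1
    by_cases h : M ω ≤ t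
    · rw [indicator_of_mem (by exact h)]
      have := bump_exp c (t - M ω) (r ω) hc (by linarith) hr0 hω.2
      have e1 : (t - M ω) ^ 2 = (M ω - t) ^ 2 := by ring
      have e2 : t - M ω + 3 * c = t + 3 * c - M ω := by ring
      rw [e1, e2] at this
      linarith
    · rw [indicator_of_notMem (by exact h)]
      have := Phi_nonneg ((t + 3 * c - M ω) / Real.sqrt (r ω))
      positivity
  · refine le_trans ?_ (add_le_add_right kb2 _)
    rw [← eK, ← integral_add iI iK2]
    refine integral_mono_ae (iP _) (addI iI iK2) ?_
    filter_upwards [hr1] with ω hω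
    have hr0 : 0 < r ω := lt_of_lt_of_le (by positivity) hω.1
    by_cases h : M ω ≤ t
    · rw [indicator_of_mem (by exact h)]
      have := Phi_le_one ((t - 3 * c - M ω) / Real.sqrt (r ω))
      have : 0 ≤ 1 / 8 * (c ^ 2 * (c ^ 2 + (M ω - t) ^ 2)⁻¹) := by positivity
      linarith
    · rw [indicator_of_notMem (by exact h)]
      have h : t < M ω := not_le.1 h
      have := bump_exp c (M ω - t) (r ω) hc (by linarith) hr0 hω.2
      rw [← Phi_neg] at this
      have e2 : -((M ω - t + 3 * c) / Real.sqrt (r ω)) = (t - 3 * c - M ω) / Real.sqrt (r ω) := by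
        rw [← neg_div]; congr 1; ring
      rw [e2] at this
      linarith

lemma BE.main (H : BE μ F n ξ v γ κ δ) (hδ0 : 0 ≤ δ) (hδ : δ ≤ 1) (t : ℝ) :
    |μ.real {ω | psum ξ n ω ≤ t} - stdNormalCDF t| ≤ 2000000 * (γ * (1 + |Real.log γ|) + κ + δ) := by
  have hγ := H.γ0
  have hκ := H.κ0
  set D : ℝ := ⨆ s, |μ.real {ω | psum ξ n ω ≤ s} - stdNormalCDF s| with hDdef
  have b1 : ∀ s, |μ.real {ω | psum ξ n ω ≤ s} - stdNormalCDF s| ≤ 1 := fun s => by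
    have h1 : μ.real {ω | psum ξ n ω ≤ s} ≤ 1 := measureReal_le_one
    have h2 : 0 ≤ μ.real {ω | psum ξ n ω ≤ s} := measureReal_nonneg
    have h3 := Phi_nonneg s
    have h4 := Phi_le_one s
    rw [abs_le]; constructor <;> linarith
  have bdd : BddAbove (Set.range fun s => |μ.real {ω | psum ξ n ω ≤ s} - stdNormalCDF s|) :=
    ⟨1, by rintro _ ⟨s, rfl⟩; exact b1 s⟩
  have hD : ∀ s, |μ.real {ω | psum ξ n ω ≤ s} - stdNormalCDF s| ≤ D := fun s => le_ciSup bdd s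
  have hD0 : 0 ≤ D := (abs_nonneg _).trans (hD 0)
  set a : ℝ := 200000 * (γ + κ) with ha
  have ha0 : 0 < a := by positivity
  have hγa : γ ≤ a := by rw [ha]; linarith
  have hlog : 0 ≤ γ * |Real.log γ| := by positivity
  by_cases ha1 : a ≤ 1
  swap
  · refine (b1 t).trans ?_
    push Not at ha1
    rw [ha] at ha1
    linarith
  have hδ2 : δ ^ 2 ≤ δ := by nlinarith
  set s : ℝ := δ ^ 2 + a ^ 2 with hs
  have hs0 : 0 ≤ s := by positivity
  have hsl : s ≤ δ + a := by rw [hs]; nlinarith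
  set c : ℝ := Real.sqrt (a ^ 2 + 2 * δ ^ 2) with hc
  have hc0 : 0 < c := Real.sqrt_pos.2 (by positivity)
  have hc2 : c ^ 2 = a ^ 2 + 2 * δ ^ 2 := Real.sq_sqrt (by positivity)
  have hcl : c ≤ a + 2 * δ := by
    rw [hc]; apply Real.sqrt_le_iff.2; constructor
    · positivity
    · nlinarith
  set L : ℝ := Real.log 3 - 2 * Real.log a with hL
  have hlog3 : Real.log 3 ≤ 2 := by
    have := Real.log_le_sub_one_of_pos (x := 3) (by norm_num); linarith
  have haL : a * L ≤ 4 := by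
    have h1 := Real.log_le_sub_one_of_pos (x := 2 / a) (by positivity)
    rw [Real.log_div (by norm_num) ha0.ne'] at h1
    have h2 : Real.log 3 ≤ 2 * Real.log 2 := by
      have : (2:ℝ) * Real.log 2 = Real.log (2 ^ 2) := by rw [Real.log_pow]; norm_num
      rw [this]; exact Real.log_le_log (by norm_num) (by norm_num)
    have h3 : L ≤ 2 * (2 / a) := by rw [hL]; linarith
    calc a * L ≤ a * (2 * (2 / a)) := by gcongr
      _ = 4 := by field_simp; norm_num
  have hL0 : 0 ≤ L := by
    have := Real.log_nonneg (x := 3) (by norm_num)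
    have := Real.log_nonpos ha0.le ha1
    rw [hL]; linarith
  have hLl : L ≤ 2 + 2 * |Real.log γ| := by
    have := Real.log_le_log hγ hγa
    have := neg_abs_le (Real.log γ)
    rw [hL]; linarith
  set Err : ℝ := 2240 * (16 * κ + (4 * γ + 2 * D * κ) * L + 4 * D * γ / a) with hErr
  have se := fun t => H.smooth_err t a D hγa ha1 (by nlinarith) hD
  have nm : Measurable (psum ξ n) := (H.Mm le_rfl).mono (H.Fle _) le_rfl
  have rm : Measurable (rho v a δ n) := (H.rho_meas a (i := n) (k := n) le_rfl (by omega)).mono (H.Fle _) le_rfl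
  have hr1 : ∀ᵐ ω ∂μ, a ^ 2 ≤ rho v a δ n ω ∧ rho v a δ n ω ≤ c ^ 2 := by
    filter_upwards [H.HV] with ω hω
    refine ⟨rho_ge v a δ n ω, ?_⟩
    have := (abs_le.1 hω).1
    rw [hc2]; unfold rho psum
    have : max (1 + δ ^ 2 - ∑ j ∈ Finset.range n, v j ω) 0 ≤ 2 * δ ^ 2 := max_le (by linarith) (by positivity)
    linarith
  have key : ∀ t, |μ.real {ω | psum ξ n ω ≤ t} - stdNormalCDF t| ≤ 3.5 * c + D / 4 + Err + s := by
    intro t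
    obtain ⟨d1, d2⟩ := desmooth nm rm ha0 hc0 hr1 hD t
    have e1 := abs_le.1 (se (t + 3 * c))
    have e2 := abs_le.1 (se (t - 3 * c))
    have f1 := abs_le.1 (scale_first (t + 3 * c) s hs0)
    have f2 := abs_le.1 (scale_first (t - 3 * c) s hs0)
    have g1 := abs_le.1 (Phi_lipschitz t (t + 3 * c))
    have g2 := abs_le.1 (Phi_lipschitz (t - 3 * c) t)
    rw [show t + 3 * c - t = 3 * c by ring, abs_of_pos (by positivity)] at g1
    rw [show t - (t - 3 * c) = 3 * c by ring, abs_of_pos (by positivity)] at g2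
    obtain ⟨e1, e1'⟩ := e1
    obtain ⟨e2, e2'⟩ := e2
    obtain ⟨f1, f1'⟩ := f1
    obtain ⟨f2, f2'⟩ := f2
    obtain ⟨g1, g1'⟩ := g1
    obtain ⟨g2, g2'⟩ := g2
    rw [abs_le]
    constructor <;> linarith
  have hDle : D ≤ 3.5 * c + D / 4 + Err + s := ciSup_le key
  have hκL : κ * L ≤ 4 / 200000 := by
    have : κ ≤ a / 200000 := by rw [ha]; linarith
    calc κ * L ≤ a / 200000 * L := by gcongr
      _ = (a * L) / 200000 := by ring
      _ ≤ _ := by gcongr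
  have hγa2 : γ / a ≤ 1 / 200000 := by
    rw [div_le_div_iff₀ ha0 (by norm_num), ha]; linarith
  have hErr2 : Err ≤ 2240 * (16 * κ + 4 * (γ * L)) + D / 4 := by
    have h1 : D * (κ * L) ≤ D * (4 / 200000) := by gcongr
    have h2 : D * (γ / a) ≤ D * (1 / 200000) := by gcongr
    have h3 : Err = 2240 * (16 * κ + 4 * (γ * L)) + 2240 * (2 * (D * (κ * L)) + 4 * (D * (γ / a))) := by
      rw [hErr]; ring
    rw [h3]; linarith
  have hγL : γ * L ≤ γ * (2 + 2 * |Real.log γ|) := by gcongr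
  refine (hD t).trans ?_
  rw [ha] at hcl hsl
  have : γ * (1 + |Real.log γ|) = γ + γ * |Real.log γ| := by ring
  nlinarith
end
end Cram


namespace Cram
open ProbabilityTheory Set

/-- tilting function -/
noncomputable def tl (θ w : ℝ) : ℝ := Real.exp (w - θ * w ^ 2)

lemma tl_pos (θ w : ℝ) : 0 < tl θ w := Real.exp_pos _

lemma tl_le {θ : ℝ} (h : 1 / 4 ≤ θ) (w : ℝ) : tl θ w ≤ 3 := by
  have h1 : w - θ * w ^ 2 ≤ 1 := by nlinarith [sq_nonneg (w - 2), sq_nonneg w]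
  have := Real.exp_le_exp.2 h1
  have := Real.exp_one_lt_d9
  unfold tl; linarith

lemma exp3 (z : ℝ) : |Real.exp z - 1 - z - z ^ 2 / 2| ≤ |z| ^ 3 * Real.exp |z| := by
  have h := Complex.norm_exp_sub_sum_le_norm_mul_exp (z : ℂ) 3
  simp only [Finset.sum_range_succ, Finset.sum_range_zero] at h
  have e : Complex.exp z - (0 + (z:ℂ) ^ 0 / (Nat.factorial 0 : ℂ) + (z:ℂ) ^ 1 / (Nat.factorial 1 : ℂ) + (z:ℂ) ^ 2 / (Nat.factorial 2 : ℂ))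
    = ((Real.exp z - 1 - z - z ^ 2 / 2 : ℝ) : ℂ) := by
    push_cast; simp [Nat.factorial]; ring
  rw [e, Complex.norm_real, Complex.norm_real] at h
  simpa using h

lemma tl_small {θ : ℝ} (h1 : 1 / 4 ≤ θ) (h2 : θ ≤ 3 / 2) (w : ℝ) (hw : |w| ≤ 1) :
    |tl θ w - 1 - w - (1 / 2 - θ) * w ^ 2| ≤ 250 * |w| ^ 3 := by
  set z := w - θ * w ^ 2 with hz
  have hw0 := abs_nonneg w
  have hw2 : w ^ 2 = |w| ^ 2 := (sq_abs w).symm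
  have hzb : |z| ≤ 5 / 2 * |w| := by
    have : |z| ≤ |w| + |θ * w ^ 2| := abs_sub _ _
    rw [abs_of_nonneg (by positivity : 0 ≤ θ * w ^ 2), hw2] at this
    nlinarith [mul_nonneg hw0 (sub_nonneg.2 hw), sq_nonneg (|w|)]
  have he : Real.exp |z| ≤ 13 := by
    have a1 : |z| ≤ 5 / 2 := by linarith
    have a2 : Real.exp (5/2) ≤ 13 := by
      have : Real.exp (5/2) ^ 2 = Real.exp 1 ^ 5 := by
        rw [← Real.exp_nat_mul, ← Real.exp_nat_mul]; norm_num
      have h3 := Real.exp_one_lt_d9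
      have h4 : Real.exp 1 ^ 5 ≤ 2.7182818286 ^ 5 := by gcongr
      have h5 : (2.7182818286:ℝ) ^ 5 ≤ 13 ^ 2 := by norm_num
      exact le_of_sq_le_sq (by linarith) (by norm_num)
    exact (Real.exp_le_exp.2 a1).trans a2
  have h3 := exp3 z
  have h4 : |z| ^ 3 * Real.exp |z| ≤ (5 / 2 * |w|) ^ 3 * 13 := by gcongr
  have h5 : |z ^ 2 / 2 - w ^ 2 / 2 + θ * w ^ 2 - θ * w ^ 2| ≤ 4 * |w| ^ 3 := by
    have : z ^ 2 / 2 - w ^ 2 / 2 + θ * w ^ 2 - θ * w ^ 2 = w ^ 3 * (-θ + θ ^ 2 * w / 2) := by rw [hz]; ring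
    rw [this, abs_mul, abs_pow, mul_comm]
    gcongr
    have hw' := abs_le.1 hw
    have : 0 ≤ θ ^ 2 := by positivity
    rw [abs_le]; constructor <;> nlinarith
  have e : tl θ w - 1 - w - (1 / 2 - θ) * w ^ 2 = (Real.exp z - 1 - z - z ^ 2 / 2) +
      (z ^ 2 / 2 - w ^ 2 / 2 + θ * w ^ 2 - θ * w ^ 2) := by
    simp only [tl, hz]; ring
  rw [e]
  refine (abs_add_le _ _).trans ?_
  have : 0 ≤ |w| ^ 3 := by positivity
  nlinarith

lemma tl_three {θ : ℝ} (h1 : 1 / 4 ≤ θ) (h2 : θ ≤ 3 / 2) (w : ℝ) :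
    |tl θ w - 1 - w - (1 / 2 - θ) * w ^ 2| ≤ 300 * |w| ^ 3 := by
  rcases le_total (|w|) 1 with h | h
  · refine (tl_small h1 h2 w h).trans ?_
    have : 0 ≤ |w| ^ 3 := by positivity
    linarith
  · have a1 := tl_pos θ w
    have a2 := tl_le h1 w
    have a3 : |w| ≤ |w| ^ 3 := le_self_pow₀ h (by norm_num)
    have a4 : w ^ 2 ≤ |w| ^ 3 := by rw [← sq_abs]; exact pow_le_pow_right₀ h (by norm_num)
    have a5 := neg_abs_le w
    have a6 := le_abs_self w
    have a7 := sq_nonneg w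
    rw [abs_le]; constructor <;> nlinarith

lemma tl_two {θ : ℝ} (h1 : 1 / 4 ≤ θ) (h2 : θ ≤ 3 / 2) (w : ℝ) :
    |tl θ w - 1 - w| ≤ 300 * w ^ 2 := by
  rcases le_total (|w|) 1 with h | h
  · have := abs_le.1 (tl_small h1 h2 w h)
    have a3 : |w| ^ 3 ≤ w ^ 2 := by rw [← sq_abs w]; exact pow_le_pow_of_le_one (abs_nonneg _) h (by norm_num)
    obtain ⟨b1, b2⟩ := this
    have a7 := sq_nonneg w
    rw [abs_le]; constructor <;> nlinarith
  · have a1 := tl_pos θ w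
    have a2 := tl_le h1 w
    have a3 : |w| ≤ w ^ 2 := by rw [← sq_abs w]; exact le_self_pow₀ h (by norm_num)
    have a5 := neg_abs_le w
    have a6 := le_abs_self w
    rw [abs_le]; constructor <;> nlinarith

lemma tl_one {θ : ℝ} (h1 : 1 / 4 ≤ θ) (h2 : θ ≤ 3 / 2) (w : ℝ) :
    |tl θ w - 1| ≤ 310 * |w| := by
  rcases le_total (|w|) 1 with h | h
  · have := abs_le.1 (tl_two h1 h2 w)
    have a3 : w ^ 2 ≤ |w| := by rw [← sq_abs w]; exact pow_le_of_le_one (abs_nonneg _) h (by norm_num)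
    obtain ⟨b1, b2⟩ := this
    have a5 := neg_abs_le w
    have a6 := le_abs_self w
    rw [abs_le]; constructor <;> nlinarith
  · have a1 := tl_pos θ w
    have a2 := tl_le h1 w
    rw [abs_le]; constructor <;> nlinarith

lemma tl_half4 (w : ℝ) : (1 + w ^ 4) * tl (1 / 2) w ≤ 96 := by
  have h1 : tl (1 / 2) w ≤ Real.exp 1 * Real.exp (-(w ^ 2 / 4)) := by
    unfold tl; rw [← Real.exp_add]; apply Real.exp_le_exp.2; nlinarith [sq_nonneg (w - 2)]
  have h2 := Real.quadratic_le_exp_of_nonneg (x := w ^ 2 / 4) (by positivity)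
  have h3 : 1 + w ^ 4 ≤ 32 * Real.exp (w ^ 2 / 4) := by nlinarith [sq_nonneg (w ^ 2)]
  have h4 := Real.exp_one_lt_d9
  rw [Real.exp_neg] at h1
  have h5 := Real.exp_pos (w ^ 2 / 4)
  have h6 := (tl_pos (1 / 2) w).le
  calc (1 + w ^ 4) * tl (1 / 2) w ≤ 32 * Real.exp (w ^ 2 / 4) * (Real.exp 1 * (Real.exp (w ^ 2 / 4))⁻¹) := by
        gcongr
    _ = 32 * Real.exp 1 := by field_simp
    _ ≤ 96 := by linarith

/-- the tilted summand -/
noncomputable def ft (l X : ℝ) : ℝ := X - l * X ^ 2 / 2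

lemma ft_one (l X : ℝ) (hl : 0 ≤ l) :
    |ft l X * tl (1 / 2) (l * X) - (X + l / 2 * X ^ 2)| ≤ 460 * l ^ 2 * |X| ^ 3 := by
  have a := tl_two (θ := 1/2) (by norm_num) (by norm_num) (l * X)
  have b := tl_one (θ := 1/2) (by norm_num) (by norm_num) (l * X)
  have e : ft l X * tl (1 / 2) (l * X) - (X + l / 2 * X ^ 2) =
     X * (tl (1 / 2) (l * X) - 1 - l * X) - l * X ^ 2 / 2 * (tl (1 / 2) (l * X) - 1) := by
    unfold ft; ring
  rw [e]
  refine (abs_sub _ _).trans ?_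
  rw [abs_mul, abs_mul, abs_of_nonneg (by positivity : 0 ≤ l * X ^ 2 / 2)]
  have e2 : X ^ 2 = |X| ^ 2 := (sq_abs X).symm
  have e3 : |l * X| = l * |X| := by rw [abs_mul, abs_of_nonneg hl]
  calc _ ≤ |X| * (300 * (l * X) ^ 2) + l * X ^ 2 / 2 * (310 * |l * X|) := by gcongr
    _ = 455 * (l ^ 2 * |X| ^ 3) := by rw [e3, mul_pow, e2]; ring
    _ ≤ _ := by nlinarith [show 0 ≤ l ^ 2 * |X| ^ 3 by positivity]

lemma ft_two (l X : ℝ) (hl : 0 ≤ l) :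
    |ft l X ^ 2 * tl (1 / 2) (l * X) - X ^ 2| ≤ 340 * l * |X| ^ 3 := by
  have b := tl_one (θ := 1/2) (by norm_num) (by norm_num) (l * X)
  have c := tl_half4 (l * X)
  have d := tl_le (θ := 1/2) (by norm_num) (l * X)
  have p := tl_pos (1/2) (l * X)
  set w := l * X with hw
  set T := tl (1 / 2) w
  have e : ft l X ^ 2 * T - X ^ 2 = X ^ 2 * ((T - 1) - w * T + w ^ 2 * T / 4) := by
    unfold ft; rw [hw]; ring
  have h1 : |w| * T ≤ 96 := by
    refine le_trans ?_ c
    gcongr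
    have : w ^ 4 = |w| ^ 4 := by rw [← abs_pow]; rw [abs_of_nonneg (by positivity)]
    rw [this]
    nlinarith [sq_nonneg (|w| - 1), sq_nonneg (|w| ^ 2 - 1), abs_nonneg w]
  have e3 : |w| = l * |X| := by rw [hw, abs_mul, abs_of_nonneg hl]
  rw [e, abs_mul, abs_of_nonneg (sq_nonneg X)]
  have h2 : |(T - 1) - w * T + w ^ 2 * T / 4| ≤ 340 * |w| := by
    have i1 : |w * T| ≤ 3 * |w| := by rw [abs_mul, abs_of_pos p]; nlinarith [abs_nonneg w]
    have i2 : |w ^ 2 * T / 4| ≤ 24 * |w| := by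
      rw [abs_of_nonneg (by positivity), ← sq_abs]; nlinarith [abs_nonneg w]
    have i3 := abs_add_le ((T - 1) - w * T) (w ^ 2 * T / 4)
    have i4 := abs_sub (T - 1) (w * T)
    nlinarith [abs_nonneg w]
  calc _ ≤ X ^ 2 * (340 * |w|) := by gcongr
    _ = _ := by rw [e3, ← sq_abs X]; ring

lemma ft_three (l X : ℝ) : |ft l X| ^ 3 * tl (1 / 2) (l * X) ≤ 60 * |X| ^ 3 := by
  have c := tl_half4 (l * X)
  have d := tl_le (θ := 1/2) (by norm_num) (l * X)
  have p := tl_pos (1/2) (l * X)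
  set w := l * X with hw
  set T := tl (1 / 2) w
  have e : ft l X = X * (1 - w / 2) := by unfold ft; rw [hw]; ring
  rw [e, abs_mul, mul_pow]
  have h1 : |1 - w / 2| ^ 3 ≤ 4 + |w| ^ 3 / 2 := by
    have : |1 - w / 2| ≤ 1 + |w| / 2 := by
      have := abs_sub 1 (w/2); rw [abs_div] at this; simpa using this
    calc |1 - w / 2| ^ 3 ≤ (1 + |w| / 2) ^ 3 := by gcongr
      _ ≤ _ := by nlinarith [abs_nonneg w, mul_nonneg (add_nonneg zero_le_one (abs_nonneg w)) (sq_nonneg (|w| / 2 - 1))]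
  have h2 : |w| ^ 3 * T ≤ 96 := by
    refine le_trans ?_ c
    gcongr
    have : w ^ 4 = |w| ^ 4 := by rw [← abs_pow]; rw [abs_of_nonneg (by positivity)]
    rw [this]
    rcases le_total (|w|) 1 with h | h
    · have := pow_le_one₀ (n := 3) (abs_nonneg w) h
      have : 0 ≤ |w| ^ 4 := by positivity
      linarith
    · have := pow_le_pow_right₀ h (show 3 ≤ 4 by norm_num); linarith
  calc |X| ^ 3 * |1 - w / 2| ^ 3 * T ≤ |X| ^ 3 * (4 + |w| ^ 3 / 2) * T := by gcongr
    _ = |X| ^ 3 * (4 * T + |w| ^ 3 * T / 2) := by ring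
    _ ≤ |X| ^ 3 * 60 := by gcongr; linarith
    _ = _ := by ring

end Cram


namespace Cram
open ProbabilityTheory Set

/-- normalized martingale data -/
structure NM {Ω : Type} [mΩ : MeasurableSpace Ω] (P : Measure Ω) (F : ℕ → MeasurableSpace Ω)
    (n : ℕ) (X s b : ℕ → Ω → ℝ) (γ ε δ : ℝ) : Prop where
  Fm : Monotone F
  Fle : ∀ i, F i ≤ mΩ
  γ0 : 0 < γ
  γ1 : γ ≤ 1 / 4
  ε0 : 0 < ε
  ε1 : ε ≤ 1 / 4
  εγ : ε ≤ 2 * γ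
  δ0 : 0 ≤ δ
  δ1 : δ ≤ 1 / 4
  Xm : ∀ i < n, Measurable[F (i + 1)] (X i)
  sm : ∀ i < n, Measurable[F i] (s i)
  bm : ∀ i < n, Measurable[F i] (b i)
  s0 : ∀ i < n, ∀ ω, 0 ≤ s i ω
  sγ : ∀ i < n, ∀ ω, s i ω ≤ γ ^ 2
  b0 : ∀ i < n, ∀ ω, 0 ≤ b i ω
  bγ : ∀ i < n, ∀ ω, b i ω ≤ γ * s i ω
  sb : ∀ i < n, ∀ ω, s i ω * Real.sqrt (s i ω) ≤ b i ω
  i3 : ∀ i < n, Integrable (fun ω => |X i ω| ^ 3) P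
  E1 : ∀ i < n, P[X i|F i] =ᵐ[P] 0
  E2 : ∀ i < n, P[fun ω => X i ω ^ 2|F i] =ᵐ[P] s i
  E3 : ∀ i < n, P[fun ω => |X i ω| ^ 3|F i] =ᵐ[P] b i
  HV : ∀ᵐ ω ∂P, |∑ i ∈ Finset.range n, s i ω - 1| ≤ δ ^ 2
  HB : ∀ᵐ ω ∂P, ∑ i ∈ Finset.range n, b i ω ≤ ε

section
variable {Ω : Type} [mΩ : MeasurableSpace Ω] (P : Measure Ω)
  (F : ℕ → MeasurableSpace Ω) (n : ℕ) (X : ℕ → Ω → ℝ) (l θ : ℝ)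

/-- tilting factor -/
noncomputable def ee (i : ℕ) (ω : Ω) : ℝ := tl θ (l * X i ω)

/-- conditional normalisation -/
noncomputable def mm (i : ℕ) (ω : Ω) : ℝ := max ((P[ee X l θ i|F i]) ω) (1 / 2)

/-- partial densities -/
noncomputable def GG (k : ℕ) (ω : Ω) : ℝ := ∏ i ∈ Finset.range k, (ee X l θ i ω / mm P F X l θ i ω)

/-- tilted measure -/
noncomputable def tilt : Measure Ω := P.withDensity (fun ω => ENNReal.ofReal (GG P F X l θ n ω))
end

namespace NM
variable {Ω : Type} [mΩ : MeasurableSpace Ω] {P : Measure Ω} [IsProbabilityMeasure P]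
  {F : ℕ → MeasurableSpace Ω} {n : ℕ} {X s b : ℕ → Ω → ℝ} {γ ε δ : ℝ}

lemma Xm' (H : NM P F n X s b γ ε δ) {i : ℕ} (hi : i < n) : Measurable (X i) :=
  (H.Xm i hi).mono (H.Fle _) le_rfl

lemma X1 (H : NM P F n X s b γ ε δ) {i : ℕ} (hi : i < n) : Integrable (X i) P := by
  refine ((integrable_const (1:ℝ)).add (H.i3 i hi)).mono' (H.Xm' hi).aestronglyMeasurable
    (Eventually.of_forall fun ω => ?_)
  simp only [Real.norm_eq_abs, Pi.add_apply]
  nlinarith [sq_nonneg (|X i ω| - 1), abs_nonneg (X i ω), mul_nonneg (abs_nonneg (X i ω)) (sq_nonneg (|X i ω| - 1))]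

lemma X2 (H : NM P F n X s b γ ε δ) {i : ℕ} (hi : i < n) : Integrable (fun ω => X i ω ^ 2) P := by
  refine ((integrable_const (1:ℝ)).add (H.i3 i hi)).mono' ((H.Xm' hi).pow_const 2).aestronglyMeasurable
    (Eventually.of_forall fun ω => ?_)
  simp only [Real.norm_eq_abs, Pi.add_apply, abs_pow]
  nlinarith [sq_nonneg (|X i ω| - 1), abs_nonneg (X i ω), mul_nonneg (abs_nonneg (X i ω)) (sq_nonneg (|X i ω| - 1))]

lemma poly_int (H : NM P F n X s b γ ε δ) {i : ℕ} (hi : i < n) (c α β C : ℝ) :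
    Integrable (fun ω => c + α * X i ω + β * X i ω ^ 2 + C * |X i ω| ^ 3) P :=
  (((integrable_const c).add ((H.X1 hi).const_mul α)).add ((H.X2 hi).const_mul β)).add ((H.i3 i hi).const_mul C)

lemma ce_poly (H : NM P F n X s b γ ε δ) {i : ℕ} (hi : i < n) (c α β C : ℝ) :
    P[fun ω => c + α * X i ω + β * X i ω ^ 2 + C * |X i ω| ^ 3|F i] =ᵐ[P]
      fun ω => c + β * s i ω + C * b i ω := by
  have h0 := H.Fle i
  have a1 := condExp_add (m := F i) (((integrable_const c).add ((H.X1 hi).const_mul α)).add ((H.X2 hi).const_mul β)) ((H.i3 i hi).const_mul C)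
  have a2 := condExp_add (m := F i) ((integrable_const c).add ((H.X1 hi).const_mul α)) ((H.X2 hi).const_mul β)
  have a3 := condExp_add (m := F i) (integrable_const (μ := P) c) ((H.X1 hi).const_mul α)
  have a4 := condExp_const (μ := P) h0 c
  have a5 := condExp_smul (m := F i) (μ := P) α (X i)
  have a6 := condExp_smul (m := F i) (μ := P) β (fun ω => X i ω ^ 2)
  have a7 := condExp_smul (m := F i) (μ := P) C (fun ω => |X i ω| ^ 3)
  filter_upwards [a1, a2, a3, a5, a6, a7, H.E1 i hi, H.E2 i hi, H.E3 i hi] with ω a1 a2 a3 a5 a6 a7 e1 e2 e3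
  refine a1.trans ?_
  simp only [Pi.add_apply, Pi.smul_apply, smul_eq_mul, Pi.zero_apply] at *
  rw [a2, a3, a4]
  change _ + (P[α • X i|F i]) ω + (P[β • fun ω => X i ω ^ 2|F i]) ω + (P[C • fun ω => |X i ω| ^ 3|F i]) ω = _
  rw [a5, a6, a7, e1, e2, e3]; ring

lemma dom_int (H : NM P F n X s b γ ε δ) {i : ℕ} (hi : i < n) {c α β C : ℝ} {g : Ω → ℝ} (hg : Measurable g)
    (hb : ∀ ω, |g ω - (c + α * X i ω + β * X i ω ^ 2)| ≤ C * |X i ω| ^ 3) : Integrable g P := by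
  have h1 := H.poly_int hi c α β 0
  have : Integrable (fun ω => g ω - (c + α * X i ω + β * X i ω ^ 2 + 0 * |X i ω| ^ 3)) P := by
    refine ((H.i3 i hi).const_mul C).mono' (hg.aestronglyMeasurable.sub h1.1) (Eventually.of_forall fun ω => ?_)
    simpa using hb ω
  exact (this.add h1).congr (Eventually.of_forall fun ω => by simp)

lemma ce_bound (H : NM P F n X s b γ ε δ) {i : ℕ} (hi : i < n) {c α β C : ℝ} {g : Ω → ℝ} (hg : Measurable g)
    (hb : ∀ ω, |g ω - (c + α * X i ω + β * X i ω ^ 2)| ≤ C * |X i ω| ^ 3) :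
    ∀ᵐ ω ∂P, |(P[g|F i]) ω - (c + β * s i ω)| ≤ C * b i ω := by
  have gi := H.dom_int hi hg hb
  have u := condExp_mono (m := F i) gi (H.poly_int hi c α β C) (Eventually.of_forall fun ω => by
    have := (abs_le.1 (hb ω)).2; simp only; linarith)
  have v := condExp_mono (m := F i) (H.poly_int hi c α β (-C)) gi (Eventually.of_forall fun ω => by
    have := (abs_le.1 (hb ω)).1; simp only; linarith)
  filter_upwards [u, v, H.ce_poly hi c α β C, H.ce_poly hi c α β (-C)] with ω u v e1 e2
  rw [e1] at u; rw [e2] at v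
  rw [abs_le]; constructor <;> linarith

end NM
end Cram


namespace Cram
open ProbabilityTheory Set

/-- tilting parameter constraints -/
structure TP (l θ γ : ℝ) : Prop where
  l0 : 0 ≤ l
  lγ : l * γ ≤ 1 / 1000
  θ1 : 1 / 4 ≤ θ
  θ2 : θ ≤ 3 / 2

lemma pull {Ω : Type} [mΩ : MeasurableSpace Ω] {P : Measure Ω} [IsProbabilityMeasure P] {m : MeasurableSpace Ω}
    (hm : m ≤ mΩ) {f g : Ω → ℝ} (hf : Measurable[m] f) (hfg : Integrable (fun ω => f ω * g ω) P) (hg : Integrable g P) :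
    Integrable (fun ω => f ω * (P[g|m]) ω) P ∧ ∫ ω, f ω * g ω ∂P = ∫ ω, f ω * (P[g|m]) ω ∂P := by
  have h := condExp_mul_of_stronglyMeasurable_left hf.stronglyMeasurable hfg hg
  refine ⟨(integrable_condExp (m := m) (f := f * g)).congr h, ?_⟩
  have h2 : ∫ ω, (P[f * g|m]) ω ∂P = ∫ ω, (f * g) ω ∂P := integral_condExp hm
  rw [integral_congr_ae h] at h2
  exact h2.symm

namespace NM
variable {Ω : Type} [mΩ : MeasurableSpace Ω] {P : Measure Ω} [IsProbabilityMeasure P]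
  {F : ℕ → MeasurableSpace Ω} {n : ℕ} {X s b : ℕ → Ω → ℝ} {γ ε δ l θ : ℝ}

lemma ls (H : NM P F n X s b γ ε δ) (T : TP l θ γ) {i : ℕ} (hi : i < n) (ω : Ω) :
    l * Real.sqrt (s i ω) ≤ 1 / 1000 := by
  refine le_trans ?_ T.lγ
  have : Real.sqrt (s i ω) ≤ γ := Real.sqrt_le_iff.2 ⟨H.γ0.le, H.sγ i hi ω⟩
  have := T.l0
  gcongr

lemma ls2 (H : NM P F n X s b γ ε δ) (T : TP l θ γ) {i : ℕ} (hi : i < n) (ω : Ω) :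
    l ^ 2 * s i ω ≤ 1 / 1000000 := by
  have h1 : l ^ 2 * s i ω ≤ l ^ 2 * γ ^ 2 := mul_le_mul_of_nonneg_left (H.sγ i hi ω) (sq_nonneg l)
  have h2 : (l * γ) ^ 2 ≤ (1 / 1000) ^ 2 := pow_le_pow_left₀ (mul_nonneg T.l0 H.γ0.le) T.lγ 2
  nlinarith

lemma lb (H : NM P F n X s b γ ε δ) (T : TP l θ γ) {i : ℕ} (hi : i < n) (ω : Ω) :
    l * b i ω ≤ 1 / 1000 * s i ω := by
  have h1 : l * b i ω ≤ l * (γ * s i ω) := mul_le_mul_of_nonneg_left (H.bγ i hi ω) T.l0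
  have h2 : l * γ * s i ω ≤ 1 / 1000 * s i ω := mul_le_mul_of_nonneg_right T.lγ (H.s0 i hi ω)
  nlinarith

lemma lb3 (H : NM P F n X s b γ ε δ) (T : TP l θ γ) {i : ℕ} (hi : i < n) (ω : Ω) :
    l ^ 3 * b i ω ≤ 1 / 1000000000 := by
  have h1 : l ^ 2 * (l * b i ω) ≤ l ^ 2 * (1 / 1000 * s i ω) := mul_le_mul_of_nonneg_left (H.lb T hi ω) (sq_nonneg l)
  have h2 := H.ls2 T hi ω
  nlinarith

lemma ee_pos (X : ℕ → Ω → ℝ) (l θ : ℝ) (i : ℕ) (ω : Ω) : 0 < ee X l θ i ω := tl_pos _ _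

lemma ee_le (X : ℕ → Ω → ℝ) (T : TP l θ γ) (i : ℕ) (ω : Ω) : ee X l θ i ω ≤ 3 := tl_le T.θ1 _

lemma ee_meas (H : NM P F n X s b γ ε δ) (l θ : ℝ) {i : ℕ} (hi : i < n) : Measurable[F (i + 1)] (ee X l θ i) := by
  unfold ee tl
  have := H.Xm i hi
  fun_prop

lemma ee_meas' (H : NM P F n X s b γ ε δ) (l θ : ℝ) {i : ℕ} (hi : i < n) : Measurable (ee X l θ i) :=
  (H.ee_meas l θ hi).mono (H.Fle _) le_rfl

lemma mm_meas (l θ : ℝ) (i : ℕ) : Measurable[F i] (mm P F X l θ i) := by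
  unfold mm
  exact (stronglyMeasurable_condExp.measurable).max measurable_const

lemma mm_ge (i : ℕ) (ω : Ω) : 1 / 2 ≤ mm P F X l θ i ω := le_max_right _ _

lemma mm_pos (i : ℕ) (ω : Ω) : 0 < mm P F X l θ i ω := lt_of_lt_of_le (by norm_num) (mm_ge i ω)

lemma ee_int (H : NM P F n X s b γ ε δ) (T : TP l θ γ) {i : ℕ} (hi : i < n) : Integrable (ee X l θ i) P :=
  int_bdd' (H.ee_meas' l θ hi) 3 fun ω => by
    rw [abs_of_pos (ee_pos X l θ i ω)]; exact ee_le X T i ω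

lemma mm_ae (H : NM P F n X s b γ ε δ) (T : TP l θ γ) {i : ℕ} (hi : i < n) :
    ∀ᵐ ω ∂P, (P[ee X l θ i|F i]) ω = mm P F X l θ i ω ∧
      |mm P F X l θ i ω - 1 - (1 / 2 - θ) * l ^ 2 * s i ω| ≤ 300 * l ^ 3 * b i ω ∧
      |mm P F X l θ i ω - 1| ≤ 1 / 100 := by
  have h := H.ce_bound hi (c := 1) (α := l) (β := (1 / 2 - θ) * l ^ 2) (C := 300 * l ^ 3) (H.ee_meas' l θ hi)
    (fun ω => by
      have := tl_three T.θ1 T.θ2 (l * X i ω)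
      unfold ee
      rw [abs_mul, abs_of_nonneg T.l0, mul_pow l |X i ω| 3] at this
      calc _ = |tl θ (l * X i ω) - 1 - l * X i ω - (1 / 2 - θ) * (l * X i ω) ^ 2| := by congr 1; ring
        _ ≤ _ := by linarith)
  filter_upwards [h] with ω h
  have h1 := H.ls2 T hi ω
  have h2 := H.lb3 T hi ω
  have h3 : 0 ≤ l ^ 2 * s i ω := mul_nonneg (sq_nonneg l) (H.s0 i hi ω)
  have a1 := T.θ1
  have a2 := T.θ2
  have h4 : |(P[ee X l θ i|F i]) ω - 1| ≤ 1 / 100 := by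
    obtain ⟨h5, h6⟩ := abs_le.1 h
    rw [abs_le]; constructor <;> nlinarith
  have h5 : (P[ee X l θ i|F i]) ω = mm P F X l θ i ω := by
    unfold mm; rw [max_eq_left]; linarith [(abs_le.1 h4).1]
  rw [h5] at h h4
  refine ⟨h5, ?_, h4⟩
  rwa [show mm P F X l θ i ω - 1 - (1 / 2 - θ) * l ^ 2 * s i ω = mm P F X l θ i ω - (1 + (1 / 2 - θ) * l ^ 2 * s i ω) by ring]

lemma em_pos (i : ℕ) (ω : Ω) : 0 < ee X l θ i ω / mm P F X l θ i ω := div_pos (ee_pos X l θ i ω) (mm_pos i ω)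

lemma em_le (T : TP l θ γ) (i : ℕ) (ω : Ω) : ee X l θ i ω / mm P F X l θ i ω ≤ 6 := by
  rw [div_le_iff₀ (mm_pos i ω)]
  linarith [ee_le X T i ω, mm_ge (P := P) (F := F) (X := X) (l := l) (θ := θ) i ω]

lemma GG_pos (k : ℕ) (ω : Ω) : 0 < GG P F X l θ k ω := Finset.prod_pos fun i _ => em_pos i ω

lemma GG_le (T : TP l θ γ) (k : ℕ) (ω : Ω) : GG P F X l θ k ω ≤ 6 ^ k := by
  unfold GG
  calc _ ≤ ∏ i ∈ Finset.range k, (6:ℝ) := Finset.prod_le_prod (fun i _ => (em_pos i ω).le) fun i _ => em_le T i ω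
    _ = _ := by simp

lemma GG_meas (H : NM P F n X s b γ ε δ) (l θ : ℝ) {k : ℕ} (hk : k ≤ n) : Measurable[F k] (GG P F X l θ k) := by
  unfold GG
  refine Finset.measurable_fun_prod _ fun i hi => ?_
  have hi := Finset.mem_range.1 hi
  exact ((H.ee_meas l θ (by omega)).mono (H.Fm (by omega)) le_rfl).div
    ((mm_meas l θ i).mono (H.Fm (by omega)) le_rfl)

lemma GG_meas' (H : NM P F n X s b γ ε δ) (l θ : ℝ) {k : ℕ} (hk : k ≤ n) : Measurable (GG P F X l θ k) :=
  (H.GG_meas l θ hk).mono (H.Fle _) le_rfl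

lemma GG_succ (k : ℕ) (ω : Ω) : GG P F X l θ (k + 1) ω = GG P F X l θ k ω * (ee X l θ k ω / mm P F X l θ k ω) := by
  unfold GG; rw [Finset.prod_range_succ]

lemma tower (H : NM P F n X s b γ ε δ) (T : TP l θ γ) {k : ℕ} {h : Ω → ℝ} (hh : Measurable[F k] h)
    (hi : Integrable (fun ω => h ω * GG P F X l θ k ω) P) (j : ℕ) (hj : k + j ≤ n) :
    Integrable (fun ω => h ω * GG P F X l θ (k + j) ω) P ∧
    ∫ ω, h ω * GG P F X l θ (k + j) ω ∂P = ∫ ω, h ω * GG P F X l θ k ω ∂P := by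
  induction j with
  | zero => exact ⟨hi, rfl⟩
  | succ j ih =>
    obtain ⟨i1, i2⟩ := ih (by omega)
    have hlt : k + j < n := by omega
    set q := k + j with hq
    have mq : Measurable[F q] fun ω => h ω * GG P F X l θ q ω / mm P F X l θ q ω :=
      ((hh.mono (H.Fm (by omega)) le_rfl).mul (H.GG_meas l θ hlt.le)).div (mm_meas l θ q)
    have m1 : Measurable (mm P F X l θ q) := (mm_meas l θ q).mono (H.Fle _) le_rfl
    have e : ∀ ω, h ω * GG P F X l θ (q + 1) ω = (h ω * GG P F X l θ q ω / mm P F X l θ q ω) * ee X l θ q ω := fun ω => by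
      rw [GG_succ]; ring
    have i3 : Integrable (fun ω => (h ω * GG P F X l θ q ω / mm P F X l θ q ω) * ee X l θ q ω) P := by
      refine (int_bdd (f := fun ω => ee X l θ q ω / mm P F X l θ q ω) ((H.ee_meas' l θ hlt).div m1) 6 (fun ω => ?_) i1).congr
        (Eventually.of_forall fun ω => by simp only; ring)
      rw [abs_of_pos (em_pos q ω)]; exact em_le T q ω
    rw [show k + (j + 1) = q + 1 by omega]
    simp only [e]
    refine ⟨i3, ?_⟩
    rw [← i2, (pull (H.Fle q) mq i3 (H.ee_int T hlt)).2]
    refine integral_congr_ae ?_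
    filter_upwards [H.mm_ae T hlt] with ω hω
    rw [hω.1]; field_simp [(mm_pos (P := P) (F := F) (X := X) (l := l) (θ := θ) q ω).ne']

lemma tilt_int (H : NM P F n X s b γ ε δ) (g : Ω → ℝ) :
    ∫ ω, g ω ∂(tilt P F n X l θ) = ∫ ω, g ω * GG P F X l θ n ω ∂P := by
  unfold tilt
  rw [integral_withDensity_eq_integral_toReal_smul (H.GG_meas' l θ le_rfl).ennreal_ofReal
    (Eventually.of_forall fun ω => ENNReal.ofReal_lt_top)]
  refine integral_congr_ae (Eventually.of_forall fun ω => ?_)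
  simp only [smul_eq_mul]
  rw [ENNReal.toReal_ofReal (GG_pos n ω).le, mul_comm]

lemma tilt_integrable (H : NM P F n X s b γ ε δ) (g : Ω → ℝ) :
    Integrable g (tilt P F n X l θ) ↔ Integrable (fun ω => g ω * GG P F X l θ n ω) P := by
  unfold tilt
  rw [integrable_withDensity_iff_integrable_smul' (H.GG_meas' l θ le_rfl).ennreal_ofReal
    (Eventually.of_forall fun ω => ENNReal.ofReal_lt_top)]
  refine integrable_congr (Eventually.of_forall fun ω => ?_)
  simp only [smul_eq_mul]
  rw [ENNReal.toReal_ofReal (GG_pos n ω).le, mul_comm]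

lemma tilt_prob (H : NM P F n X s b γ ε δ) (T : TP l θ γ) : IsProbabilityMeasure (tilt P F n X l θ) := by
  constructor
  have h := H.tower T (k := 0) (h := fun _ => 1) measurable_const (by simp [GG]) n (by omega)
  simp only [one_mul, zero_add] at h
  have h2 : ∫ ω, GG P F X l θ 0 ω ∂P = 1 := by simp [GG]
  rw [h2] at h
  unfold tilt
  rw [withDensity_apply _ MeasurableSet.univ, Measure.restrict_univ,
    ← ofReal_integral_eq_lintegral_ofReal h.1 (Eventually.of_forall fun ω => (GG_pos n ω).le), h.2]
  simp

lemma tilt_ae (Q : Ω → Prop) (h : ∀ᵐ ω ∂P, Q ω) : ∀ᵐ ω ∂(tilt P F n X l θ), Q ω :=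
  (withDensity_absolutelyContinuous P _).ae_le h

/-- main transfer lemma -/
lemma tcond (H : NM P F n X s b γ ε δ) (T : TP l θ γ) {i : ℕ} (hi : i < n) {f g : Ω → ℝ} {C : ℝ}
    (hf : Measurable[F i] f) (hC : ∀ ω, |f ω| ≤ C) (hg : Measurable[F (i + 1)] g)
    (hge : Integrable (fun ω => g ω * ee X l θ i ω) P) :
    Integrable (fun ω => f ω * g ω) (tilt P F n X l θ) ∧
    Integrable (fun ω => f ω * GG P F X l θ i ω / mm P F X l θ i ω * (P[fun ω => g ω * ee X l θ i ω|F i]) ω) P ∧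
    ∫ ω, f ω * g ω ∂(tilt P F n X l θ) =
      ∫ ω, f ω * GG P F X l θ i ω / mm P F X l θ i ω * (P[fun ω => g ω * ee X l θ i ω|F i]) ω ∂P := by
  have mf : Measurable[F i] fun ω => f ω * GG P F X l θ i ω / mm P F X l θ i ω :=
    (hf.mul (H.GG_meas l θ hi.le)).div (mm_meas l θ i)
  have mb : ∀ ω, |f ω * GG P F X l θ i ω / mm P F X l θ i ω| ≤ C * 6 ^ i * 2 := fun ω => by
    have m0 := mm_ge (P := P) (F := F) (X := X) (l := l) (θ := θ) i ω
    have m1 := mm_pos (P := P) (F := F) (X := X) (l := l) (θ := θ) i ω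
    have hC0 : 0 ≤ C := (abs_nonneg _).trans (hC ω)
    rw [abs_div, abs_mul, abs_of_pos m1, abs_of_pos (GG_pos i ω), div_le_iff₀ m1]
    have h1 : |f ω| * GG P F X l θ i ω ≤ C * 6 ^ i :=
      mul_le_mul (hC ω) (GG_le T i ω) (GG_pos i ω).le hC0
    have h2 : 0 ≤ C * 6 ^ i := by positivity
    nlinarith
  have i1 : Integrable (fun ω => f ω * GG P F X l θ i ω / mm P F X l θ i ω * (g ω * ee X l θ i ω)) P :=
    int_bdd (mf.mono (H.Fle _) le_rfl) _ mb hge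
  have e : ∀ ω, f ω * g ω * GG P F X l θ (i + 1) ω =
      f ω * GG P F X l θ i ω / mm P F X l θ i ω * (g ω * ee X l θ i ω) := fun ω => by rw [GG_succ]; ring
  have tw := H.tower T (k := i + 1) (h := fun ω => f ω * g ω) ((hf.mono (H.Fm (by omega)) le_rfl).mul hg)
    (by simp only [e]; exact i1) (n - (i + 1)) (by omega)
  rw [show i + 1 + (n - (i + 1)) = n by omega] at tw
  refine ⟨(H.tilt_integrable _).2 tw.1, (pull (H.Fle i) mf i1 hge).1, ?_⟩
  rw [H.tilt_int, tw.2, ← (pull (H.Fle i) mf i1 hge).2]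
  simp only [e]

lemma tmeas (H : NM P F n X s b γ ε δ) (T : TP l θ γ) {i : ℕ} (hi : i < n) {f : Ω → ℝ} {C : ℝ}
    (hf : Measurable[F i] f) (hC : ∀ ω, |f ω| ≤ C) :
    Integrable f (tilt P F n X l θ) ∧ Integrable (fun ω => f ω * GG P F X l θ i ω) P ∧
    ∫ ω, f ω ∂(tilt P F n X l θ) = ∫ ω, f ω * GG P F X l θ i ω ∂P := by
  have i1 : Integrable (fun ω => f ω * GG P F X l θ i ω) P :=
    int_bdd (hf.mono (H.Fle _) le_rfl) C hC (int_bdd' (H.GG_meas' l θ hi.le) (6 ^ i) fun ω => by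
      rw [abs_of_pos (GG_pos i ω)]; exact GG_le T i ω)
  have tw := H.tower T hf i1 (n - i) (by omega)
  rw [show i + (n - i) = n by omega] at tw
  exact ⟨(H.tilt_integrable _).2 tw.1, i1, by rw [H.tilt_int, tw.2]⟩

lemma tle (H : NM P F n X s b γ ε δ) (T : TP l θ γ) {i : ℕ} (hi : i < n) {f g u : Ω → ℝ} {C C' : ℝ}
    (hf : Measurable[F i] f) (hC : ∀ ω, |f ω| ≤ C) (hf0 : ∀ ω, 0 ≤ f ω) (hg : Measurable[F (i + 1)] g)
    (hge : Integrable (fun ω => g ω * ee X l θ i ω) P)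
    (hu : Measurable[F i] u) (hC' : ∀ ω, |u ω| ≤ C')
    (hle : ∀ᵐ ω ∂P, (P[fun ω => g ω * ee X l θ i ω|F i]) ω ≤ mm P F X l θ i ω * u ω) :
    ∫ ω, f ω * g ω ∂(tilt P F n X l θ) ≤ ∫ ω, f ω * u ω ∂(tilt P F n X l θ) := by
  obtain ⟨-, i1, e1⟩ := H.tcond T hi hf hC hg hge
  obtain ⟨-, i2, e2⟩ := H.tmeas T hi (f := fun ω => f ω * u ω) (C := C * C') (hf.mul hu) (fun ω => by
    rw [abs_mul]; exact mul_le_mul (hC ω) (hC' ω) (abs_nonneg _) ((abs_nonneg _).trans (hC ω)))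
  rw [e1, e2]
  refine integral_mono_ae i1 i2 ?_
  filter_upwards [hle] with ω h
  have m1 := mm_pos (P := P) (F := F) (X := X) (l := l) (θ := θ) i ω
  have : 0 ≤ f ω * GG P F X l θ i ω / mm P F X l θ i ω :=
    div_nonneg (mul_nonneg (hf0 ω) (GG_pos i ω).le) m1.le
  calc _ ≤ f ω * GG P F X l θ i ω / mm P F X l θ i ω * (mm P F X l θ i ω * u ω) := mul_le_mul_of_nonneg_left h this
    _ = _ := by field_simp

lemma tabs (H : NM P F n X s b γ ε δ) (T : TP l θ γ) {i : ℕ} (hi : i < n) {f g u w : Ω → ℝ} {C C' C'' : ℝ}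
    (hf : Measurable[F i] f) (hC : ∀ ω, |f ω| ≤ C) (hg : Measurable[F (i + 1)] g)
    (hge : Integrable (fun ω => g ω * ee X l θ i ω) P)
    (hu : Measurable[F i] u) (hC' : ∀ ω, |u ω| ≤ C') (hw : Measurable[F i] w) (hC'' : ∀ ω, |w ω| ≤ C'')
    (hle : ∀ᵐ ω ∂P, |(P[fun ω => g ω * ee X l θ i ω|F i]) ω - mm P F X l θ i ω * u ω| ≤ mm P F X l θ i ω * w ω) :
    |∫ ω, f ω * g ω ∂(tilt P F n X l θ) - ∫ ω, f ω * u ω ∂(tilt P F n X l θ)| ≤ ∫ ω, |f ω| * w ω ∂(tilt P F n X l θ) := by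
  obtain ⟨-, i1, e1⟩ := H.tcond T hi hf hC hg hge
  obtain ⟨-, i2, e2⟩ := H.tmeas T hi (f := fun ω => f ω * u ω) (C := C * C') (hf.mul hu) (fun ω => by
    rw [abs_mul]; exact mul_le_mul (hC ω) (hC' ω) (abs_nonneg _) ((abs_nonneg _).trans (hC ω)))
  obtain ⟨-, i3, e3⟩ := H.tmeas T hi (f := fun ω => |f ω| * w ω) (C := C * C'') (Measurable.mul (continuous_abs.measurable.comp hf) hw) (fun ω => by
    rw [abs_mul, abs_abs]; exact mul_le_mul (hC ω) (hC'' ω) (abs_nonneg _) ((abs_nonneg _).trans (hC ω)))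
  rw [e1, e2, e3, ← integral_sub i1 i2]
  refine (abs_integral_le_integral_abs).trans ?_
  refine integral_mono_ae (subI i1 i2).abs i3 ?_
  filter_upwards [hle] with ω h
  have m1 := mm_pos (P := P) (F := F) (X := X) (l := l) (θ := θ) i ω
  have g1 := GG_pos (P := P) (F := F) (X := X) (l := l) (θ := θ) i ω
  have e : f ω * GG P F X l θ i ω / mm P F X l θ i ω * (P[fun ω => g ω * ee X l θ i ω|F i]) ω - f ω * u ω * GG P F X l θ i ω
    = f ω * GG P F X l θ i ω / mm P F X l θ i ω * ((P[fun ω => g ω * ee X l θ i ω|F i]) ω - mm P F X l θ i ω * u ω) := by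
    field_simp
  rw [e, abs_mul, abs_div, abs_mul, abs_of_pos m1, abs_of_pos g1]
  calc _ ≤ |f ω| * GG P F X l θ i ω / mm P F X l θ i ω * (mm P F X l θ i ω * w ω) := by gcongr
    _ = _ := by field_simp

end NM
end Cram


namespace Cram
open ProbabilityTheory Set

section
variable {Ω : Type} [mΩ : MeasurableSpace Ω] (P : Measure Ω)
  (F : ℕ → MeasurableSpace Ω) (X : ℕ → Ω → ℝ) (l : ℝ)

/-- tilted summand -/
noncomputable def ff (i : ℕ) (ω : Ω) : ℝ := ft l (X i ω)

/-- tilted conditional mean -/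
noncomputable def hh (i : ℕ) (ω : Ω) : ℝ :=
  max (-1) (min 1 ((P[fun ω => ff X l i ω * ee X l (1 / 2) i ω|F i]) ω / mm P F X l (1 / 2) i ω))

/-- centered tilted summand -/
noncomputable def xi (i : ℕ) (ω : Ω) : ℝ := ff X l i ω - hh P F X l i ω
end

namespace NM
variable {Ω : Type} [mΩ : MeasurableSpace Ω] {P : Measure Ω} [IsProbabilityMeasure P]
  {F : ℕ → MeasurableSpace Ω} {n : ℕ} {X s b : ℕ → Ω → ℝ} {γ ε δ l : ℝ}

lemma ff_meas (H : NM P F n X s b γ ε δ) (l : ℝ) {i : ℕ} (hi : i < n) : Measurable[F (i + 1)] (ff X l i) := by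
  unfold ff ft
  have := H.Xm i hi
  fun_prop

lemma hh_meas (l : ℝ) (i : ℕ) : Measurable[F i] (hh P F X l i) := by
  unfold hh
  exact measurable_const.max (measurable_const.min ((stronglyMeasurable_condExp.measurable).div (mm_meas l _ i)))

lemma hh_bdd (i : ℕ) (ω : Ω) : |hh P F X l i ω| ≤ 1 := by
  unfold hh
  rw [abs_le]
  exact ⟨le_max_left _ _, max_le (by norm_num) (min_le_left _ _)⟩

lemma f1_bound (hl : 0 ≤ l) (i : ℕ) (ω : Ω) :
    |ff X l i ω * ee X l (1 / 2) i ω - (0 + 1 * X i ω + l / 2 * X i ω ^ 2)| ≤ 460 * l ^ 2 * |X i ω| ^ 3 := by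
  have := ft_one l (X i ω) hl
  rw [zero_add, one_mul]
  exact this

lemma f2_bound (hl : 0 ≤ l) (i : ℕ) (ω : Ω) :
    |ff X l i ω ^ 2 * ee X l (1 / 2) i ω - (0 + 0 * X i ω + 1 * X i ω ^ 2)| ≤ 340 * l * |X i ω| ^ 3 := by
  have := ft_two l (X i ω) hl
  rw [zero_mul, zero_add, one_mul, zero_add]
  exact this

lemma f3_bound (i : ℕ) (ω : Ω) :
    |(|ff X l i ω| ^ 3 * ee X l (1 / 2) i ω) - (0 + 0 * X i ω + 0 * X i ω ^ 2)| ≤ 60 * |X i ω| ^ 3 := by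
  have := ft_three l (X i ω)
  rw [zero_mul, zero_mul, add_zero, add_zero, sub_zero, abs_of_nonneg (mul_nonneg (by positivity) (ee_pos X l _ i ω).le)]
  exact this

lemma m_half (H : NM P F n X s b γ ε δ) (T : TP l (1 / 2) γ) {i : ℕ} (hi : i < n) :
    ∀ᵐ ω ∂P, |mm P F X l (1 / 2) i ω - 1| ≤ 300 * l ^ 3 * b i ω ∧ |mm P F X l (1 / 2) i ω - 1| ≤ 1 / 100 := by
  filter_upwards [H.mm_ae T hi] with ω h
  have h1 := h.2.1
  rw [show mm P F X l (1 / 2) i ω - 1 - (1 / 2 - 1 / 2) * l ^ 2 * s i ω = mm P F X l (1 / 2) i ω - 1 by ring] at h1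
  exact ⟨h1, h.2.2⟩

lemma h_ae (H : NM P F n X s b γ ε δ) (T : TP l (1 / 2) γ) {i : ℕ} (hi : i < n) :
    ∀ᵐ ω ∂P, (P[fun ω => ff X l i ω * ee X l (1 / 2) i ω|F i]) ω = mm P F X l (1 / 2) i ω * hh P F X l i ω ∧
      |hh P F X l i ω - l / 2 * s i ω| ≤ 1000 * l ^ 2 * b i ω ∧ |hh P F X l i ω| ≤ 2 * l * s i ω := by
  have hm : Measurable (fun ω => ff X l i ω * ee X l (1 / 2) i ω) :=
    ((H.ff_meas l hi).mono (H.Fle _) le_rfl).mul (H.ee_meas' l _ hi)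
  filter_upwards [H.m_half T hi, H.ce_bound hi hm (f1_bound T.l0 i)] with ω h1 h2
  set p := (P[fun ω => ff X l i ω * ee X l (1 / 2) i ω|F i]) ω
  set m := mm P F X l (1 / 2) i ω with hmdef
  have m0 : 0 < m := mm_pos i ω
  obtain ⟨h1, h1'⟩ := h1
  rw [zero_add] at h2
  have hs0 := H.s0 i hi ω
  have hb0 := H.b0 i hi ω
  have hl0 := T.l0
  have hlb := H.lb T hi ω
  have hls := H.ls2 T hi ω
  have hm2 : (99:ℝ) / 100 ≤ m := by linarith [(abs_le.1 h1').1]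
  have a1 : |p / m - l / 2 * s i ω| ≤ 1000 * l ^ 2 * b i ω := by
    have e : p / m - l / 2 * s i ω = (p - l / 2 * s i ω - (m - 1) * (l / 2 * s i ω)) / m := by field_simp; ring
    rw [e, abs_div, abs_of_pos m0, div_le_iff₀ m0]
    have t1 := abs_sub (p - l / 2 * s i ω) ((m - 1) * (l / 2 * s i ω))
    rw [abs_mul, abs_of_nonneg (by positivity : 0 ≤ l / 2 * s i ω)] at t1
    have t2 : |m - 1| * (l / 2 * s i ω) ≤ 300 * l ^ 3 * b i ω * (l / 2 * s i ω) := by gcongr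
    have t3 : 300 * l ^ 3 * b i ω * (l / 2 * s i ω) = 150 * (l ^ 2 * b i ω) * (l ^ 2 * s i ω) := by ring
    have t4 : 0 ≤ l ^ 2 * b i ω := by positivity
    have t5 : 150 * (l ^ 2 * b i ω) * (l ^ 2 * s i ω) ≤ 150 * (l ^ 2 * b i ω) * (1 / 1000000) := by gcongr
    have t6 : 1000 * l ^ 2 * b i ω * (99 / 100) ≤ 1000 * l ^ 2 * b i ω * m := by gcongr
    linarith
  have a2 : |p / m| ≤ 2 * l * s i ω := by
    have : l ^ 2 * b i ω ≤ l * (1 / 1000 * s i ω) := by nlinarith [mul_le_mul_of_nonneg_left hlb hl0]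
    have hp : 0 ≤ l * s i ω := by positivity
    obtain ⟨c1, c2⟩ := abs_le.1 a1
    rw [abs_le]; constructor <;> nlinarith
  have a3 : 2 * l * s i ω ≤ 1 := by
    have h5 : l * s i ω ≤ l * γ ^ 2 := mul_le_mul_of_nonneg_left (H.sγ i hi ω) hl0
    have := T.lγ
    have := H.γ1
    have := H.γ0
    nlinarith [mul_nonneg hl0 H.γ0.le]
  have e : hh P F X l i ω = p / m := by
    unfold hh
    obtain ⟨c1, c2⟩ := abs_le.1 (a2.trans a3)
    rw [min_eq_right c2, max_eq_right c1]
  rw [e]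
  exact ⟨by field_simp, a1, a2⟩

lemma toBE (H : NM P F n X s b γ ε δ) (T : TP l (1 / 2) γ) :
    BE (tilt P F n X l (1 / 2)) F n (xi P F X l) s (300 * γ) (400 * (l * γ)) δ := by
  have hγ0 := H.γ0
  have hl0 := T.l0
  have hlγ := T.lγ
  have hlγ0 : 0 ≤ l * γ := mul_nonneg hl0 hγ0.le
  have prob := H.tilt_prob T
  have sb' : ∀ i < n, ∀ ω, |s i ω| ≤ γ ^ 2 := fun i hi ω => by
    rw [abs_of_nonneg (H.s0 i hi ω)]; exact H.sγ i hi ω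
  have fm : ∀ i < n, Measurable (ff X l i) := fun i hi => (H.ff_meas l hi).mono (H.Fle _) le_rfl
  have i1 : ∀ i < n, Integrable (fun ω => ff X l i ω * ee X l (1 / 2) i ω) P := fun i hi =>
    H.dom_int hi ((fm i hi).mul (H.ee_meas' l _ hi)) (f1_bound T.l0 i)
  have i2 : ∀ i < n, Integrable (fun ω => ff X l i ω ^ 2 * ee X l (1 / 2) i ω) P := fun i hi =>
    H.dom_int hi (((fm i hi).pow_const 2).mul (H.ee_meas' l _ hi)) (f2_bound T.l0 i)
  have i3 : ∀ i < n, Integrable (fun ω => |ff X l i ω| ^ 3 * ee X l (1 / 2) i ω) P := fun i hi =>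
    H.dom_int hi ((((fm i hi).abs).pow_const 3).mul (H.ee_meas' l _ hi)) (f3_bound i)
  have m2 : ∀ i < n, Measurable (fun ω => ff X l i ω ^ 2 * ee X l (1 / 2) i ω) := fun i hi =>
    ((fm i hi).pow_const 2).mul (H.ee_meas' l _ hi)
  have m3 : ∀ i < n, Measurable (fun ω => |ff X l i ω| ^ 3 * ee X l (1 / 2) i ω) := fun i hi =>
    ((fm i hi).abs.pow_const 3).mul (H.ee_meas' l _ hi)
  have abm : ∀ i < n, Measurable[F (i + 1)] fun ω => |ff X l i ω| ^ 3 := fun i hi =>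
    (continuous_abs.measurable.comp (H.ff_meas l hi)).pow_const 3
  have key1 : ∀ i < n, ∀ f : Ω → ℝ, Measurable[F i] f → ∀ C, (∀ ω, |f ω| ≤ C) →
      Integrable (fun ω => f ω * ff X l i ω) (tilt P F n X l (1 / 2)) ∧
      Integrable (fun ω => f ω * hh P F X l i ω) (tilt P F n X l (1 / 2)) ∧
      ∫ ω, f ω * ff X l i ω ∂(tilt P F n X l (1 / 2)) = ∫ ω, f ω * hh P F X l i ω ∂(tilt P F n X l (1 / 2)) := by
    intro i hi f hf C hC
    refine ⟨(H.tcond T hi hf hC (H.ff_meas l hi) (i1 i hi)).1,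
      (H.tmeas T hi (hf.mul (hh_meas l i)) (C := C * 1) (fun ω => ?_)).1, ?_⟩
    · simp only [Pi.mul_apply]
      rw [abs_mul]; exact mul_le_mul (hC ω) (hh_bdd i ω) (abs_nonneg _) ((abs_nonneg _).trans (hC ω))
    have := H.tabs T hi hf hC (H.ff_meas l hi) (i1 i hi) (hh_meas l i) (hh_bdd (P := P) (F := F) (X := X) (l := l) i)
      (w := fun _ => 0) measurable_const (C'' := 0) (fun ω => by simp) (by
        filter_upwards [H.h_ae T hi] with ω h
        rw [h.1]; simp)
    simp only [mul_zero, integral_zero] at this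
    have := abs_nonpos_iff.1 this
    linarith
  refine ⟨H.Fm, H.Fle, by positivity, by positivity, by linarith, ?_, H.sm, H.s0, ?_, ?_, ?_, ?_, ?_, ?_⟩
  · intro i hi
    exact (H.ff_meas l hi).sub ((hh_meas l i).mono (H.Fm (by omega)) le_rfl)
  · intro i hi ω
    refine (H.sγ i hi ω).trans ?_
    nlinarith
  · intro i hi
    have t := (H.tcond T hi (f := fun _ => 4) measurable_const (C := 4) (fun ω => by simp) (abm i hi) (i3 i hi)).1
    refine (t.add (integrable_const (4:ℝ))).mono' ?_ (Eventually.of_forall fun ω => ?_)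
    · exact (((fm i hi).sub ((hh_meas l i).mono (H.Fle _) le_rfl)).abs.pow_const 3).aestronglyMeasurable
    · simp only [Pi.add_apply, Real.norm_eq_abs, abs_pow, abs_abs, xi]
      have a1 := abs_sub (ff X l i ω) (hh P F X l i ω)
      have a2 := hh_bdd (P := P) (F := F) (X := X) (l := l) i ω
      have a3 := abs_nonneg (ff X l i ω)
      calc _ ≤ (|ff X l i ω| + 1) ^ 3 := by gcongr; linarith
        _ ≤ _ := by nlinarith [mul_nonneg (add_nonneg a3 zero_le_one) (sq_nonneg (|ff X l i ω| - 1))]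
  · intro i hi f hf C hC
    obtain ⟨a, b, c⟩ := key1 i hi f hf C hC
    simp only [xi, mul_sub]
    rw [integral_sub a b, c, sub_self]
  · intro i hi f hf C hC
    obtain ⟨a, b', c⟩ := key1 i hi (fun ω => f ω * hh P F X l i ω) (hf.mul (hh_meas l i)) (C * 1) (fun ω => by
      rw [abs_mul]; exact mul_le_mul (hC ω) (hh_bdd i ω) (abs_nonneg _) ((abs_nonneg _).trans (hC ω)))
    have j2 := (H.tcond T hi hf hC ((H.ff_meas l hi).pow_const 2) (i2 i hi)).1
    have js : Integrable (fun ω => f ω * s i ω) (tilt P F n X l (1 / 2)) := (H.tmeas T hi (hf.mul (H.sm i hi)) (C := C * γ ^ 2) (fun ω => by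
      simp only [Pi.mul_apply]
      rw [abs_mul]; exact mul_le_mul (hC ω) (sb' i hi ω) (abs_nonneg _) ((abs_nonneg _).trans (hC ω)))).1
    have jsa : Integrable (fun ω => |f ω| * s i ω) (tilt P F n X l (1 / 2)) := (H.tmeas T hi ((continuous_abs.measurable.comp hf).mul (H.sm i hi)) (C := C * γ ^ 2) (fun ω => by
      simp only [Pi.mul_apply, Function.comp]
      rw [abs_mul, abs_abs]; exact mul_le_mul (hC ω) (sb' i hi ω) (abs_nonneg _) ((abs_nonneg _).trans (hC ω)))).1
    have t := H.tabs T hi hf hC ((H.ff_meas l hi).pow_const 2) (i2 i hi) (H.sm i hi) (sb' i hi)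
      (w := fun ω => 350 * (l * γ) * s i ω) ((H.sm i hi).const_mul _) (C'' := 350 * (l * γ) * γ ^ 2) (fun ω => by
        rw [abs_mul, abs_of_nonneg (by positivity : 0 ≤ 350 * (l * γ))]
        exact mul_le_mul_of_nonneg_left (sb' i hi ω) (by positivity)) (by
        filter_upwards [H.m_half T hi, H.ce_bound hi (m2 i hi) (f2_bound T.l0 i)] with ω h1 h2
        set p := (P[fun ω => ff X l i ω ^ 2 * ee X l (1 / 2) i ω|F i]) ω
        set m := mm P F X l (1 / 2) i ω
        have hs0 := H.s0 i hi ω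
        have hb0 := H.b0 i hi ω
        have hls := H.ls2 T hi ω
        have hbγ : l * b i ω ≤ l * γ * s i ω := by nlinarith [mul_le_mul_of_nonneg_left (H.bγ i hi ω) hl0]
        rw [zero_add, one_mul] at h2
        have q1 : p - m * s i ω = (p - s i ω) - (m - 1) * s i ω := by ring
        rw [q1]
        refine (abs_sub _ _).trans ?_
        rw [abs_mul, abs_of_nonneg hs0]
        have q2 : |m - 1| * s i ω ≤ 300 * l ^ 3 * b i ω * s i ω := mul_le_mul_of_nonneg_right h1.1 hs0
        have q3 : 300 * l ^ 3 * b i ω * s i ω = 300 * (l * b i ω) * (l ^ 2 * s i ω) := by ring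
        have q4 : 300 * (l * b i ω) * (l ^ 2 * s i ω) ≤ 300 * (l * b i ω) * (1 / 1000000) := by gcongr
        have q5 : (99:ℝ) / 100 ≤ m := by linarith [(abs_le.1 h1.2).1]
        have q6 : 99 / 100 * (350 * (l * γ) * s i ω) ≤ m * (350 * (l * γ) * s i ω) := by gcongr
        have q7 : 0 ≤ l * γ * s i ω := by positivity
        linarith)
    have e : ∫ ω, f ω * (xi P F X l i ω ^ 2 - s i ω) ∂(tilt P F n X l (1 / 2)) =
        (∫ ω, f ω * ff X l i ω ^ 2 ∂(tilt P F n X l (1 / 2)) - ∫ ω, f ω * s i ω ∂(tilt P F n X l (1 / 2)))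
        - ∫ ω, f ω * hh P F X l i ω * hh P F X l i ω ∂(tilt P F n X l (1 / 2)) := by
      have e1 : ∀ ω, f ω * (xi P F X l i ω ^ 2 - s i ω) = (f ω * ff X l i ω ^ 2 - f ω * s i ω)
         - (2 * (f ω * hh P F X l i ω * ff X l i ω) - f ω * hh P F X l i ω * hh P F X l i ω) := fun ω => by
        simp only [xi]; ring
      simp only [e1]
      rw [integral_sub (subI j2 js) (subI (a.const_mul 2) b'), integral_sub j2 js, integral_sub (a.const_mul 2) b',
        integral_const_mul, c]; ring
    rw [e]
    refine (abs_sub _ _).trans ?_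
    have h2b : |∫ ω, f ω * hh P F X l i ω * hh P F X l i ω ∂(tilt P F n X l (1 / 2))| ≤
        ∫ ω, 50 * (l * γ) * (|f ω| * s i ω) ∂(tilt P F n X l (1 / 2)) := by
      refine (abs_integral_le_integral_abs).trans (integral_mono_ae b'.abs (jsa.const_mul _) ?_)
      filter_upwards [tilt_ae _ (H.h_ae T hi)] with ω h
      have hs0 := H.s0 i hi ω
      rw [mul_assoc, abs_mul, abs_mul_self, ← sq, ← sq_abs]
      have r1 : |hh P F X l i ω| ^ 2 ≤ (2 * l * s i ω) ^ 2 := pow_le_pow_left₀ (abs_nonneg _) h.2.2 2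
      have r2 : (2 * l * s i ω) ^ 2 = 4 * l ^ 2 * s i ω * s i ω := by ring
      have r3 : 4 * l ^ 2 * s i ω * s i ω ≤ 4 * l ^ 2 * γ ^ 2 * s i ω := by
        gcongr; exact H.sγ i hi ω
      have r4 : 4 * l ^ 2 * γ ^ 2 * s i ω = 4 * (l * γ) * ((l * γ) * s i ω) := by ring
      have r5 : 4 * (l * γ) * ((l * γ) * s i ω) ≤ 50 * ((l * γ) * s i ω) := by
        have : 0 ≤ (l * γ) * s i ω := by positivity
        nlinarith
      calc |f ω| * |hh P F X l i ω| ^ 2 ≤ |f ω| * (50 * ((l * γ) * s i ω)) := by gcongr; linarith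
        _ = _ := by ring
    have e2 : ∫ ω, |f ω| * (350 * (l * γ) * s i ω) ∂(tilt P F n X l (1 / 2)) = 350 * (l * γ) * ∫ ω, |f ω| * s i ω ∂(tilt P F n X l (1 / 2)) := by
      rw [← integral_const_mul]; congr 1; ext ω; ring
    rw [integral_const_mul] at h2b
    rw [e2] at t
    linarith
  · intro i hi f hf C hC hf0
    have t := H.tle T hi hf hC hf0 (abm i hi) (i3 i hi) (u := fun ω => 70 * γ * s i ω)
      ((H.sm i hi).const_mul _) (C' := 70 * γ * γ ^ 2) (fun ω => by
        rw [abs_mul, abs_of_nonneg (by positivity : 0 ≤ 70 * γ)]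
        exact mul_le_mul_of_nonneg_left (sb' i hi ω) (by positivity)) (by
        filter_upwards [H.m_half T hi, H.ce_bound hi (m3 i hi) (f3_bound i)] with ω h1 h2
        have hs0 := H.s0 i hi ω
        have hb := H.bγ i hi ω
        have q5 : (99:ℝ) / 100 ≤ mm P F X l (1 / 2) i ω := by linarith [(abs_le.1 h1.2).1]
        have q6 : 99 / 100 * (70 * γ * s i ω) ≤ mm P F X l (1 / 2) i ω * (70 * γ * s i ω) := by gcongr
        have q7 : 0 ≤ γ * s i ω := by positivity
        rw [zero_mul, add_zero, sub_zero] at h2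
        have := (abs_le.1 h2).2
        linarith)
    have j3 := (H.tcond T hi hf hC (abm i hi) (i3 i hi)).1
    have js : Integrable (fun ω => f ω * s i ω) (tilt P F n X l (1 / 2)) := (H.tmeas T hi (hf.mul (H.sm i hi)) (C := C * γ ^ 2) (fun ω => by
      simp only [Pi.mul_apply]
      rw [abs_mul]; exact mul_le_mul (hC ω) (sb' i hi ω) (abs_nonneg _) ((abs_nonneg _).trans (hC ω)))).1
    have e2 : ∫ ω, f ω * (70 * γ * s i ω) ∂(tilt P F n X l (1 / 2)) = 70 * γ * ∫ ω, f ω * s i ω ∂(tilt P F n X l (1 / 2)) := by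
      rw [← integral_const_mul]; congr 1; ext ω; ring
    rw [e2] at t
    have : ∫ ω, f ω * |xi P F X l i ω| ^ 3 ∂(tilt P F n X l (1 / 2)) ≤
        ∫ ω, (4 * (f ω * |ff X l i ω| ^ 3) + 4 * γ * (f ω * s i ω)) ∂(tilt P F n X l (1 / 2)) := by
      refine integral_mono_of_nonneg (Eventually.of_forall fun ω => mul_nonneg (hf0 ω) (by positivity))
        ((j3.const_mul 4).add (js.const_mul (4 * γ))) ?_
      filter_upwards [tilt_ae _ (H.h_ae T hi)] with ω h
      have hs0 := H.s0 i hi ω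
      have r1 : |hh P F X l i ω| ^ 3 ≤ (2 * l * s i ω) ^ 3 := pow_le_pow_left₀ (abs_nonneg _) h.2.2 3
      have r2 : (2 * l * s i ω) ^ 3 = 8 * l * s i ω * (l ^ 2 * s i ω) * s i ω := by ring
      have r3 : 8 * l * s i ω * (l ^ 2 * s i ω) * s i ω ≤ 8 * l * γ ^ 2 * (1 / 1000000) * s i ω := by
        gcongr
        · exact H.sγ i hi ω
        · exact H.ls2 T hi ω
      have r4 : 8 * l * γ ^ 2 * (1 / 1000000) * s i ω = (8 / 1000000) * (l * γ) * (γ * s i ω) := by ring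
      have r5 : (8 / 1000000) * (l * γ) * (γ * s i ω) ≤ γ * s i ω := by
        have : 0 ≤ γ * s i ω := by positivity
        nlinarith
      have r6 : |xi P F X l i ω| ^ 3 ≤ 4 * |ff X l i ω| ^ 3 + 4 * |hh P F X l i ω| ^ 3 := by
        have a1 := abs_sub (ff X l i ω) (hh P F X l i ω)
        have a2 := abs_nonneg (hh P F X l i ω)
        have a3 := abs_nonneg (ff X l i ω)
        simp only [xi]
        calc _ ≤ (|ff X l i ω| + |hh P F X l i ω|) ^ 3 := by gcongr
          _ ≤ _ := by nlinarith [mul_nonneg (add_nonneg a3 a2) (sq_nonneg (|ff X l i ω| - |hh P F X l i ω|))]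
      calc f ω * |xi P F X l i ω| ^ 3 ≤ f ω * (4 * |ff X l i ω| ^ 3 + 4 * (γ * s i ω)) :=
            mul_le_mul_of_nonneg_left (by linarith) (hf0 ω)
        _ = _ := by ring
    rw [integral_add (j3.const_mul 4) (js.const_mul (4 * γ)), integral_const_mul, integral_const_mul] at this
    have : 0 ≤ γ * ∫ ω, f ω * s i ω ∂(tilt P F n X l (1 / 2)) :=
      mul_nonneg hγ0.le (integral_nonneg fun ω => mul_nonneg (hf0 ω) (H.s0 i hi ω))
    linarith
  · exact tilt_ae _ H.HV

end NM
end Cram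


namespace Cram
open ProbabilityTheory Set

/-- quadratic variation -/
noncomputable def QQ {Ω : Type} (X : ℕ → Ω → ℝ) (n : ℕ) (ω : Ω) : ℝ := ∑ i ∈ Finset.range n, X i ω ^ 2

lemma QQ_nonneg {Ω : Type} (X : ℕ → Ω → ℝ) (n : ℕ) (ω : Ω) : 0 ≤ QQ X n ω :=
  Finset.sum_nonneg fun _ _ => sq_nonneg _

/-- the Berry-Esseen scale -/
noncomputable def DD (γ δ l : ℝ) : ℝ := 10000000000 * (γ * |Real.log γ| + l * γ + δ)

/-- the drift error -/
noncomputable def hs (ε δ l : ℝ) : ℝ := 1000 * l ^ 2 * ε + l * δ ^ 2 / 2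

namespace NM
variable {Ω : Type} [mΩ : MeasurableSpace Ω] {P : Measure Ω} [IsProbabilityMeasure P]
  {F : ℕ → MeasurableSpace Ω} {n : ℕ} {X s b : ℕ → Ω → ℝ} {γ ε δ l θ : ℝ}

lemma SS_meas (H : NM P F n X s b γ ε δ) : Measurable (psum X n) :=
  psum_meas' _ X n fun _ hj => H.Xm' hj

lemma QQ_meas (H : NM P F n X s b γ ε δ) : Measurable (QQ X n) :=
  Finset.measurable_fun_sum _ fun _ hj => (H.Xm' (Finset.mem_range.1 hj)).pow_const 2

lemma log_ge (H : NM P F n X s b γ ε δ) : 1 ≤ |Real.log γ| := by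
  have h1 : Real.log γ ≤ Real.log (1 / 4) := Real.log_le_log H.γ0 H.γ1
  have h2 : Real.log (1 / 4) = - (2 * Real.log 2) := by
    rw [show (1:ℝ) / 4 = (2 ^ 2)⁻¹ by norm_num, Real.log_inv, Real.log_pow]; norm_num
  have h3 := Real.log_two_gt_d9
  rw [abs_of_neg (by linarith)]; linarith

lemma Dbd (H : NM P F n X s b γ ε δ) (T : TP l (1 / 2) γ) (t : ℝ) :
    |(tilt P F n X l (1 / 2)).real {ω | psum (xi P F X l) n ω ≤ t} - stdNormalCDF t| ≤ DD γ δ l := by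
  have := H.tilt_prob T
  have h := (H.toBE T).main H.δ0 (by linarith [H.δ1]) t
  refine h.trans ?_
  have hg := H.γ0
  have l1 := H.log_ge
  have e : Real.log (300 * γ) = Real.log 300 + Real.log γ := Real.log_mul (by norm_num) hg.ne'
  have h300 : Real.log 300 ≤ 6 := by
    rw [Real.log_le_iff_le_exp (by norm_num)]
    have := Real.exp_one_gt_d9
    calc (300:ℝ) ≤ 2.7 ^ 6 := by norm_num
      _ ≤ Real.exp 1 ^ 6 := by gcongr; linarith
      _ = Real.exp 6 := by rw [← Real.exp_nat_mul]; norm_num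
  have h300' : 0 ≤ Real.log 300 := Real.log_nonneg (by norm_num)
  have l2 : 1 + |Real.log (300 * γ)| ≤ 8 * |Real.log γ| := by
    rw [e]
    have := abs_add_le (Real.log 300) (Real.log γ)
    rw [abs_of_nonneg h300'] at this
    linarith
  have l3 : 300 * γ * (1 + |Real.log (300 * γ)|) ≤ 300 * γ * (8 * |Real.log γ|) := by gcongr
  have a1 : 0 ≤ γ * |Real.log γ| := by positivity
  have a2 : 0 ≤ l * γ := mul_nonneg T.l0 hg.le
  have a3 := H.δ0
  unfold DD
  linarith

lemma MM_meas (H : NM P F n X s b γ ε δ) (l : ℝ) : Measurable (psum (xi P F X l) n) :=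
  psum_meas' _ _ n fun j hj => ((H.ff_meas l hj).mono (H.Fle _) le_rfl).sub ((hh_meas l j).mono (H.Fle _) le_rfl)

lemma Z_ae (H : NM P F n X s b γ ε δ) (T : TP l (1 / 2) γ) :
    ∀ᵐ ω ∂P, |psum X n ω - l * QQ X n ω / 2 - l / 2 - psum (xi P F X l) n ω| ≤ hs ε δ l := by
  have h1 : ∀ᵐ ω ∂P, ∀ i ∈ Finset.range n, |hh P F X l i ω - l / 2 * s i ω| ≤ 1000 * l ^ 2 * b i ω := by
    rw [Finset.eventually_all]
    intro i hi
    filter_upwards [H.h_ae T (Finset.mem_range.1 hi)] with ω h using h.2.1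
  filter_upwards [h1, H.HV, H.HB] with ω h1 h2 h3
  have e : psum X n ω - l * QQ X n ω / 2 - l / 2 - psum (xi P F X l) n ω =
      ∑ i ∈ Finset.range n, (hh P F X l i ω - l / 2 * s i ω) + l / 2 * (∑ i ∈ Finset.range n, s i ω - 1) := by
    simp only [psum, QQ, xi, ff, ft, Finset.sum_sub_distrib, mul_sub, Finset.mul_sum, Finset.sum_div]
    ring
  rw [e]
  refine (abs_add_le _ _).trans ?_
  have hl := T.l0
  unfold hs
  rw [abs_mul, abs_of_nonneg (by positivity : 0 ≤ l / 2)]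
  have t1 : |∑ i ∈ Finset.range n, (hh P F X l i ω - l / 2 * s i ω)| ≤ 1000 * l ^ 2 * ε := by
    refine (Finset.abs_sum_le_sum_abs _ _).trans ((Finset.sum_le_sum h1).trans ?_)
    rw [← Finset.mul_sum]
    gcongr
  have t2 : l / 2 * |∑ i ∈ Finset.range n, s i ω - 1| ≤ l / 2 * δ ^ 2 := by gcongr
  linarith

lemma prod_up (H : NM P F n X s b γ ε δ) (T : TP l θ γ) :
    ∀ᵐ ω ∂P, ∏ i ∈ Finset.range n, mm P F X l θ i ω ≤
      Real.exp ((1 / 2 - θ) * l ^ 2 + |1 / 2 - θ| * l ^ 2 * δ ^ 2 + 300 * l ^ 3 * ε) := by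
  have h1 : ∀ᵐ ω ∂P, ∀ i ∈ Finset.range n, mm P F X l θ i ω ≤
      Real.exp ((1 / 2 - θ) * l ^ 2 * s i ω + 300 * l ^ 3 * b i ω) := by
    rw [Finset.eventually_all]
    intro i hi
    filter_upwards [H.mm_ae T (Finset.mem_range.1 hi)] with ω h
    have := (abs_le.1 h.2.1).2
    refine le_trans ?_ (Real.add_one_le_exp _)
    linarith
  filter_upwards [h1, H.HV, H.HB] with ω h1 h2 h3
  refine (Finset.prod_le_prod (fun i _ => (mm_pos i ω).le) h1).trans ?_
  rw [← Real.exp_sum, Real.exp_le_exp, Finset.sum_add_distrib, ← Finset.mul_sum, ← Finset.mul_sum]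
  have hl := T.l0
  have t1 : 300 * l ^ 3 * ∑ i ∈ Finset.range n, b i ω ≤ 300 * l ^ 3 * ε := by gcongr
  have t2 : (1 / 2 - θ) * l ^ 2 * ∑ i ∈ Finset.range n, s i ω = (1 / 2 - θ) * l ^ 2 +
    (1 / 2 - θ) * l ^ 2 * (∑ i ∈ Finset.range n, s i ω - 1) := by ring
  have t3 : (1 / 2 - θ) * l ^ 2 * (∑ i ∈ Finset.range n, s i ω - 1) ≤ |1 / 2 - θ| * l ^ 2 * δ ^ 2 := by
    refine (le_abs_self _).trans ?_
    rw [abs_mul, abs_mul, abs_of_nonneg (by positivity : 0 ≤ l ^ 2)]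
    gcongr
  linarith

lemma prod_low (H : NM P F n X s b γ ε δ) (T : TP l (1 / 2) γ) :
    ∀ᵐ ω ∂P, Real.exp (-(600 * l ^ 3 * ε)) ≤ ∏ i ∈ Finset.range n, mm P F X l (1 / 2) i ω := by
  have h1 : ∀ᵐ ω ∂P, ∀ i ∈ Finset.range n, Real.exp (-(600 * l ^ 3 * b i ω)) ≤ mm P F X l (1 / 2) i ω := by
    rw [Finset.eventually_all]
    intro i hi
    filter_upwards [H.m_half T (Finset.mem_range.1 hi)] with ω h
    have h1 := (abs_le.1 h.1).1
    have h2 := H.lb3 T (Finset.mem_range.1 hi) ω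
    have h3 : 0 ≤ l ^ 3 * b i ω := mul_nonneg (pow_nonneg T.l0 3) (H.b0 i (Finset.mem_range.1 hi) ω)
    have h4 : Real.exp (-(600 * l ^ 3 * b i ω)) ≤ 1 / (1 + 600 * l ^ 3 * b i ω) := by
      rw [Real.exp_neg, ← one_div]
      apply one_div_le_one_div_of_le (by linarith)
      linarith [Real.add_one_le_exp (600 * l ^ 3 * b i ω)]
    refine h4.trans ?_
    rw [div_le_iff₀ (by linarith)]
    nlinarith
  filter_upwards [h1, H.HB] with ω h1 h3
  refine le_trans ?_ (Finset.prod_le_prod (fun i _ => (Real.exp_pos _).le) h1)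
  rw [← Real.exp_sum, Real.exp_le_exp, Finset.sum_neg_distrib, ← Finset.mul_sum]
  have hl := T.l0
  have t1 : 600 * l ^ 3 * ∑ i ∈ Finset.range n, b i ω ≤ 600 * l ^ 3 * ε := by gcongr
  linarith

lemma GG_inv (ω : Ω) : (GG P F X l θ n ω)⁻¹ =
    (∏ i ∈ Finset.range n, mm P F X l θ i ω) * Real.exp (-(l * psum X n ω - θ * l ^ 2 * QQ X n ω)) := by
  unfold GG
  rw [Finset.prod_div_distrib, inv_div, div_eq_mul_inv]
  congr 1
  have : ∏ i ∈ Finset.range n, ee X l θ i ω = Real.exp (l * psum X n ω - θ * l ^ 2 * QQ X n ω) := by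
    simp only [ee, tl]
    rw [← Real.exp_sum]
    congr 1
    simp only [psum, QQ, Finset.mul_sum]
    rw [← Finset.sum_sub_distrib]
    refine Finset.sum_congr rfl fun i _ => by ring
  rw [this, ← Real.exp_neg]

lemma com (H : NM P F n X s b γ ε δ) {E : Set Ω} (hE : MeasurableSet E) :
    Integrable (E.indicator fun ω => (GG P F X l θ n ω)⁻¹) (tilt P F n X l θ) ∧
    P.real E = ∫ ω, E.indicator (fun ω => (GG P F X l θ n ω)⁻¹) ω ∂(tilt P F n X l θ) := by
  have e : ∀ ω, E.indicator (fun ω => (GG P F X l θ n ω)⁻¹) ω * GG P F X l θ n ω = E.indicator (fun _ => (1:ℝ)) ω := fun ω => by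
    by_cases h : ω ∈ E
    · simp only [indicator_of_mem h]; exact inv_mul_cancel₀ (GG_pos n ω).ne'
    · simp only [indicator_of_notMem h, zero_mul]
  constructor
  · rw [H.tilt_integrable]
    simp only [e]
    exact (integrable_const (1:ℝ)).indicator hE
  · rw [H.tilt_int]
    simp only [e]
    rw [integral_indicator hE]; simp [Measure.real]

lemma com_up (H : NM P F n X s b γ ε δ) {E : Set Ω} (hE : MeasurableSet E) {A : ℝ}
    (hA : ∀ᵐ ω ∂P, ∏ i ∈ Finset.range n, mm P F X l θ i ω ≤ Real.exp A) {g : Ω → ℝ}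
    (hg : Integrable (E.indicator g) (tilt P F n X l θ))
    (hle : ∀ᵐ ω ∂P, ω ∈ E → Real.exp (-(l * psum X n ω - θ * l ^ 2 * QQ X n ω)) ≤ g ω) :
    P.real E ≤ Real.exp A * ∫ ω, E.indicator g ω ∂(tilt P F n X l θ) := by
  rw [(H.com (l := l) (θ := θ) hE).2, ← integral_const_mul]
  refine integral_mono_ae (H.com hE).1 (hg.const_mul _) ?_
  filter_upwards [tilt_ae _ hA, tilt_ae _ hle] with ω h1 h2
  by_cases h : ω ∈ E
  · simp only [indicator_of_mem h]
    rw [GG_inv]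
    exact mul_le_mul h1 (h2 h) (Real.exp_pos _).le (Real.exp_pos _).le
  · simp only [indicator_of_notMem h, mul_zero, le_refl]

lemma com_low (H : NM P F n X s b γ ε δ) (T : TP l (1 / 2) γ) {E : Set Ω} (hE : MeasurableSet E) {g : Ω → ℝ}
    (hg : Integrable (E.indicator g) (tilt P F n X l (1 / 2)))
    (hle : ∀ᵐ ω ∂P, ω ∈ E → g ω ≤ Real.exp (-(l * psum X n ω - 1 / 2 * l ^ 2 * QQ X n ω))) :
    Real.exp (-(600 * l ^ 3 * ε)) * ∫ ω, E.indicator g ω ∂(tilt P F n X l (1 / 2)) ≤ P.real E := by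
  rw [(H.com (l := l) (θ := 1 / 2) hE).2, ← integral_const_mul]
  refine integral_mono_ae (hg.const_mul _) (H.com hE).1 ?_
  filter_upwards [tilt_ae _ (H.prod_low T), tilt_ae _ hle] with ω h1 h2
  by_cases h : ω ∈ E
  · simp only [indicator_of_mem h]
    rw [GG_inv]
    calc _ ≤ Real.exp (-(600 * l ^ 3 * ε)) * Real.exp (-(l * psum X n ω - 1 / 2 * l ^ 2 * QQ X n ω)) :=
          mul_le_mul_of_nonneg_left (h2 h) (Real.exp_pos _).le
      _ ≤ _ := mul_le_mul_of_nonneg_right h1 (Real.exp_pos _).le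
  · simp only [indicator_of_notMem h, mul_zero, le_refl]

end NM
end Cram


namespace Cram
open ProbabilityTheory Set

/-- smooth absolute value -/
noncomputable def psi (a : ℝ) : ℝ := Real.sqrt (1 + a ^ 2) - 1
/-- its derivative -/
noncomputable def psid (a : ℝ) : ℝ := a / Real.sqrt (1 + a ^ 2)

lemma psi_step (a c : ℝ) : psi (a + c) ≤ psi a + psid a * c + 2 * (|c| * Real.sqrt |c|) := by
  unfold psi psid
  set r := Real.sqrt (1 + a ^ 2) with hr
  have r1 : 1 ≤ r := by rw [hr]; apply Real.one_le_sqrt.2; nlinarith [sq_nonneg a]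
  have r2 : r ^ 2 = 1 + a ^ 2 := Real.sq_sqrt (by positivity)
  have r0 : 0 < r := by linarith
  have ar : |a| ≤ r := by rw [hr]; exact Real.abs_le_sqrt (by linarith)
  have hk : |c| * Real.sqrt |c| ≥ 0 := by positivity
  obtain ⟨ar1, ar2⟩ := abs_le.1 ar
  rcases le_total |c| 1 with h | h
  · have : Real.sqrt (1 + (a + c) ^ 2) ≤ r + (2 * a * c + c ^ 2) / (2 * r) := by
      have e : r + (2 * a * c + c ^ 2) / (2 * r) = (2 * r ^ 2 + 2 * a * c + c ^ 2) / (2 * r) := by field_simp; ring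
      have e0 : 0 ≤ (2 * r ^ 2 + 2 * a * c + c ^ 2) := by nlinarith [sq_nonneg (a + c), sq_nonneg a]
      have e1 : 0 ≤ r + (2 * a * c + c ^ 2) / (2 * r) := by rw [e]; positivity
      apply Real.sqrt_le_iff.2 ⟨e1, ?_⟩
      have e2 : (r + (2 * a * c + c ^ 2) / (2 * r)) ^ 2 = r ^ 2 + (2 * a * c + c ^ 2) + ((2 * a * c + c ^ 2) / (2 * r)) ^ 2 := by
        field_simp; ring
      rw [e2, r2]; nlinarith [sq_nonneg ((2 * a * c + c ^ 2) / (2 * r))]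
    have e3 : (2 * a * c + c ^ 2) / (2 * r) = a / r * c + c ^ 2 / (2 * r) := by field_simp
    have e4 : c ^ 2 / (2 * r) ≤ c ^ 2 := by
      rw [div_le_iff₀ (by linarith)]; nlinarith [sq_nonneg c]
    have e5 : c ^ 2 ≤ |c| * Real.sqrt |c| := by
      rw [← sq_abs, sq]
      apply mul_le_mul_of_nonneg_left _ (abs_nonneg _)
      apply Real.le_sqrt_of_sq_le
      nlinarith [abs_nonneg c]
    linarith
  · have : Real.sqrt (1 + (a + c) ^ 2) ≤ r + |c| := by
      apply Real.sqrt_le_iff.2 ⟨by positivity, ?_⟩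
      have h1 : a * c ≤ r * |c| := by
        calc a * c ≤ |a * c| := le_abs_self _
          _ = |a| * |c| := abs_mul _ _
          _ ≤ _ := by gcongr
      nlinarith [sq_abs c]
    have e6 : -|c| ≤ a / r * c := by
      have : |a / r * c| ≤ |c| := by
        rw [abs_mul, abs_div, abs_of_pos r0]
        have : |a| / r ≤ 1 := (div_le_one r0).2 ar
        nlinarith [abs_nonneg c]
      exact (abs_le.1 this).1
    have e7 : |c| ≤ |c| * Real.sqrt |c| := by
      have : 1 ≤ Real.sqrt |c| := Real.one_le_sqrt.2 h
      nlinarith [abs_nonneg c]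
    linarith

lemma psi_nonneg (a : ℝ) : 0 ≤ psi a := by
  unfold psi
  have : 1 ≤ Real.sqrt (1 + a ^ 2) := Real.one_le_sqrt.2 (by nlinarith [sq_nonneg a])
  linarith

lemma psi_le (a : ℝ) : psi a ≤ |a| := by
  unfold psi
  have : Real.sqrt (1 + a ^ 2) ≤ 1 + |a| := by
    apply Real.sqrt_le_iff.2 ⟨by positivity, ?_⟩
    nlinarith [sq_abs a, abs_nonneg a]
  linarith

lemma psi_ge (a : ℝ) (h : 1 ≤ |a|) : 2 / 5 ≤ psi a := by
  unfold psi
  have : 7 / 5 ≤ Real.sqrt (1 + a ^ 2) := by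
    apply Real.le_sqrt_of_sq_le
    nlinarith [sq_abs a]
  linarith

lemma psid_le (a : ℝ) : |psid a| ≤ 1 := by
  unfold psid
  have r0 : 0 < Real.sqrt (1 + a ^ 2) := by positivity
  rw [abs_div, abs_of_pos r0, div_le_one r0]
  exact Real.abs_le_sqrt (by linarith)

lemma psi_cont : Continuous psi := by unfold psi; fun_prop
lemma psid_cont : Continuous psid := by
  unfold psid
  refine continuous_id.div (by fun_prop) fun a => ?_
  positivity

lemma pow32 (t y : ℝ) (ht : 0 < t) : |y / t| * Real.sqrt |y / t| = (t * Real.sqrt t)⁻¹ * (|y| * Real.sqrt |y|) := by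
  rw [abs_div, abs_of_pos ht, Real.sqrt_div' _ ht.le]
  have := Real.sqrt_pos.2 ht
  field_simp

lemma y32 (x u : ℝ) (hu : 0 ≤ u) : |x ^ 2 - u| * Real.sqrt |x ^ 2 - u| ≤ |x| ^ 3 + u * Real.sqrt u := by
  rcases le_total (x ^ 2) u with h | h
  · have h1 : |x ^ 2 - u| ≤ u := by rw [abs_le]; constructor <;> nlinarith [sq_nonneg x]
    have : |x ^ 2 - u| * Real.sqrt |x ^ 2 - u| ≤ u * Real.sqrt u :=
      mul_le_mul h1 (Real.sqrt_le_sqrt h1) (Real.sqrt_nonneg _) hu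
    have : 0 ≤ |x| ^ 3 := by positivity
    linarith
  · have h1 : |x ^ 2 - u| ≤ x ^ 2 := by rw [abs_le]; constructor <;> nlinarith [sq_nonneg x]
    have : |x ^ 2 - u| * Real.sqrt |x ^ 2 - u| ≤ x ^ 2 * Real.sqrt (x ^ 2) :=
      mul_le_mul h1 (Real.sqrt_le_sqrt h1) (Real.sqrt_nonneg _) (sq_nonneg _)
    rw [Real.sqrt_sq_eq_abs] at this
    have e : |x| ^ 3 = x ^ 2 * |x| := by rw [← sq_abs]; ring
    have : 0 ≤ u * Real.sqrt u := by positivity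
    linarith

section
variable {Ω : Type} [mΩ : MeasurableSpace Ω] (P : Measure Ω)
  (F : ℕ → MeasurableSpace Ω) (X : ℕ → Ω → ℝ) (l θ : ℝ)

/-- tilted conditional second moment -/
noncomputable def uu (i : ℕ) (ω : Ω) : ℝ :=
  max 0 (min 1 ((P[fun ω => X i ω ^ 2 * ee X l θ i ω|F i]) ω / mm P F X l θ i ω))

/-- centered squares -/
noncomputable def yy (i : ℕ) (ω : Ω) : ℝ := X i ω ^ 2 - uu P F X l θ i ω
end

namespace NM
variable {Ω : Type} [mΩ : MeasurableSpace Ω] {P : Measure Ω} [IsProbabilityMeasure P]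
  {F : ℕ → MeasurableSpace Ω} {n : ℕ} {X s b : ℕ → Ω → ℝ} {γ ε δ l θ : ℝ}

lemma uu_meas (l θ : ℝ) (i : ℕ) : Measurable[F i] (uu P F X l θ i) := by
  unfold uu
  exact measurable_const.max (measurable_const.min ((stronglyMeasurable_condExp.measurable).div (mm_meas l _ i)))

lemma uu_nonneg (i : ℕ) (ω : Ω) : 0 ≤ uu P F X l θ i ω := le_max_left _ _

lemma uu_bdd (i : ℕ) (ω : Ω) : |uu P F X l θ i ω| ≤ 1 := by
  rw [abs_of_nonneg (uu_nonneg i ω)]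
  exact max_le (by norm_num) (min_le_left _ _)

lemma q_bound (T : TP l θ γ) (i : ℕ) (ω : Ω) :
    |X i ω ^ 2 * ee X l θ i ω - (0 + 0 * X i ω + 1 * X i ω ^ 2)| ≤ 310 * l * |X i ω| ^ 3 := by
  rw [show X i ω ^ 2 * ee X l θ i ω - (0 + 0 * X i ω + 1 * X i ω ^ 2) = X i ω ^ 2 * (ee X l θ i ω - 1) by ring,
    abs_mul, abs_of_nonneg (sq_nonneg _), ← sq_abs]
  have h := tl_one T.θ1 T.θ2 (l * X i ω)
  rw [abs_mul, abs_of_nonneg T.l0] at h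
  calc |X i ω| ^ 2 * |ee X l θ i ω - 1| ≤ |X i ω| ^ 2 * (310 * (l * |X i ω|)) := by gcongr; exact h
    _ = _ := by ring

lemma c_bound (T : TP l θ γ) (i : ℕ) (ω : Ω) :
    |(|X i ω| ^ 3 * ee X l θ i ω) - (0 + 0 * X i ω + 0 * X i ω ^ 2)| ≤ 3 * |X i ω| ^ 3 := by
  rw [zero_mul, zero_mul, add_zero, add_zero, sub_zero, abs_of_nonneg (mul_nonneg (by positivity) (ee_pos X l _ i ω).le)]
  have := ee_le X T i ω
  have h : 0 ≤ |X i ω| ^ 3 := by positivity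
  nlinarith

lemma u_ae (H : NM P F n X s b γ ε δ) (T : TP l θ γ) {i : ℕ} (hi : i < n) :
    ∀ᵐ ω ∂P, (P[fun ω => X i ω ^ 2 * ee X l θ i ω|F i]) ω = mm P F X l θ i ω * uu P F X l θ i ω ∧
      |uu P F X l θ i ω - s i ω| ≤ 320 * l * b i ω ∧ uu P F X l θ i ω ≤ 2 * s i ω := by
  have hm : Measurable (fun ω => X i ω ^ 2 * ee X l θ i ω) :=
    ((H.Xm' hi).pow_const 2).mul (H.ee_meas' l _ hi)
  filter_upwards [H.mm_ae T hi, H.ce_bound hi hm (q_bound T i)] with ω h1 h2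
  set p := (P[fun ω => X i ω ^ 2 * ee X l θ i ω|F i]) ω
  set m := mm P F X l θ i ω with hmdef
  have m0 : 0 < m := mm_pos i ω
  obtain ⟨-, h1, h1'⟩ := h1
  rw [zero_add, one_mul] at h2
  have hs0 := H.s0 i hi ω
  have hb0 := H.b0 i hi ω
  have hl0 := T.l0
  have hlb := H.lb T hi ω
  have hls := H.ls2 T hi ω
  have hm2 : (99:ℝ) / 100 ≤ m := by linarith [(abs_le.1 h1').1]
  have q0 : |m - 1| ≤ l ^ 2 * s i ω + 300 * l ^ 3 * b i ω := by
    have := abs_add_le (m - 1 - (1 / 2 - θ) * l ^ 2 * s i ω) ((1 / 2 - θ) * l ^ 2 * s i ω)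
    rw [sub_add_cancel] at this
    have h3 : |(1 / 2 - θ) * l ^ 2 * s i ω| ≤ l ^ 2 * s i ω := by
      rw [mul_assoc, abs_mul, abs_of_nonneg (by positivity : 0 ≤ l ^ 2 * s i ω)]
      have : |1 / 2 - θ| ≤ 1 := by rw [abs_le]; constructor <;> linarith [T.θ1, T.θ2]
      exact mul_le_of_le_one_left (by positivity) this
    linarith
  have a1 : |p / m - s i ω| ≤ 320 * l * b i ω := by
    have e : p / m - s i ω = (p - s i ω - (m - 1) * s i ω) / m := by field_simp; ring
    rw [e, abs_div, abs_of_pos m0, div_le_iff₀ m0]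
    have t1 := abs_sub (p - s i ω) ((m - 1) * s i ω)
    rw [abs_mul, abs_of_nonneg hs0] at t1
    have t2 : |m - 1| * s i ω ≤ (l ^ 2 * s i ω + 300 * l ^ 3 * b i ω) * s i ω := by gcongr
    have r1 : l * Real.sqrt (s i ω) ≤ 1 / 1000 := by
      apply abs_le_of_sq_le_sq' _ (by norm_num) |>.2
      rw [mul_pow, Real.sq_sqrt hs0]; linarith
    have r2 : l ^ 2 * s i ω * s i ω ≤ l * b i ω * (1 / 1000) := by
      have e1 : s i ω = Real.sqrt (s i ω) * Real.sqrt (s i ω) := (Real.mul_self_sqrt hs0).symm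
      have e2 : l ^ 2 * s i ω * s i ω = l * (s i ω * Real.sqrt (s i ω)) * (l * Real.sqrt (s i ω)) := by
        rw [show l * (s i ω * Real.sqrt (s i ω)) * (l * Real.sqrt (s i ω)) = l ^ 2 * s i ω * (Real.sqrt (s i ω) * Real.sqrt (s i ω)) by ring, ← e1]
      rw [e2]
      apply mul_le_mul _ r1 (by positivity) (by positivity)
      exact mul_le_mul_of_nonneg_left (H.sb i hi ω) hl0
    have r3 : 300 * l ^ 3 * b i ω * s i ω = 300 * (l * b i ω) * (l ^ 2 * s i ω) := by ring
    have r4 : 300 * (l * b i ω) * (l ^ 2 * s i ω) ≤ 300 * (l * b i ω) * (1 / 1000000) := by gcongr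
    have r5 : 0 ≤ l * b i ω := by positivity
    have t6 : 320 * l * b i ω * (99 / 100) ≤ 320 * l * b i ω * m := by gcongr
    linarith
  obtain ⟨c1, c2⟩ := abs_le.1 a1
  have hs1 : s i ω ≤ 1 / 16 := by nlinarith [H.sγ i hi ω, H.γ0, H.γ1]
  have e : uu P F X l θ i ω = p / m := by
    unfold uu
    rw [min_eq_right (by linarith), max_eq_right (by linarith)]
  rw [e]
  exact ⟨by field_simp, a1, by linarith⟩

lemma yint (H : NM P F n X s b γ ε δ) (T : TP l θ γ) {i : ℕ} (hi : i < n) :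
    Integrable (fun ω => X i ω ^ 2 * ee X l θ i ω) P ∧ Integrable (fun ω => |X i ω| ^ 3 * ee X l θ i ω) P :=
  ⟨H.dom_int hi (((H.Xm' hi).pow_const 2).mul (H.ee_meas' l _ hi)) (q_bound T i),
   H.dom_int hi ((((H.Xm' hi).abs).pow_const 3).mul (H.ee_meas' l _ hi)) (c_bound T i)⟩

lemma yy_meas (H : NM P F n X s b γ ε δ) {i : ℕ} (hi : i < n) : Measurable[F (i + 1)] (yy P F X l θ i) :=
  ((H.Xm i hi).pow_const 2).sub ((uu_meas l θ i).mono (H.Fm (by omega)) le_rfl)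

lemma ystep (H : NM P F n X s b γ ε δ) (T : TP l θ γ) {t : ℝ} (ht : 0 < t) :
    ∀ k ≤ n, Integrable (fun ω => psi (psum (yy P F X l θ) k ω / t)) (tilt P F n X l θ) ∧
      ∫ ω, psi (psum (yy P F X l θ) k ω / t) ∂(tilt P F n X l θ) ≤
      14 * (t * Real.sqrt t)⁻¹ * ∫ ω, ∑ i ∈ Finset.range k, b i ω ∂(tilt P F n X l θ) := by
  have prob := H.tilt_prob T
  have bb : ∀ i < n, ∀ ω, |b i ω| ≤ 1 := fun i hi ω => by
    rw [abs_of_nonneg (H.b0 i hi ω)]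
    have h1 := H.bγ i hi ω
    have h2 := H.sγ i hi ω
    have h3 := H.γ0
    have h4 := H.γ1
    nlinarith [mul_nonneg h3.le (H.s0 i hi ω)]
  have bi : ∀ i < n, Integrable (b i) (tilt P F n X l θ) := fun i hi =>
    int_bdd' ((H.bm i hi).mono (H.Fle _) le_rfl) 1 (bb i hi)
  have sint : ∀ i < n, Integrable (fun ω => X i ω ^ 2) (tilt P F n X l θ) := fun i hi => by
    have := (H.tcond T hi (f := fun _ => 1) measurable_const (C := 1) (fun ω => by simp)
      ((H.Xm i hi).pow_const 2) (H.yint T hi).1).1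
    simpa using this
  have cint : ∀ i < n, Integrable (fun ω => |X i ω| ^ 3) (tilt P F n X l θ) := fun i hi => by
    have := (H.tcond T hi (f := fun _ => 1) measurable_const (C := 1) (fun ω => by simp)
      ((continuous_abs.measurable.comp (H.Xm i hi)).pow_const 3) (H.yint T hi).2).1
    simpa using this
  have uint : ∀ i < n, Integrable (uu P F X l θ i) (tilt P F n X l θ) := fun i hi =>
    int_bdd' ((uu_meas l θ i).mono (H.Fle _) le_rfl) 1 (uu_bdd i)
  have yi : ∀ i < n, Integrable (yy P F X l θ i) (tilt P F n X l θ) := fun i hi => (sint i hi).sub (uint i hi)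
  have pint : ∀ k ≤ n, Integrable (fun ω => psi (psum (yy P F X l θ) k ω / t)) (tilt P F n X l θ) := by
    intro k hk
    have h1 : Integrable (psum (yy P F X l θ) k) (tilt P F n X l θ) :=
      integrable_finsetSum _ fun i hi => yi i (by have := Finset.mem_range.1 hi; omega)
    refine (h1.div_const t).abs.mono' ?_ (Eventually.of_forall fun ω => ?_)
    · exact (psi_cont.measurable.comp ((psum_meas' _ _ k fun j hj => (H.yy_meas (by omega)).mono (H.Fle _) le_rfl).div_const t)).aestronglyMeasurable
    · rw [Real.norm_eq_abs, abs_of_nonneg (psi_nonneg _)]; exact psi_le _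
  intro k
  induction k with
  | zero =>
    intro _
    refine ⟨pint 0 (by omega), ?_⟩
    simp [psum, psi]
  | succ k ih =>
    intro hk
    obtain ⟨j1, j2⟩ := ih (by omega)
    have hk' : k < n := by omega
    refine ⟨pint _ hk, ?_⟩
    have mT : Measurable[F k] (psum (yy P F X l θ) k) :=
      psum_meas' _ _ k fun j hj => (H.yy_meas (by omega)).mono (H.Fm (by omega)) le_rfl
    have md : Measurable[F k] fun ω => psid (psum (yy P F X l θ) k ω / t) :=
      psid_cont.measurable.comp (mT.div_const t)
    have bd : ∀ ω, |psid (psum (yy P F X l θ) k ω / t)| ≤ 1 := fun ω => psid_le _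
    have iy : Integrable (fun ω => psid (psum (yy P F X l θ) k ω / t) * yy P F X l θ k ω) (tilt P F n X l θ) :=
      int_bdd (md.mono (H.Fle _) le_rfl) 1 bd (yi k hk')
    have z : ∫ ω, psid (psum (yy P F X l θ) k ω / t) * yy P F X l θ k ω ∂(tilt P F n X l θ) = 0 := by
      have := H.tabs T hk' md bd ((H.Xm k hk').pow_const 2) (H.yint T hk').1 (uu_meas l θ k) (uu_bdd (P := P) (F := F) (X := X) (l := l) (θ := θ) k)
        (w := fun _ => 0) measurable_const (C'' := 0) (fun ω => by simp) (by
          filter_upwards [H.u_ae T hk'] with ω h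
          rw [h.1]; simp)
      simp only [mul_zero, integral_zero] at this
      have := abs_nonpos_iff.1 this
      simp only [yy, mul_sub] at iy ⊢
      rw [integral_sub]
      · exact this
      · exact int_bdd (md.mono (H.Fle _) le_rfl) 1 bd (sint k hk')
      · exact int_bdd (md.mono (H.Fle _) le_rfl) 1 bd (uint k hk')
    have c3 : ∫ ω, |X k ω| ^ 3 ∂(tilt P F n X l θ) ≤ ∫ ω, 4 * b k ω ∂(tilt P F n X l θ) := by
      have := H.tle T hk' (f := fun _ => 1) measurable_const (C := 1) (fun ω => by simp) (fun ω => by simp)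
        (g := fun ω => |X k ω| ^ 3) ((continuous_abs.measurable.comp (H.Xm k hk')).pow_const 3) (H.yint T hk').2
        (u := fun ω => 4 * b k ω) ((H.bm k hk').const_mul 4) (C' := 4) (fun ω => by
          rw [abs_mul, abs_of_pos (by norm_num : (0:ℝ) < 4)]; linarith [bb k hk' ω]) (by
          have hm : Measurable (fun ω => |X k ω| ^ 3 * ee X l θ k ω) :=
            ((H.Xm' hk').abs.pow_const 3).mul (H.ee_meas' l _ hk')
          filter_upwards [H.mm_ae T hk', H.ce_bound hk' hm (c_bound T k)] with ω h1 h2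
          have q5 : (99:ℝ) / 100 ≤ mm P F X l θ k ω := by linarith [(abs_le.1 h1.2.2).1]
          have hb0 := H.b0 k hk' ω
          rw [zero_mul, add_zero, sub_zero] at h2
          have := (abs_le.1 h2).2
          nlinarith)
      simpa only [one_mul] using this
    have step : ∫ ω, psi (psum (yy P F X l θ) (k + 1) ω / t) ∂(tilt P F n X l θ) ≤
        ∫ ω, ((psi (psum (yy P F X l θ) k ω / t) + t⁻¹ * (psid (psum (yy P F X l θ) k ω / t) * yy P F X l θ k ω)) +
          2 * (t * Real.sqrt t)⁻¹ * (|X k ω| ^ 3 + 3 * b k ω)) ∂(tilt P F n X l θ) := by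
      refine integral_mono_ae (pint _ hk) (addI (addI j1 (iy.const_mul _)) ((addI (cint k hk') ((bi k hk').const_mul 3)).const_mul _)) ?_
      filter_upwards [tilt_ae _ (H.u_ae T hk')] with ω h
      have e : psum (yy P F X l θ) (k + 1) ω / t = psum (yy P F X l θ) k ω / t + yy P F X l θ k ω / t := by
        rw [psum, Finset.sum_range_succ, add_div]; rfl
      have p1 := psi_step (psum (yy P F X l θ) k ω / t) (yy P F X l θ k ω / t)
      rw [pow32 t _ ht] at p1
      rw [e]
      refine p1.trans ?_
      have p2 := y32 (X k ω) (uu P F X l θ k ω) (uu_nonneg k ω)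
      have hs0 := H.s0 k hk' ω
      have p3 : uu P F X l θ k ω * Real.sqrt (uu P F X l θ k ω) ≤ 3 * b k ω := by
        have hsq : Real.sqrt (2 * s k ω) ≤ 3 / 2 * Real.sqrt (s k ω) := by
          rw [Real.sqrt_mul (by norm_num)]
          have : Real.sqrt 2 ≤ 3 / 2 := by rw [Real.sqrt_le_iff]; norm_num
          gcongr
        calc _ ≤ (2 * s k ω) * Real.sqrt (2 * s k ω) :=
              mul_le_mul h.2.2 (Real.sqrt_le_sqrt h.2.2) (Real.sqrt_nonneg _) (by positivity)
          _ ≤ (2 * s k ω) * (3 / 2 * Real.sqrt (s k ω)) := by gcongr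
          _ = 3 * (s k ω * Real.sqrt (s k ω)) := by ring
          _ ≤ 3 * b k ω := by linarith [H.sb k hk' ω]
      have p4 : (t * Real.sqrt t)⁻¹ * (|yy P F X l θ k ω| * Real.sqrt |yy P F X l θ k ω|) ≤
          (t * Real.sqrt t)⁻¹ * (|X k ω| ^ 3 + 3 * b k ω) := by
        apply mul_le_mul_of_nonneg_left _ (by positivity)
        exact p2.trans (by linarith)
      have p5 : psid (psum (yy P F X l θ) k ω / t) * (yy P F X l θ k ω / t) = t⁻¹ * (psid (psum (yy P F X l θ) k ω / t) * yy P F X l θ k ω) := by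
        rw [div_eq_mul_inv]; ring
      linarith
    rw [integral_add (addI j1 (iy.const_mul _)) ((addI (cint k hk') ((bi k hk').const_mul 3)).const_mul _),
      integral_add j1 (iy.const_mul _), integral_const_mul, z, mul_zero, add_zero, integral_const_mul,
      integral_add (cint k hk') ((bi k hk').const_mul 3), integral_const_mul] at step
    rw [integral_const_mul] at c3
    simp only [Finset.sum_range_succ]
    rw [integral_add (integrable_finsetSum _ fun i hi => bi i (by have := Finset.mem_range.1 hi; omega)) (bi k hk'), mul_add]
    have p0 : 0 ≤ (t * Real.sqrt t)⁻¹ := by positivity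
    have p6 : (t * Real.sqrt t)⁻¹ * (∫ ω, |X k ω| ^ 3 ∂(tilt P F n X l θ)) ≤ (t * Real.sqrt t)⁻¹ * (4 * ∫ ω, b k ω ∂(tilt P F n X l θ)) :=
      mul_le_mul_of_nonneg_left c3 p0
    linarith

lemma Qconc (H : NM P F n X s b γ ε δ) (T : TP l θ γ) {t : ℝ} (ht : 0 < t) :
    (tilt P F n X l θ).real {ω | t + 320 * l * ε + δ ^ 2 ≤ |QQ X n ω - 1|} ≤ 35 * ε / (t * Real.sqrt t) := by
  have prob := H.tilt_prob T
  obtain ⟨i1, h1⟩ := H.ystep T ht n le_rfl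
  have hb : ∫ ω, ∑ i ∈ Finset.range n, b i ω ∂(tilt P F n X l θ) ≤ ε := by
    calc _ ≤ ∫ ω, ε ∂(tilt P F n X l θ) := by
          refine integral_mono_of_nonneg (Eventually.of_forall fun ω => Finset.sum_nonneg fun i hi => H.b0 i (Finset.mem_range.1 hi) ω)
            (integrable_const _) (tilt_ae _ H.HB)
      _ = ε := by simp
  have st : 0 < t * Real.sqrt t := by positivity
  have mk : (2 / 5) * (tilt P F n X l θ).real {ω | 2 / 5 ≤ psi (psum (yy P F X l θ) n ω / t)} ≤
      ∫ ω, psi (psum (yy P F X l θ) n ω / t) ∂(tilt P F n X l θ) :=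
    mul_meas_ge_le_integral_of_nonneg (Eventually.of_forall fun ω => psi_nonneg _) i1 _
  have sub : (tilt P F n X l θ).real {ω | t + 320 * l * ε + δ ^ 2 ≤ |QQ X n ω - 1|} ≤
      (tilt P F n X l θ).real {ω | 2 / 5 ≤ psi (psum (yy P F X l θ) n ω / t)} := by
    refine ENNReal.toReal_mono (measure_ne_top _ _) (measure_mono_ae ?_)
    have h1 : ∀ᵐ ω ∂P, ∀ i ∈ Finset.range n, |uu P F X l θ i ω - s i ω| ≤ 320 * l * b i ω := by
      rw [Finset.eventually_all]
      intro i hi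
      filter_upwards [H.u_ae T (Finset.mem_range.1 hi)] with ω h using h.2.1
    filter_upwards [tilt_ae _ h1, tilt_ae _ H.HV, tilt_ae _ H.HB] with ω h1 h2 h3 h4
    have h4 : t + 320 * l * ε + δ ^ 2 ≤ |QQ X n ω - 1| := h4
    refine psi_ge _ ?_
    rw [abs_div, abs_of_pos ht, le_div_iff₀ ht, one_mul]
    have e : QQ X n ω - 1 = psum (yy P F X l θ) n ω + ∑ i ∈ Finset.range n, (uu P F X l θ i ω - s i ω)
        + (∑ i ∈ Finset.range n, s i ω - 1) := by
      simp only [QQ, psum, yy, Finset.sum_sub_distrib]; ring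
    have t1 : |∑ i ∈ Finset.range n, (uu P F X l θ i ω - s i ω)| ≤ 320 * l * ε := by
      refine (Finset.abs_sum_le_sum_abs _ _).trans ((Finset.sum_le_sum h1).trans ?_)
      rw [← Finset.mul_sum]
      have := T.l0
      gcongr
    rw [e] at h4
    have a1 := abs_add_le (psum (yy P F X l θ) n ω + ∑ i ∈ Finset.range n, (uu P F X l θ i ω - s i ω)) (∑ i ∈ Finset.range n, s i ω - 1)
    have a2 := abs_add_le (psum (yy P F X l θ) n ω) (∑ i ∈ Finset.range n, (uu P F X l θ i ω - s i ω))
    linarith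
  rw [le_div_iff₀ st]
  have p : 14 * (t * Real.sqrt t)⁻¹ * ∫ ω, ∑ i ∈ Finset.range n, b i ω ∂(tilt P F n X l θ) ≤ 14 * (t * Real.sqrt t)⁻¹ * ε := by gcongr
  have q : (tilt P F n X l θ).real {ω | t + 320 * l * ε + δ ^ 2 ≤ |QQ X n ω - 1|} ≤ 35 * ε * (t * Real.sqrt t)⁻¹ := by linarith
  calc _ ≤ 35 * ε * (t * Real.sqrt t)⁻¹ * (t * Real.sqrt t) := by gcongr
    _ = _ := by field_simp

end NM
end Cram


namespace Cram
open ProbabilityTheory Set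

lemma mills_up (y : ℝ) (hy : 0 ≤ y) : (1 + y) * (1 - stdNormalCDF y) ≤ 2 * Real.exp (-(y ^ 2) / 2) := by
  have h1 := tail_le y hy
  have h2 : y * (1 - stdNormalCDF y) ≤ Real.exp (-(y ^ 2) / 2) := by
    rcases hy.eq_or_lt with h | h
    · rw [← h]; simp
    · rw [one_sub_Phi_Ioi]
      have i1 : IntegrableOn (fun t => Real.exp (-y * t)) (Ioi y) := integrableOn_exp_mul_Ioi (by linarith) y
      have : ∫ t in Ioi y, phi t ≤ ∫ t in Ioi y, Real.exp (y ^ 2 / 2) * Real.exp (-y * t) := by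
        refine integral_mono phi_integrable.integrableOn (i1.const_mul _) fun t => ?_
        refine (phi_le t).trans ?_
        rw [← Real.exp_add, Real.exp_le_exp]
        nlinarith [sq_nonneg (t - y)]
      rw [integral_const_mul, integral_exp_mul_Ioi (by linarith)] at this
      calc y * ∫ t in Ioi y, phi t ≤ y * (Real.exp (y ^ 2 / 2) * (-Real.exp (-y * y) / -y)) := by gcongr
        _ = Real.exp (y ^ 2 / 2) * Real.exp (-y * y) := by field_simp
        _ = Real.exp (-(y ^ 2) / 2) := by rw [← Real.exp_add]; congr 1; ring
        _ ≤ _ := le_rfl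
  linarith

lemma Phi_inc (y : ℝ) (h0 : 0 ≤ y) (h1 : y ≤ 1) : y / 6 ≤ stdNormalCDF y - stdNormalCDF 0 := by
  have hm : MonotoneOn (fun u => stdNormalCDF u - u / 6) (Icc 0 1) := by
    refine monotoneOn_of_deriv_nonneg (convex_Icc _ _) (Continuous.continuousOn (by have := Phi_continuous; fun_prop)) ?_ ?_
    · intro u _
      exact ((Phi_hasDeriv u).sub ((hasDerivAt_id u).div_const 6)).differentiableAt.differentiableWithinAt
    · intro u hu
      rw [interior_Icc] at hu
      have e := ((Phi_hasDeriv u).sub ((hasDerivAt_id u).div_const 6)).deriv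
      have e' : deriv (fun u => stdNormalCDF u - u / 6) u = phi u - 1 / 6 := e
      rw [e']
      have h3 := phi_ge u
      have h4 : -(1 / 2) ≤ -(u ^ 2) / 2 := by nlinarith [hu.1, hu.2]
      have h5 : (1:ℝ) / 2 ≤ Real.exp (-(u ^ 2) / 2) := by
        linarith [Real.add_one_le_exp (-(u ^ 2) / 2)]
      linarith
  have := hm ⟨le_rfl, by norm_num⟩ ⟨h0, h1⟩ h0
  simp only at this
  linarith

lemma psi_step2 (a c : ℝ) : psi (a + c) ≤ psi a + psid a * c + c ^ 2 := by
  unfold psi psid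
  set r := Real.sqrt (1 + a ^ 2) with hr
  have r1 : 1 ≤ r := by rw [hr]; apply Real.one_le_sqrt.2; nlinarith [sq_nonneg a]
  have r2 : r ^ 2 = 1 + a ^ 2 := Real.sq_sqrt (by positivity)
  have r0 : 0 < r := by linarith
  have : Real.sqrt (1 + (a + c) ^ 2) ≤ r + (2 * a * c + c ^ 2) / (2 * r) := by
    have e : r + (2 * a * c + c ^ 2) / (2 * r) = (2 * r ^ 2 + 2 * a * c + c ^ 2) / (2 * r) := by field_simp; ring
    have e0 : 0 ≤ (2 * r ^ 2 + 2 * a * c + c ^ 2) := by nlinarith [sq_nonneg (a + c), sq_nonneg a]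
    have e1 : 0 ≤ r + (2 * a * c + c ^ 2) / (2 * r) := by rw [e]; positivity
    apply Real.sqrt_le_iff.2 ⟨e1, ?_⟩
    have e2 : (r + (2 * a * c + c ^ 2) / (2 * r)) ^ 2 = r ^ 2 + (2 * a * c + c ^ 2) + ((2 * a * c + c ^ 2) / (2 * r)) ^ 2 := by
      field_simp; ring
    rw [e2, r2]; nlinarith [sq_nonneg ((2 * a * c + c ^ 2) / (2 * r))]
  have e3 : (2 * a * c + c ^ 2) / (2 * r) = a / r * c + c ^ 2 / (2 * r) := by field_simp
  have e4 : c ^ 2 / (2 * r) ≤ c ^ 2 := by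
    rw [div_le_iff₀ (by linarith)]; nlinarith [sq_nonneg c]
  linarith

lemma psi_ge' (a : ℝ) (h : 1 ≤ a) : 2 / 5 * a ≤ psi a := by
  unfold psi
  have : 2 / 5 * a + 1 ≤ Real.sqrt (1 + a ^ 2) := by
    apply Real.le_sqrt_of_sq_le
    nlinarith
  linarith

section
variable {Ω : Type} [mΩ : MeasurableSpace Ω] {μ : Measure Ω} [IsProbabilityMeasure μ]
  {F : ℕ → MeasurableSpace Ω} {n : ℕ} {ξ v : ℕ → Ω → ℝ} {γ κ δ : ℝ}

lemma BE.ints (H : BE μ F n ξ v γ κ δ) {i : ℕ} (hi : i < n) :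
    Integrable (ξ i) μ ∧ Integrable (fun ω => ξ i ω ^ 2) μ := by
  have hm : Measurable (ξ i) := (H.ξm i hi).mono (H.Fle _) le_rfl
  have h3 := H.i3 i hi
  constructor
  · refine (h3.add (integrable_const (1:ℝ))).mono' hm.aestronglyMeasurable (Eventually.of_forall fun ω => ?_)
    simp only [Pi.add_apply, Real.norm_eq_abs]
    have := abs_nonneg (ξ i ω)
    nlinarith [mul_nonneg this (sq_nonneg (|ξ i ω| - 1)), sq_nonneg (|ξ i ω| - 1)]
  · refine (h3.add (integrable_const (1:ℝ))).mono' (hm.pow_const 2).aestronglyMeasurable (Eventually.of_forall fun ω => ?_)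
    simp only [Pi.add_apply, Real.norm_eq_abs, abs_pow]
    have := abs_nonneg (ξ i ω)
    rcases le_total (|ξ i ω|) 1 with h | h
    · nlinarith [pow_nonneg this 3]
    · nlinarith [mul_nonneg (sq_nonneg |ξ i ω|) (sub_nonneg.2 h)]

lemma BE.psi_int (H : BE μ F n ξ v γ κ δ) (hδ : δ ^ 2 ≤ 1) {K : ℝ} (hK : 0 < K) :
    Integrable (fun ω => psi (psum ξ n ω / K)) μ ∧ ∫ ω, psi (psum ξ n ω / K) ∂μ ≤ 4 / K ^ 2 := by
  have vi : ∀ i < n, Integrable (v i) μ := fun i hi =>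
    int_bdd' ((H.vm i hi).mono (H.Fle _) le_rfl) (γ ^ 2) fun ω => by
      rw [abs_of_nonneg (H.v0 i hi ω)]; exact H.vγ i hi ω
  have pint : ∀ k ≤ n, Integrable (fun ω => psi (psum ξ k ω / K)) μ := by
    intro k hk
    have h1 : Integrable (psum ξ k) μ :=
      integrable_finsetSum _ fun i hi => (H.ints (by have := Finset.mem_range.1 hi; omega)).1
    refine (h1.div_const K).abs.mono' ?_ (Eventually.of_forall fun ω => ?_)
    · exact (psi_cont.measurable.comp ((psum_meas' _ _ k fun j hj => (H.ξm j (by omega)).mono (H.Fle _) le_rfl).div_const K)).aestronglyMeasurable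
    · rw [Real.norm_eq_abs, abs_of_nonneg (psi_nonneg _)]; exact psi_le _
  have key : ∀ k ≤ n, ∫ ω, psi (psum ξ k ω / K) ∂μ ≤ 2 / K ^ 2 * ∫ ω, ∑ i ∈ Finset.range k, v i ω ∂μ := by
    intro k
    induction k with
    | zero => intro _; simp [psum, psi]
    | succ k ih =>
      intro hk
      have j2 := ih (by omega)
      have j1 := pint k (by omega)
      have hk' : k < n := by omega
      have mT : Measurable[F k] (psum ξ k) :=
        psum_meas' _ _ k fun j hj => (H.ξm j (by omega)).mono (H.Fm (by omega)) le_rfl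
      have md : Measurable[F k] fun ω => psid (psum ξ k ω / K) :=
        psid_cont.measurable.comp (mT.div_const K)
      have bd : ∀ ω, |psid (psum ξ k ω / K)| ≤ 1 := fun ω => psid_le _
      have iy : Integrable (fun ω => psid (psum ξ k ω / K) * ξ k ω) μ :=
        int_bdd (md.mono (H.Fle _) le_rfl) 1 bd (H.ints hk').1
      have z := H.H1 k hk' _ md 1 bd
      have q := H.H2 k hk' (fun _ => 1) measurable_const 1 (fun ω => by simp)
      simp only [one_mul, abs_one] at q
      rw [integral_sub (H.ints hk').2 (vi k hk')] at q
      have q2 := (abs_le.1 q).2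
      have v0 : 0 ≤ ∫ ω, v k ω ∂μ := integral_nonneg fun ω => H.v0 k hk' ω
      have q3 : ∫ ω, ξ k ω ^ 2 ∂μ ≤ 2 * ∫ ω, v k ω ∂μ := by nlinarith [H.κ1]
      have step : ∫ ω, psi (psum ξ (k + 1) ω / K) ∂μ ≤
          ∫ ω, ((psi (psum ξ k ω / K) + K⁻¹ * (psid (psum ξ k ω / K) * ξ k ω)) + (K ^ 2)⁻¹ * ξ k ω ^ 2) ∂μ := by
        refine integral_mono (pint _ hk) (addI (addI j1 (iy.const_mul _)) ((H.ints hk').2.const_mul _)) fun ω => ?_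
        have e : psum ξ (k + 1) ω / K = psum ξ k ω / K + ξ k ω / K := by
          rw [psum, Finset.sum_range_succ, add_div]; rfl
        have p1 := psi_step2 (psum ξ k ω / K) (ξ k ω / K)
        simp only
        rw [e]
        refine p1.trans (le_of_eq ?_)
        rw [div_pow, div_eq_mul_inv (ξ k ω) K, div_eq_mul_inv (ξ k ω ^ 2)]; ring
      rw [integral_add (addI j1 (iy.const_mul _)) ((H.ints hk').2.const_mul _),
        integral_add j1 (iy.const_mul _), integral_const_mul, z, mul_zero, add_zero, integral_const_mul] at step
      simp only [Finset.sum_range_succ]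
      rw [integral_add (integrable_finsetSum _ fun i hi => vi i (by have := Finset.mem_range.1 hi; omega)) (vi k hk'), mul_add]
      have p6 : (K ^ 2)⁻¹ * (∫ ω, ξ k ω ^ 2 ∂μ) ≤ (K ^ 2)⁻¹ * (2 * ∫ ω, v k ω ∂μ) :=
        mul_le_mul_of_nonneg_left q3 (by positivity)
      have p7 : (K ^ 2)⁻¹ * (2 * ∫ ω, v k ω ∂μ) = 2 / K ^ 2 * ∫ ω, v k ω ∂μ := by ring
      linarith
  refine ⟨pint n le_rfl, (key n le_rfl).trans ?_⟩
  have : ∫ ω, ∑ i ∈ Finset.range n, v i ω ∂μ ≤ 2 := by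
    calc _ ≤ ∫ ω, (2:ℝ) ∂μ := by
          refine integral_mono_of_nonneg (Eventually.of_forall fun ω => Finset.sum_nonneg fun i hi => H.v0 i (Finset.mem_range.1 hi) ω)
            (integrable_const _) ?_
          filter_upwards [H.HV] with ω h
          have := (abs_le.1 h).2
          linarith
      _ = 2 := by simp
  calc _ ≤ 2 / K ^ 2 * 2 := by gcongr
    _ = _ := by ring

lemma BE.window (H : BE μ F n ξ v γ κ δ) (hδ : δ ^ 2 ≤ 1) {a : ℝ} (ha : 0 < a) :
    a ^ 2 / (4 * a ^ 2 + 80) ≤ μ.real {ω | -a ≤ psum ξ n ω ∧ psum ξ n ω ≤ a + 40 / a} := by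
  set K := a + 40 / a with hKd
  have hK : 0 < K := by positivity
  have hKa : a ≤ K := by have : 0 < 40 / a := by positivity
                         linarith
  obtain ⟨i1, h1⟩ := H.psi_int hδ hK
  have hM : Measurable (psum ξ n) := psum_meas' _ _ n fun j hj => (H.ξm j hj).mono (H.Fle _) le_rfl
  have iM : Integrable (psum ξ n) μ := integrable_finsetSum _ fun i hi => (H.ints (Finset.mem_range.1 hi)).1
  have zM : ∫ ω, psum ξ n ω ∂μ = 0 := by
    unfold psum
    rw [integral_finsetSum _ fun i hi => (H.ints (Finset.mem_range.1 hi)).1]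
    refine Finset.sum_eq_zero fun i hi => ?_
    have := H.H1 i (Finset.mem_range.1 hi) (fun _ => 1) measurable_const 1 (fun ω => by simp)
    simpa using this
  set E := {ω | -a ≤ psum ξ n ω ∧ psum ξ n ω ≤ K} with hE
  have mE : MeasurableSet E := (measurableSet_le measurable_const hM).inter (measurableSet_le hM measurable_const)
  have iE : Integrable (E.indicator fun _ => (1:ℝ)) μ := (integrable_const _).indicator mE
  have vE : ∫ ω, E.indicator (fun _ => (1:ℝ)) ω ∂μ = μ.real E := by
    rw [integral_indicator mE]; simp [Measure.real]
  have step : ∫ ω, (psum ξ n ω + a) ∂μ ≤ ∫ ω, ((K + a) * E.indicator (fun _ => (1:ℝ)) ω + 5 * K * psi (psum ξ n ω / K)) ∂μ := by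
    refine integral_mono (addI iM (integrable_const _)) (addI (iE.const_mul _) (i1.const_mul _)) fun ω => ?_
    simp only
    have p0 : 0 ≤ 5 * K * psi (psum ξ n ω / K) := mul_nonneg (by positivity) (psi_nonneg _)
    by_cases h : ω ∈ E
    · rw [indicator_of_mem h]
      have := h.2
      linarith
    · rw [indicator_of_notMem h, mul_zero, zero_add]
      by_cases h2 : -a ≤ psum ξ n ω
      · have h3 : K < psum ξ n ω := by
          by_contra h4
          exact h ⟨h2, not_lt.1 h4⟩
        have h4 := psi_ge' (psum ξ n ω / K) (by rw [le_div_iff₀ hK]; linarith)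
        have h5 : 5 * K * (2 / 5 * (psum ξ n ω / K)) ≤ 5 * K * psi (psum ξ n ω / K) := by gcongr
        have h6 : 5 * K * (2 / 5 * (psum ξ n ω / K)) = 2 * psum ξ n ω := by field_simp
        linarith
      · push Not at h2; linarith
  rw [integral_add iM (integrable_const _), zM, integral_add (iE.const_mul _) (i1.const_mul _), integral_const_mul, vE,
    integral_const_mul] at step
  simp only [integral_const, probReal_univ, smul_eq_mul, one_mul, zero_add] at step
  have s2 : 5 * K * ∫ ω, psi (psum ξ n ω / K) ∂μ ≤ 5 * K * (4 / K ^ 2) := by gcongr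
  have s3 : 5 * K * (4 / K ^ 2) = 20 / K := by field_simp; norm_num
  have s4 : 20 / K ≤ a / 2 := by
    rw [div_le_iff₀ hK, hKd]
    have : a * (40 / a) = 40 := by field_simp
    nlinarith
  have s5 : a / 2 ≤ (K + a) * μ.real E := by linarith
  have s6 : K + a = (2 * a ^ 2 + 40) / a := by rw [hKd]; field_simp; ring
  rw [s6] at s5
  rw [div_le_iff₀ (by positivity)]
  have s7 : a * (a / 2) ≤ a * ((2 * a ^ 2 + 40) / a * μ.real E) := by gcongr
  have s8 : a * ((2 * a ^ 2 + 40) / a * μ.real E) = (2 * a ^ 2 + 40) * μ.real E := by field_simp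
  nlinarith
end
end Cram


namespace Cram
open ProbabilityTheory Set

/-- the error functional of the theorem -/
noncomputable def RR (x γ ε δ : ℝ) : ℝ :=
  x ^ 3 * ε + x ^ 2 * δ ^ 2 + (1 + x) * (x * γ + γ * |Real.log γ| + δ + ε ^ ((1 : ℝ) / 4) / (1 + x ^ ((3 : ℝ) / 4)))

/-- the event `x ≤ W` -/
def WE {Ω : Type} (X : ℕ → Ω → ℝ) (n : ℕ) (x : ℝ) : Set Ω := {ω | x ≤ psum X n ω / Real.sqrt (QQ X n ω)}

lemma QQ_zero {Ω : Type} (X : ℕ → Ω → ℝ) (n : ℕ) (ω : Ω) (h : QQ X n ω = 0) : psum X n ω = 0 := by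
  unfold QQ at h
  rw [Finset.sum_eq_zero_iff_of_nonneg fun _ _ => sq_nonneg _] at h
  exact Finset.sum_eq_zero fun i hi => by simpa using h i hi

lemma WE_of {Ω : Type} {X : ℕ → Ω → ℝ} {n : ℕ} {x l A : ℝ} {ω : Ω} (hx : 0 ≤ x) (hl : 0 ≤ l) (hA : 0 < A)
    (h : l * (QQ X n ω / 2 + A / 2) ≤ psum X n ω) (hxl : x ^ 2 ≤ l ^ 2 * A) (h0 : 0 < l ∨ x = 0) : ω ∈ WE X n x := by
  have hq := QQ_nonneg X n ω
  have hS : 0 ≤ psum X n ω := le_trans (by positivity) h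
  change x ≤ psum X n ω / Real.sqrt (QQ X n ω)
  rcases h0 with h0 | h0
  · have hS' : 0 < psum X n ω := lt_of_lt_of_le (by positivity) h
    have hq' : 0 < QQ X n ω := by
      rcases hq.eq_or_lt with e | e
      · rw [QQ_zero X n ω e.symm] at hS'; exact absurd hS' (lt_irrefl _)
      · exact e
    rw [le_div_iff₀ (Real.sqrt_pos.2 hq')]
    refine (le_abs_self _).trans (abs_le_of_sq_le_sq ?_ hS)
    rw [mul_pow, Real.sq_sqrt hq]
    have h1 : (l * (QQ X n ω / 2 + A / 2)) ^ 2 ≤ psum X n ω ^ 2 := pow_le_pow_left₀ (by positivity) h 2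
    have h2 : x ^ 2 * QQ X n ω ≤ l ^ 2 * A * QQ X n ω := mul_le_mul_of_nonneg_right hxl hq
    have h3 : l ^ 2 * (A * QQ X n ω) ≤ l ^ 2 * (QQ X n ω / 2 + A / 2) ^ 2 :=
      mul_le_mul_of_nonneg_left (by nlinarith [sq_nonneg (QQ X n ω - A)]) (sq_nonneg l)
    nlinarith
  · rw [h0]; exact div_nonneg hS (Real.sqrt_nonneg _)

namespace NM
variable {Ω : Type} [mΩ : MeasurableSpace Ω] {P : Measure Ω} [IsProbabilityMeasure P]
  {F : ℕ → MeasurableSpace Ω} {n : ℕ} {X s b : ℕ → Ω → ℝ} {γ ε δ l θ x : ℝ}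

lemma WE_meas (H : NM P F n X s b γ ε δ) (x : ℝ) : MeasurableSet (WE X n x) :=
  measurableSet_le measurable_const (H.SS_meas.div H.QQ_meas.sqrt)

lemma map_prob (H : NM P F n X s b γ ε δ) (T : TP l (1 / 2) γ) :
    IsProbabilityMeasure ((tilt P F n X l (1 / 2)).map (psum (xi P F X l) n)) := by
  have := H.tilt_prob T
  exact Measure.isProbabilityMeasure_map (H.MM_meas l).aemeasurable

lemma map_D (H : NM P F n X s b γ ε δ) (T : TP l (1 / 2) γ) (t : ℝ) :
    |((tilt P F n X l (1 / 2)).map (psum (xi P F X l) n)).real (Iic t) - stdNormalCDF t| ≤ DD γ δ l := by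
  rw [map_measureReal_apply (H.MM_meas l) measurableSet_Iic]
  exact H.Dbd T t

lemma low1 (H : NM P F n X s b γ ε δ) (T : TP l (1 / 2) γ) (hx : 0 ≤ x) {I : Set ℝ} (hI : MeasurableSet I) {A : ℝ}
    (hA : 0 < A) (hy : ∀ y ∈ I, l * A / 2 ≤ y + l / 2 - hs ε δ l) (hxl : x ^ 2 ≤ l ^ 2 * A) (h0 : 0 < l ∨ x = 0) :
    Real.exp (-(600 * l ^ 3 * ε) - (l ^ 2 / 2 + l * hs ε δ l)) *
      ∫ y, I.indicator (fun y => Real.exp (-l * y)) y ∂((tilt P F n X l (1 / 2)).map (psum (xi P F X l) n))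
      ≤ P.real (WE X n x) := by
  have hp := H.tilt_prob T
  have hl := T.l0
  set M := psum (xi P F X l) n with hM
  have mM : Measurable M := H.MM_meas l
  have mg : Measurable (I.indicator (fun y => Real.exp (-l * y))) := (by fun_prop : Measurable fun y : ℝ => Real.exp (-l * y)).indicator hI
  have key := H.com_low T (hI.preimage mM) (g := fun ω => Real.exp (-(l ^ 2 / 2 + l * hs ε δ l)) * Real.exp (-l * M ω)) ?_ ?_
  · rw [integral_map mM.aemeasurable mg.aestronglyMeasurable]
    have e : ∫ ω, (M ⁻¹' I).indicator (fun ω => Real.exp (-(l ^ 2 / 2 + l * hs ε δ l)) * Real.exp (-l * M ω)) ω ∂(tilt P F n X l (1 / 2))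
      = Real.exp (-(l ^ 2 / 2 + l * hs ε δ l)) * ∫ ω, I.indicator (fun y => Real.exp (-l * y)) (M ω) ∂(tilt P F n X l (1 / 2)) := by
      rw [← integral_const_mul]
      refine integral_congr_ae (Eventually.of_forall fun ω => ?_)
      by_cases h : M ω ∈ I
      · simp only [indicator_of_mem h, indicator_of_mem (show ω ∈ M ⁻¹' I from h)]
      · simp only [indicator_of_notMem h, indicator_of_notMem (show ω ∉ M ⁻¹' I from h), mul_zero]
    rw [e] at key
    calc _ = Real.exp (-(600 * l ^ 3 * ε)) * (Real.exp (-(l ^ 2 / 2 + l * hs ε δ l)) * ∫ ω, I.indicator (fun y => Real.exp (-l * y)) (M ω) ∂(tilt P F n X l (1 / 2))) := by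
          rw [← mul_assoc, ← Real.exp_add, sub_eq_add_neg]
      _ ≤ P.real (M ⁻¹' I) := key
      _ ≤ _ := by
        refine ENNReal.toReal_mono (measure_ne_top _ _) (measure_mono_ae ?_)
        filter_upwards [H.Z_ae T] with ω hz hω
        have h1 := hy _ hω
        obtain ⟨h2, h3⟩ := abs_le.1 hz
        refine WE_of hx hl hA ?_ hxl h0
        linarith
  · refine int_bdd' ?_ (Real.exp (-(l ^ 2 / 2 + l * hs ε δ l)) * Real.exp (-l * (l * A / 2 - l / 2 + hs ε δ l))) fun ω => ?_
    · exact (by fun_prop : Measurable fun ω => Real.exp (-(l ^ 2 / 2 + l * hs ε δ l)) * Real.exp (-l * M ω)).indicator (hI.preimage mM)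
    · by_cases h : M ω ∈ I
      · rw [indicator_of_mem (show ω ∈ M ⁻¹' I from h), abs_of_pos (by positivity)]
        refine mul_le_mul_of_nonneg_left (Real.exp_le_exp.2 ?_) (Real.exp_pos _).le
        have := mul_le_mul_of_nonneg_left (hy _ h) hl
        nlinarith
      · rw [indicator_of_notMem (show ω ∉ M ⁻¹' I from h), abs_zero]; positivity
  · filter_upwards [H.Z_ae T] with ω hz hω
    rw [← Real.exp_add, Real.exp_le_exp]
    obtain ⟨h2, h3⟩ := abs_le.1 hz
    have := mul_le_mul_of_nonneg_left h3 hl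
    nlinarith

end NM
end Cram


namespace Cram
open ProbabilityTheory Set

lemma RR_facts {x γ ε δ : ℝ} (hx : 0 ≤ x) (hγ : 0 < γ) (hε : 0 < ε) (hδ : 0 ≤ δ) :
    (1 + x) * (γ * |Real.log γ| + x * γ + δ) ≤ RR x γ ε δ ∧ x ^ 3 * ε ≤ RR x γ ε δ ∧ x ^ 2 * δ ^ 2 ≤ RR x γ ε δ ∧
    x ^ 2 * γ ≤ RR x γ ε δ ∧ (1 + x) * δ ≤ RR x γ ε δ ∧
    (1 + x) * (ε ^ ((1 : ℝ) / 4) / (1 + x ^ ((3 : ℝ) / 4))) ≤ RR x γ ε δ ∧ 0 < RR x γ ε δ ∧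
    x ^ 3 * ε + x ^ 2 * δ ^ 2 + (1 + x) * (γ * |Real.log γ| + x * γ + δ) ≤ RR x γ ε δ := by
  unfold RR
  have h1 : 0 < ε ^ ((1 : ℝ) / 4) / (1 + x ^ ((3 : ℝ) / 4)) := by positivity
  set E := ε ^ ((1 : ℝ) / 4) / (1 + x ^ ((3 : ℝ) / 4)) with hE
  have a1 : 0 ≤ x ^ 3 * ε := by positivity
  have a2 : 0 ≤ x ^ 2 * δ ^ 2 := by positivity
  have a3 : 0 ≤ γ * |Real.log γ| := by positivity
  have a4 : 0 ≤ x * γ := by positivity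
  have a5 : 0 ≤ x * (x * γ) := by positivity
  have a6 : 0 ≤ x * (γ * |Real.log γ|) := by positivity
  have a7 : 0 ≤ x * δ := by positivity
  have a8 : 0 ≤ x * E := by positivity
  refine ⟨?_, ?_, ?_, ?_, ?_, ?_, ?_, ?_⟩ <;> nlinarith

namespace NM
variable {Ω : Type} [mΩ : MeasurableSpace Ω] {P : Measure Ω} [IsProbabilityMeasure P]
  {F : ℕ → MeasurableSpace Ω} {n : ℕ} {X s b : ℕ → Ω → ℝ} {γ ε δ l θ x : ℝ}

set_option maxHeartbeats 4000000 in
/-- cases (i) and (ii) of the lower bound -/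
lemma low_a (H : NM P F n X s b γ ε δ) (hx : 0 ≤ x) (hxγ : x * γ ≤ 1 / 1000000)
    (hD : DD γ δ (x * (1 + 4 * (2000 * x * ε + δ ^ 2 / 2))) ≤ 1 / 20) :
    Real.exp (-(10 ^ 14 * RR x γ ε δ)) * (1 - stdNormalCDF x) ≤ P.real (WE X n x) := by
  obtain ⟨r1, r2, r3, r4, r5, -, r0, r7⟩ := RR_facts hx H.γ0 H.ε0 H.δ0
  set R := RR x γ ε δ with hR
  have hγ := H.γ0; have hε := H.ε0; have hδ := H.δ0; have hεγ := H.εγ; have hδ1 := H.δ1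
  set q := 2000 * x * ε + δ ^ 2 / 2 with hq
  have xe : x * ε ≤ 2 * (x * γ) := by nlinarith
  have hδ2 : δ ^ 2 ≤ 1 / 16 := by nlinarith
  have q0 : 0 ≤ q := by positivity
  have q1 : q ≤ 1 / 8 := by nlinarith
  set l := x * (1 + 4 * q) with hl
  have lx : x ≤ l := by nlinarith
  have l2 : l ≤ 2 * x := by nlinarith
  have l0 : 0 ≤ l := hx.trans lx
  have T : TP l (1 / 2) γ := ⟨l0, by nlinarith, by norm_num, by norm_num⟩
  have hh : hs ε δ l ≤ l * q := by
    unfold hs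
    have : 1000 * (l * (l * ε)) ≤ 1000 * (l * (2 * x * ε)) := by gcongr
    rw [hq]; nlinarith
  have hh0 : 0 ≤ hs ε δ l := by unfold hs; positivity
  set D := DD γ δ l with hDd
  have D0 : 0 ≤ D := by rw [hDd]; unfold DD; positivity
  have x2e : x ^ 2 * ε ≤ 2 * R := by nlinarith [mul_nonneg hx hx]
  have xd : x * δ ^ 2 ≤ R := by
    have : x * (δ * δ) ≤ x * (δ * 1) := by gcongr; linarith
    nlinarith
  -- losses
  have L1 : 600 * l ^ 3 * ε ≤ 4800 * R := by
    have : l ^ 3 ≤ (2 * x) ^ 3 := pow_le_pow_left₀ l0 l2 3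
    have := mul_le_mul_of_nonneg_right this hε.le
    nlinarith
  have L2 : l * hs ε δ l ≤ 8002 * R := by
    have h1 : l * hs ε δ l ≤ l * (l * q) := by gcongr
    have h2 : l * (l * q) ≤ (2 * x) * ((2 * x) * q) := by gcongr
    have h3 : (2 * x) * ((2 * x) * q) = 8000 * (x ^ 3 * ε) + 2 * (x ^ 2 * δ ^ 2) := by rw [hq]; ring
    linarith
  have L3 : (1 + l) * D ≤ 40000000000 * R := by
    have h1 : (1 + l) * D ≤ (2 * (1 + x)) * (10000000000 * (γ * |Real.log γ| + 2 * x * γ + δ)) := by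
      rw [hDd]; unfold DD
      gcongr; linarith
    have h2 : (1 + x) * (γ * |Real.log γ| + 2 * x * γ + δ) ≤ (1 + x) * (2 * (γ * |Real.log γ| + x * γ + δ)) := by
      have : 0 ≤ γ * |Real.log γ| := by positivity
      gcongr; linarith
    linarith
  have L4 : 15 * (1 + l) * (l - x) ≤ 10 ^ 7 * R := by
    have h1 : l - x = 4 * x * q := by rw [hl]; ring
    have h2 : (1 + l) * (l - x) ≤ (1 + 2 * x) * (4 * x * q) := by
      rw [h1]; gcongr
    have h3 : (1 + 2 * x) * (4 * x * q) = 8000 * (x ^ 2 * ε) + 2 * (x * δ ^ 2) + 16000 * (x ^ 3 * ε) + 4 * (x ^ 2 * δ ^ 2) := by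
      rw [hq]; ring
    linarith
  have sh := tail_shift l x l l0 lx le_rfl
  have shx : (1 - stdNormalCDF x) ≤ (1 - stdNormalCDF l) * Real.exp (10 ^ 7 * R) :=
    sh.trans (mul_le_mul_of_nonneg_left (Real.exp_le_exp.2 L4) (tail_pos l).le)
  have hA : 0 < 1 - 2 * q := by linarith
  have hxl : x ^ 2 ≤ l ^ 2 * (1 - 2 * q) := by
    rw [hl]
    have : 1 ≤ (1 + 4 * q) ^ 2 * (1 - 2 * q) := by 
      have a1 := mul_nonneg q0 (mul_nonneg q0 (sub_nonneg.2 q1))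
      have a2 := mul_nonneg q0 (sub_nonneg.2 q1)
      clear_value q
      clear L1 L2 L3 L4 sh shx
      nlinarith
    calc x ^ 2 = x ^ 2 * 1 := by ring
      _ ≤ x ^ 2 * ((1 + 4 * q) ^ 2 * (1 - 2 * q)) := by gcongr
      _ = _ := by ring
  have h0 : 0 < l ∨ x = 0 := by
    rcases hx.eq_or_lt with h | h
    · right; exact h.symm
    · left; linarith
  have hpm := H.map_prob T
  by_cases c : (1 + l) * D ≤ 1 / 60
  · -- case (i)
    have k := H.low1 T hx (measurableSet_Ici (a := (0:ℝ))) hA (fun y hy => by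
      have : (0:ℝ) ≤ y := hy
      linarith) hxl h0
    have k2 := exptail_lower _ D (H.map_D T) l 0 l0
    rw [add_zero, mul_zero, Real.exp_zero, mul_one] at k2
    set J := ∫ y, (Ici (0:ℝ)).indicator (fun y => Real.exp (-l * y)) y ∂((tilt P F n X l (1 / 2)).map (psum (xi P F X l) n)) with hJ
    have tg := tail_ge l l0
    -- twice D ≤ 30 (1+l) D * e^{l²/2} Φbar(l)
    have k3 : 2 * D ≤ 30 * ((1 + l) * D) * (Real.exp (l ^ 2 / 2) * (1 - stdNormalCDF l)) := by
      have : Real.exp (l ^ 2 / 2) * (Real.exp (-(l ^ 2) / 2) / (15 * (1 + l))) ≤ Real.exp (l ^ 2 / 2) * (1 - stdNormalCDF l) := by gcongr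
      have e1 : Real.exp (l ^ 2 / 2) * (Real.exp (-(l ^ 2) / 2) / (15 * (1 + l))) = 1 / (15 * (1 + l)) := by
        rw [← mul_div_assoc, ← Real.exp_add]; congr 1; rw [Real.exp_eq_one_iff]; ring
      rw [e1] at this
      calc 2 * D = 30 * ((1 + l) * D) * (1 / (15 * (1 + l))) := by field_simp; ring
        _ ≤ _ := by gcongr
    have k4 : Real.exp (-(60 * ((1 + l) * D))) ≤ 1 - 30 * ((1 + l) * D) := by
      have u0 : 0 ≤ (1 + l) * D := by positivity
      set u := (1 + l) * D
      have h1 := Real.add_one_le_exp (60 * u)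
      rw [Real.exp_neg]
      have : (Real.exp (60 * u))⁻¹ ≤ (60 * u + 1)⁻¹ := by gcongr
      refine this.trans ?_
      rw [inv_le_comm₀ (by positivity) (by linarith), ← one_div, div_le_iff₀ (by linarith)]
      have := mul_nonneg u0 (sub_nonneg.2 c)
      linarith
    have k5 : Real.exp (l ^ 2 / 2) * (1 - stdNormalCDF l) * Real.exp (-(60 * ((1 + l) * D))) ≤ J := by
      have := mul_le_mul_of_nonneg_left k4 (mul_pos (Real.exp_pos (l ^ 2 / 2)) (tail_pos l)).le
      linarith
    calc Real.exp (-(10 ^ 14 * R)) * (1 - stdNormalCDF x) ≤ Real.exp (-(10 ^ 14 * R)) * ((1 - stdNormalCDF l) * Real.exp (10 ^ 7 * R)) := by gcongr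
      _ = Real.exp (-(10 ^ 14 * R) + 10 ^ 7 * R) * (1 - stdNormalCDF l) := by rw [Real.exp_add]; ring
      _ ≤ Real.exp ((-(600 * l ^ 3 * ε) - (l ^ 2 / 2 + l * hs ε δ l)) + l ^ 2 / 2 + (-(60 * ((1 + l) * D)))) * (1 - stdNormalCDF l) := by
          refine mul_le_mul_of_nonneg_right (Real.exp_le_exp.2 ?_) (tail_pos l).le
          linarith
      _ = Real.exp (-(600 * l ^ 3 * ε) - (l ^ 2 / 2 + l * hs ε δ l)) * (Real.exp (l ^ 2 / 2) * (1 - stdNormalCDF l) * Real.exp (-(60 * ((1 + l) * D)))) := by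
          rw [Real.exp_add, Real.exp_add]; ring
      _ ≤ _ := (mul_le_mul_of_nonneg_left k5 (Real.exp_pos _).le).trans k
  · push Not at c
    have k := H.low1 T hx (measurableSet_Ioc (a := (0:ℝ)) (b := 20 * D)) hA (fun y hy => by
      have := hy.1
      linarith) hxl h0
    set μM := (tilt P F n X l (1 / 2)).map (psum (xi P F X l) n) with hμ
    have m1 : D ≤ μM.real (Ioc 0 (20 * D)) := by
      have e : Ioc (0:ℝ) (20 * D) = Iic (20 * D) \ Iic 0 := by ext y; simp
      rw [e, measureReal_sdiff (Iic_subset_Iic.2 (by linarith)) measurableSet_Iic]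
      have a1 := (abs_le.1 (H.map_D T (20 * D))).1
      have a2 := (abs_le.1 (H.map_D T 0)).2
      have a3 := Phi_inc (20 * D) (by linarith) (by linarith)
      linarith
    have m2 : Real.exp (-l * (20 * D)) * D ≤ ∫ y, (Ioc (0:ℝ) (20 * D)).indicator (fun y => Real.exp (-l * y)) y ∂μM := by
      calc Real.exp (-l * (20 * D)) * D ≤ Real.exp (-l * (20 * D)) * μM.real (Ioc 0 (20 * D)) := by gcongr
        _ = ∫ y, (Ioc (0:ℝ) (20 * D)).indicator (fun y => Real.exp (-l * (20 * D))) y ∂μM := by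
            rw [integral_indicator measurableSet_Ioc, setIntegral_const, smul_eq_mul, mul_comm]
        _ ≤ _ := by
            refine integral_mono ?_ ?_ fun y => ?_
            · exact (integrable_const _).indicator measurableSet_Ioc
            · refine int_bdd' ((by fun_prop : Measurable fun y : ℝ => Real.exp (-l * y)).indicator measurableSet_Ioc) 1 fun y => ?_
              by_cases h : y ∈ Ioc (0:ℝ) (20 * D)
              · rw [indicator_of_mem h, abs_of_pos (Real.exp_pos _)]
                apply Real.exp_le_one_iff.2; linarith [mul_nonneg l0 h.1.le]
              · rw [indicator_of_notMem h]; simp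
            · by_cases h : y ∈ Ioc (0:ℝ) (20 * D)
              · rw [indicator_of_mem h, indicator_of_mem h]
                apply Real.exp_le_exp.2; linarith [mul_le_mul_of_nonneg_left h.2 l0]
              · rw [indicator_of_notMem h, indicator_of_notMem h]
    have m3 : (1 - stdNormalCDF l) * Real.exp (l ^ 2 / 2) ≤ 120 * D := by
      have h1 := mills_up l l0
      have h2 : (1 + l) * ((1 - stdNormalCDF l) * Real.exp (l ^ 2 / 2)) ≤ 2 := by
        calc _ = ((1 + l) * (1 - stdNormalCDF l)) * Real.exp (l ^ 2 / 2) := by ring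
          _ ≤ (2 * Real.exp (-(l ^ 2) / 2)) * Real.exp (l ^ 2 / 2) := by gcongr
          _ = 2 := by rw [mul_assoc, ← Real.exp_add, show -(l ^ 2) / 2 + l ^ 2 / 2 = 0 by ring, Real.exp_zero, mul_one]
      have h3 : 2 ≤ (1 + l) * (120 * D) := by linarith
      exact le_of_mul_le_mul_left (h2.trans h3) (by linarith)
    have m4 : 1 ≤ 2400000000000 * R := by linarith
    have m5 : (120:ℝ) ≤ Real.exp (10 * (2400000000000 * R)) := by
      have h1 : (120:ℝ) ≤ Real.exp 10 := by
        have h := Real.exp_one_gt_d9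
        have h5 : (2:ℝ) ^ 10 ≤ Real.exp 1 ^ 10 := pow_le_pow_left₀ (by norm_num) (by linarith) 10
        rw [← Real.exp_nat_mul] at h5
        norm_num at h5; linarith
      exact h1.trans (Real.exp_le_exp.2 (by linarith))
    calc Real.exp (-(10 ^ 14 * R)) * (1 - stdNormalCDF x) ≤ Real.exp (-(10 ^ 14 * R)) * ((1 - stdNormalCDF l) * Real.exp (10 ^ 7 * R)) := by gcongr
      _ = Real.exp (-(10 ^ 14 * R) + 10 ^ 7 * R - l ^ 2 / 2) * ((1 - stdNormalCDF l) * Real.exp (l ^ 2 / 2)) := by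
          have e : Real.exp (-(10 ^ 14 * R)) * Real.exp (10 ^ 7 * R) =
              Real.exp (-(10 ^ 14 * R) + 10 ^ 7 * R - l ^ 2 / 2) * Real.exp (l ^ 2 / 2) := by
            rw [← Real.exp_add, ← Real.exp_add]; congr 1; ring
          linear_combination (1 - stdNormalCDF l) * e
      _ ≤ Real.exp (-(10 ^ 14 * R) + 10 ^ 7 * R - l ^ 2 / 2) * (Real.exp (10 * (2400000000000 * R)) * D) := by
          refine mul_le_mul_of_nonneg_left (m3.trans ?_) (Real.exp_pos _).le
          gcongr
      _ = Real.exp (-(10 ^ 14 * R) + 10 ^ 7 * R - l ^ 2 / 2 + 10 * (2400000000000 * R)) * D := by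
          rw [← mul_assoc, ← Real.exp_add]
      _ ≤ Real.exp ((-(600 * l ^ 3 * ε) - (l ^ 2 / 2 + l * hs ε δ l)) + -l * (20 * D)) * D := by
          refine mul_le_mul_of_nonneg_right (Real.exp_le_exp.2 ?_) D0
          linarith
      _ = Real.exp (-(600 * l ^ 3 * ε) - (l ^ 2 / 2 + l * hs ε δ l)) * (Real.exp (-l * (20 * D)) * D) := by
          rw [Real.exp_add]; ring
      _ ≤ _ := (mul_le_mul_of_nonneg_left m2 (Real.exp_pos _).le).trans k

end NM
end Cram


namespace Cram
open ProbabilityTheory Set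

namespace NM
variable {Ω : Type} [mΩ : MeasurableSpace Ω] {P : Measure Ω} [IsProbabilityMeasure P]
  {F : ℕ → MeasurableSpace Ω} {n : ℕ} {X s b : ℕ → Ω → ℝ} {γ ε δ l θ x : ℝ}

set_option maxHeartbeats 4000000 in
/-- crude lower bound -/
lemma low_b (H : NM P F n X s b γ ε δ) (hx : 0 ≤ x) (hxγ : x * γ ≤ 1 / 10000000) :
    Real.exp (-(300 * (1 + x ^ 2))) ≤ P.real (WE X n x) := by
  have hγ := H.γ0; have hε := H.ε0; have hδ := H.δ0; have hεγ := H.εγ; have hδ1 := H.δ1; have hγ1 := H.γ1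
  set l := max (2 * x) (1 / 1000000) with hl
  have l1 : 2 * x ≤ l := le_max_left _ _
  have l2 : 1 / 1000000 ≤ l := le_max_right _ _
  have lp : 0 < l := by linarith
  have l3 : l ^ 2 ≤ 4 * x ^ 2 + 1 := by
    rcases max_choice (2 * x) (1 / 1000000) with h | h <;> rw [hl, h] <;> nlinarith [sq_nonneg x]
  have lg : l * γ ≤ 25 / 100000000 := by
    rcases max_choice (2 * x) (1 / 1000000) with h | h <;> rw [hl, h] <;> nlinarith
  have T : TP l (1 / 2) γ := ⟨lp.le, by linarith, by norm_num, by norm_num⟩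
  have hδ2 : δ ^ 2 ≤ 1 / 16 := by nlinarith
  have le : l * ε ≤ 5 / 10000000 := by nlinarith
  have hh : hs ε δ l ≤ l * (4 / 100) := by
    have : hs ε δ l = l * (1000 * (l * ε) + δ ^ 2 / 2) := by unfold hs; ring
    rw [this]; gcongr; linarith
  have hp := H.tilt_prob T
  have hpm := H.map_prob T
  set a := l / 5 with ha
  have a0 : 0 < a := by positivity
  have w := (H.toBE T).window (by linarith) a0
  have k := H.low1 T hx (measurableSet_Icc (a := -a) (b := a + 40 / a)) (A := 52 / 100) (by norm_num) (fun y hy => by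
      have := hy.1
      linarith) (by nlinarith) (Or.inl lp)
  set μM := (tilt P F n X l (1 / 2)).map (psum (xi P F X l) n) with hμ
  have m1 : 1 / 10 ^ 16 ≤ μM.real (Icc (-a) (a + 40 / a)) := by
    rw [hμ, map_measureReal_apply (H.MM_meas l) measurableSet_Icc]
    refine le_trans ?_ w
    rw [div_le_div_iff₀ (by norm_num) (by positivity)]
    have : 2 / 10000000 ≤ a := by rw [ha]; linarith
    nlinarith
  set U := -l * (a + 40 / a) with hU
  have eU : U = -(l ^ 2 / 5) - 200 := by
    rw [hU, ha]; field_simp; ring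
  have m2 : Real.exp U * (1 / 10 ^ 16) ≤ ∫ y, (Icc (-a) (a + 40 / a)).indicator (fun y => Real.exp (-l * y)) y ∂μM := by
    calc Real.exp U * (1 / 10 ^ 16) ≤ Real.exp U * μM.real (Icc (-a) (a + 40 / a)) := by gcongr
      _ = ∫ y, (Icc (-a) (a + 40 / a)).indicator (fun y => Real.exp U) y ∂μM := by
          rw [integral_indicator measurableSet_Icc, setIntegral_const, smul_eq_mul, mul_comm]
      _ ≤ _ := by
          refine integral_mono ?_ ?_ fun y => ?_
          · exact (integrable_const _).indicator measurableSet_Icc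
          · refine int_bdd' ((by fun_prop : Measurable fun y : ℝ => Real.exp (-l * y)).indicator measurableSet_Icc) (Real.exp (l * a)) fun y => ?_
            by_cases h : y ∈ Icc (-a) (a + 40 / a)
            · rw [indicator_of_mem h, abs_of_pos (Real.exp_pos _)]
              apply Real.exp_le_exp.2; nlinarith [h.1]
            · rw [indicator_of_notMem h, abs_zero]; positivity
          · by_cases h : y ∈ Icc (-a) (a + 40 / a)
            · rw [indicator_of_mem h, indicator_of_mem h]
              apply Real.exp_le_exp.2; rw [hU]; nlinarith [h.2]
            · rw [indicator_of_notMem h, indicator_of_notMem h]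
  have m3 : Real.exp (-60) ≤ 1 / 10 ^ 16 := by
    have h := Real.exp_one_gt_d9
    have h5 : (2:ℝ) ^ 60 ≤ Real.exp 1 ^ 60 := pow_le_pow_left₀ (by norm_num) (by linarith) 60
    rw [← Real.exp_nat_mul] at h5
    rw [Real.exp_neg, inv_le_comm₀ (Real.exp_pos _) (by norm_num)]
    norm_num at h5 ⊢; linarith
  have m4 : 600 * l ^ 3 * ε ≤ l ^ 2 / 10 := by
    have : 600 * l ^ 3 * ε = 600 * l ^ 2 * (l * ε) := by ring
    rw [this]; nlinarith [sq_nonneg l]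
  have m5 : l * hs ε δ l ≤ l ^ 2 / 10 := by
    have := mul_le_mul_of_nonneg_left hh lp.le
    nlinarith [sq_nonneg l]
  calc Real.exp (-(300 * (1 + x ^ 2))) ≤ Real.exp (-(600 * l ^ 3 * ε) - (l ^ 2 / 2 + l * hs ε δ l) + (U + -60)) := by
        apply Real.exp_le_exp.2; rw [eU]; nlinarith [sq_nonneg x]
    _ = Real.exp (-(600 * l ^ 3 * ε) - (l ^ 2 / 2 + l * hs ε δ l)) * (Real.exp U * Real.exp (-60)) := by
        rw [Real.exp_add, Real.exp_add]
    _ ≤ Real.exp (-(600 * l ^ 3 * ε) - (l ^ 2 / 2 + l * hs ε δ l)) * (Real.exp U * (1 / 10 ^ 16)) := by gcongr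
    _ ≤ _ := (mul_le_mul_of_nonneg_left m2 (Real.exp_pos _).le).trans k

/-- when the Berry-Esseen scale is not small, the error term is huge -/
lemma R_big (H : NM P F n X s b γ ε δ) (hx : 0 ≤ x) (hxγ : x * γ ≤ 1 / 10 ^ 24)
    (hD : 1 / 20 ≤ DD γ δ (2 * x)) : 1 + x ^ 2 ≤ 10 ^ 24 * RR x γ ε δ := by
  obtain ⟨r1, r2, r3, r4, r5, -, r0, r7⟩ := RR_facts hx H.γ0 H.ε0 H.δ0
  set R := RR x γ ε δ with hR
  have hγ := H.γ0; have hδ := H.δ0; have hδ1 := H.δ1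
  unfold DD at hD
  have g0 : 0 ≤ γ * |Real.log γ| := by positivity
  have p1 : 0 ≤ x * (γ * |Real.log γ|) := by positivity
  have p2 : 0 ≤ x * (x * γ) := by positivity
  have p3 : 0 ≤ x ^ 3 * ε := by have := H.ε0; positivity
  by_cases c : 1 / 10 ^ 12 ≤ δ
  · have h1 : 1 / 10 ^ 24 ≤ δ ^ 2 := by
      have := pow_le_pow_left₀ (by norm_num) c 2
      norm_num at this ⊢; exact this
    have h2 : x ^ 2 * (1 / 10 ^ 24) ≤ x ^ 2 * δ ^ 2 := by gcongr
    have h3 : 0 ≤ x * δ := by positivity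
    have h4 : 0 ≤ x * γ := by positivity
    linarith
  · push Not at c
    have h1 : 2 / 10 ^ 12 ≤ γ * |Real.log γ| := by linarith
    have h2 : γ * |Real.log γ| ≤ 2 * Real.sqrt γ := by
      have hs := Real.sqrt_pos.2 hγ
      have hsq := Real.mul_self_sqrt hγ.le
      have e : |Real.log γ| = 2 * Real.log (Real.sqrt γ)⁻¹ := by
        rw [Real.log_inv, Real.log_sqrt hγ.le, abs_of_neg (Real.log_neg hγ (by linarith [H.γ1]))]; ring
      have h3 := Real.log_le_sub_one_of_pos (inv_pos.2 hs)
      have h4 : |Real.log γ| ≤ 2 * (Real.sqrt γ)⁻¹ := by rw [e]; linarith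
      calc γ * |Real.log γ| ≤ γ * (2 * (Real.sqrt γ)⁻¹) := by gcongr
        _ = Real.sqrt γ * Real.sqrt γ * (2 * (Real.sqrt γ)⁻¹) := by rw [hsq]
        _ = _ := by field_simp
    have h3 : 1 / 10 ^ 12 ≤ Real.sqrt γ := by linarith
    have h4 : 1 / 10 ^ 24 ≤ γ := by
      have e := Real.sq_sqrt hγ.le
      have := pow_le_pow_left₀ (by norm_num) h3 2
      rw [e] at this
      norm_num at this ⊢; exact this
    have h5 : x ≤ 1 := by
      by_contra hc
      push Not at hc
      have := mul_lt_mul_of_pos_right hc hγ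
      linarith
    have h6 : 0 ≤ x * δ := by positivity
    have h7 : 0 ≤ x ^ 2 * δ ^ 2 := by positivity
    have h8 : 0 ≤ x * γ := by positivity
    have h9 : x ^ 2 ≤ 1 := pow_le_one₀ hx h5
    linarith

/-- the lower bound -/
lemma low (H : NM P F n X s b γ ε δ) (hx : 0 ≤ x) (hxγ : x * γ ≤ 1 / 10 ^ 24) :
    Real.exp (-(10 ^ 27 * RR x γ ε δ)) * (1 - stdNormalCDF x) ≤ P.real (WE X n x) := by
  have r0 : 0 < RR x γ ε δ := (RR_facts hx H.γ0 H.ε0 H.δ0).2.2.2.2.2.2.1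
  by_cases c : DD γ δ (x * (1 + 4 * (2000 * x * ε + δ ^ 2 / 2))) ≤ 1 / 20
  · refine le_trans ?_ (H.low_a hx (by linarith) c)
    refine mul_le_mul_of_nonneg_right (Real.exp_le_exp.2 ?_) (tail_pos x).le
    linarith
  · push Not at c
    have hb := H.low_b hx (by linarith)
    have hD : 1 / 20 ≤ DD γ δ (2 * x) := by
      refine c.le.trans ?_
      have hγ := H.γ0
      have hδ2 : δ ^ 2 ≤ 1 / 16 := by nlinarith [H.δ0, H.δ1]
      have hxe : x * ε ≤ 2 * (x * γ) := by nlinarith [H.εγ]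
      unfold DD
      have : x * (1 + 4 * (2000 * x * ε + δ ^ 2 / 2)) ≤ 2 * x := by
        have : 1 + 4 * (2000 * x * ε + δ ^ 2 / 2) ≤ 2 := by linarith
        nlinarith
      have := mul_le_mul_of_nonneg_right this hγ.le
      linarith
    have h1 := H.R_big hx hxγ hD
    have h2 : 1 - stdNormalCDF x ≤ 1 := by linarith [Phi_nonneg x]
    calc _ ≤ Real.exp (-(10 ^ 27 * RR x γ ε δ)) * 1 := by gcongr
      _ ≤ _ := by
        rw [mul_one]
        refine le_trans (Real.exp_le_exp.2 ?_) hb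
        linarith

end NM
end Cram


namespace Cram
open ProbabilityTheory Set

lemma WE_le {Ω : Type} {X : ℕ → Ω → ℝ} {n : ℕ} {x : ℝ} {ω : Ω} (h : ω ∈ WE X n x) :
    x * Real.sqrt (QQ X n ω) ≤ psum X n ω := by
  have h' : x ≤ psum X n ω / Real.sqrt (QQ X n ω) := h
  rcases (QQ_nonneg X n ω).eq_or_lt with e | e
  · rw [QQ_zero X n ω e.symm, ← e]; simp
  · rwa [le_div_iff₀ (Real.sqrt_pos.2 e)] at h'

lemma exp_tail_le (x : ℝ) (hx : 0 ≤ x) : Real.exp (-(x ^ 2) / 2) ≤ 15 * (1 + x) * (1 - stdNormalCDF x) := by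
  have h := tail_ge x hx
  rw [div_le_iff₀ (by positivity)] at h
  linarith

namespace NM
variable {Ω : Type} [mΩ : MeasurableSpace Ω] {P : Measure Ω} [IsProbabilityMeasure P]
  {F : ℕ → MeasurableSpace Ω} {n : ℕ} {X s b : ℕ → Ω → ℝ} {γ ε δ l θ x : ℝ}

/-- crude tilting bound -/
lemma up1 (H : NM P F n X s b γ ε δ) (T : TP l θ γ) {E : Set Ω} (hE : MeasurableSet E) {B : ℝ}
    (hB : ∀ ω ∈ E, -(l * psum X n ω - θ * l ^ 2 * QQ X n ω) ≤ B) :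
    P.real E ≤ Real.exp ((1 / 2 - θ) * l ^ 2 + |1 / 2 - θ| * l ^ 2 * δ ^ 2 + 300 * l ^ 3 * ε + B) *
      (tilt P F n X l θ).real E := by
  have hp := H.tilt_prob T
  have k := H.com_up hE (H.prod_up T) (g := fun _ => Real.exp B) ((integrable_const _).indicator hE)
    (Eventually.of_forall fun ω hω => Real.exp_le_exp.2 (hB ω hω))
  rw [integral_indicator hE, setIntegral_const, smul_eq_mul] at k
  rw [Real.exp_add]
  linarith

/-- tilting bound on a deviation event of `Q` -/
lemma up2 (H : NM P F n X s b γ ε δ) (T : TP l θ γ) (hx : 0 ≤ x) (lx : l ≤ x) {E : Set Ω} (hE : MeasurableSet E)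
    {t : ℝ} (ht : 0 < t) (hQ : ∀ ω ∈ E, t + 320 * l * ε + δ ^ 2 ≤ |QQ X n ω - 1|) (hW : E ⊆ WE X n x)
    (hr : ∀ ω ∈ E, (1 / 2 - θ) * l ^ 2 - l * x * Real.sqrt (QQ X n ω) + θ * l ^ 2 * Real.sqrt (QQ X n ω) ^ 2 ≤ -(x ^ 2) / 2) :
    P.real E ≤ Real.exp (301 * RR x γ ε δ) * (525 * ((1 + x) * ε) / (t * Real.sqrt t)) * (1 - stdNormalCDF x) := by
  have hp := H.tilt_prob T
  obtain ⟨r1, r2, r3, r4, r5, -, r0, r7⟩ := RR_facts hx H.γ0 H.ε0 H.δ0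
  have hε := H.ε0
  have l0 := T.l0
  have k := H.up1 T hE (B := -(x ^ 2) / 2 - (1 / 2 - θ) * l ^ 2) fun ω hω => by
    have h1 := WE_le (hW hω)
    have h2 := hr ω hω
    rw [Real.sq_sqrt (QQ_nonneg X n ω)] at h2
    have h3 := mul_le_mul_of_nonneg_left h1 l0
    linarith
  have m : (tilt P F n X l θ).real E ≤ 35 * ε / (t * Real.sqrt t) :=
    (measureReal_mono (fun ω hω => hQ ω hω)).trans (H.Qconc T ht)
  have hth : |1 / 2 - θ| ≤ 1 := by rw [abs_le]; constructor <;> linarith [T.θ1, T.θ2]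
  have e1 : |1 / 2 - θ| * l ^ 2 * δ ^ 2 ≤ x ^ 2 * δ ^ 2 := by
    have h1 : l ^ 2 ≤ x ^ 2 := pow_le_pow_left₀ l0 lx 2
    calc |1 / 2 - θ| * l ^ 2 * δ ^ 2 ≤ 1 * x ^ 2 * δ ^ 2 := by gcongr
      _ = _ := by ring
  have e2 : l ^ 3 * ε ≤ x ^ 3 * ε := by gcongr
  have st : 0 < t * Real.sqrt t := mul_pos ht (Real.sqrt_pos.2 ht)
  calc P.real E ≤ _ := k
    _ ≤ Real.exp (301 * RR x γ ε δ + -(x ^ 2) / 2) * (35 * ε / (t * Real.sqrt t)) := by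
        refine mul_le_mul (Real.exp_le_exp.2 ?_) m measureReal_nonneg (Real.exp_pos _).le
        linarith
    _ = Real.exp (301 * RR x γ ε δ) * (35 * ε / (t * Real.sqrt t)) * Real.exp (-(x ^ 2) / 2) := by rw [Real.exp_add]; ring
    _ ≤ Real.exp (301 * RR x γ ε δ) * (35 * ε / (t * Real.sqrt t)) * (15 * (1 + x) * (1 - stdNormalCDF x)) := by
        refine mul_le_mul_of_nonneg_left (exp_tail_le x hx) (by positivity)
    _ = _ := by ring

/-- the main part -/
lemma up3 (H : NM P F n X s b γ ε δ) (hx : 0 ≤ x) (hxγ : x * γ ≤ 1 / 1000) {τ : ℝ} :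
    P.real {ω | x / 2 - x * τ ^ 2 / 2 ≤ psum X n ω - x * QQ X n ω / 2} ≤
      Real.exp (300 * x ^ 3 * ε + x * hs ε δ x + 15 * (1 + x) * (hs ε δ x + x * τ ^ 2 / 2)) *
        (1 + 30 * ((1 + x) * DD γ δ x)) * (1 - stdNormalCDF x) := by
  have T : TP x (1 / 2) γ := ⟨hx, hxγ, by norm_num, by norm_num⟩
  have hp := H.tilt_prob T
  have hpm := H.map_prob T
  have hε := H.ε0; have hγ := H.γ0; have hδ := H.δ0
  set M := psum (xi P F X x) n with hM
  have mM : Measurable M := H.MM_meas x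
  set h := hs ε δ x with hh
  have h0 : 0 ≤ h := by rw [hh]; unfold hs; positivity
  set h1 := h + x * τ ^ 2 / 2 with hh1
  have h10 : 0 ≤ h1 := by positivity
  set D := DD γ δ x with hD
  have D0 : 0 ≤ D := by rw [hD]; unfold DD; positivity
  have mE : MeasurableSet (M ⁻¹' (Ici (-h1))) := measurableSet_Ici.preimage mM
  have s1 : P.real {ω | x / 2 - x * τ ^ 2 / 2 ≤ psum X n ω - x * QQ X n ω / 2 } ≤
      P.real ({ω | x / 2 - x * τ ^ 2 / 2 ≤ psum X n ω - x * QQ X n ω / 2} ∩ M ⁻¹' (Ici (-h1))) := by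
    refine ENNReal.toReal_mono (measure_ne_top _ _) (measure_mono_ae ?_)
    filter_upwards [H.Z_ae T] with ω hz hω
    refine ⟨hω, ?_⟩
    have hω' : x / 2 - x * τ ^ 2 / 2 ≤ psum X n ω - x * QQ X n ω / 2 := hω
    obtain ⟨z1, z2⟩ := abs_le.1 hz
    change -h1 ≤ M ω
    rw [hh1]; linarith
  have s1' : P.real ({ω | x / 2 - x * τ ^ 2 / 2 ≤ psum X n ω - x * QQ X n ω / 2} ∩ M ⁻¹' (Ici (-h1))) ≤ P.real (M ⁻¹' (Ici (-h1))) :=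
    measureReal_mono inter_subset_right
  have mg : Measurable ((Ici (-h1)).indicator (fun y => Real.exp (-x * y))) := (by fun_prop : Measurable fun y : ℝ => Real.exp (-x * y)).indicator measurableSet_Ici
  have pr := H.prod_up T
  have k := H.com_up mE pr (g := fun ω => Real.exp (-(x ^ 2) / 2 + x * h) * Real.exp (-x * M ω)) ?_ ?_
  · have e : ∫ ω, (M ⁻¹' (Ici (-h1))).indicator (fun ω => Real.exp (-(x ^ 2) / 2 + x * h) * Real.exp (-x * M ω)) ω ∂(tilt P F n X x (1 / 2))
      = Real.exp (-(x ^ 2) / 2 + x * h) * ∫ y, (Ici (-h1)).indicator (fun y => Real.exp (-x * y)) y ∂((tilt P F n X x (1 / 2)).map M) := by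
      rw [integral_map mM.aemeasurable mg.aestronglyMeasurable, ← integral_const_mul]
      refine integral_congr_ae (Eventually.of_forall fun ω => ?_)
      by_cases h : M ω ∈ Ici (-h1)
      · simp only [indicator_of_mem h, indicator_of_mem (show ω ∈ M ⁻¹' (Ici (-h1)) from h)]
      · simp only [indicator_of_notMem h, indicator_of_notMem (show ω ∉ M ⁻¹' (Ici (-h1)) from h), mul_zero]
    rw [e] at k
    have u := exptail_upper _ D (H.map_D T) x (-h1) hx
    have ts := tail_shift x (x + -h1) x hx (by linarith) le_rfl
    have et := exp_tail_le x hx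
    have e3 : -x * -h1 ≤ 15 * (1 + x) * h1 := by nlinarith [mul_nonneg hx h10]
    have e4 : 15 * (1 + x) * (x - (x + -h1)) = 15 * (1 + x) * h1 := by ring
    rw [e4] at ts
    have tp := (tail_pos x).le
    set G := Real.exp (15 * (1 + x) * h1) with hG
    have u2 : Real.exp (-(x ^ 2) / 2) * (Real.exp (x ^ 2 / 2) * (1 - stdNormalCDF (x + -h1)) + 2 * D * Real.exp (-x * -h1)) ≤
        G * (1 + 30 * ((1 + x) * D)) * (1 - stdNormalCDF x) := by
      have a1 : Real.exp (-(x ^ 2) / 2) * Real.exp (x ^ 2 / 2) = 1 := by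
        rw [← Real.exp_add, Real.exp_eq_one_iff]; ring
      have a2 : Real.exp (-(x ^ 2) / 2) * (2 * D * Real.exp (-x * -h1)) ≤ (15 * (1 + x) * (1 - stdNormalCDF x)) * (2 * D * G) := by
        refine mul_le_mul et ?_ (by positivity) (by positivity)
        exact mul_le_mul_of_nonneg_left (Real.exp_le_exp.2 e3) (by positivity)
      calc _ = (Real.exp (-(x ^ 2) / 2) * Real.exp (x ^ 2 / 2)) * (1 - stdNormalCDF (x + -h1)) + Real.exp (-(x ^ 2) / 2) * (2 * D * Real.exp (-x * -h1)) := by ring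
        _ ≤ (1 - stdNormalCDF x) * G + (15 * (1 + x) * (1 - stdNormalCDF x)) * (2 * D * G) := by rw [a1, one_mul]; linarith
        _ = _ := by ring
    refine (s1.trans s1').trans (k.trans ?_)
    calc _ ≤ Real.exp ((1 / 2 - 1 / 2) * x ^ 2 + |(1:ℝ) / 2 - 1 / 2| * x ^ 2 * δ ^ 2 + 300 * x ^ 3 * ε) *
          (Real.exp (-(x ^ 2) / 2 + x * h) * (Real.exp (x ^ 2 / 2) * (1 - stdNormalCDF (x + -h1)) + 2 * D * Real.exp (-x * -h1))) := by
            gcongr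
      _ = Real.exp (300 * x ^ 3 * ε + x * h) * (Real.exp (-(x ^ 2) / 2) * (Real.exp (x ^ 2 / 2) * (1 - stdNormalCDF (x + -h1)) + 2 * D * Real.exp (-x * -h1))) := by
            rw [sub_self, abs_zero, zero_mul, zero_mul, zero_add, zero_add, Real.exp_add (-(x ^ 2) / 2), Real.exp_add (300 * x ^ 3 * ε)]; ring
      _ ≤ Real.exp (300 * x ^ 3 * ε + x * h) * (G * (1 + 30 * ((1 + x) * D)) * (1 - stdNormalCDF x)) := by gcongr
      _ = _ := by rw [Real.exp_add (300 * x ^ 3 * ε + x * h)]; ring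
  · refine int_bdd' ?_ (Real.exp (-(x ^ 2) / 2 + x * h) * Real.exp (x * h1)) fun ω => ?_
    · exact (by fun_prop : Measurable fun ω => Real.exp (-(x ^ 2) / 2 + x * h) * Real.exp (-x * M ω)).indicator mE
    · by_cases h : M ω ∈ Ici (-h1)
      · rw [indicator_of_mem (show ω ∈ M ⁻¹' (Ici (-h1)) from h), abs_of_pos (by positivity)]
        refine mul_le_mul_of_nonneg_left (Real.exp_le_exp.2 ?_) (Real.exp_pos _).le
        have h' : -h1 ≤ M ω := h
        have := mul_le_mul_of_nonneg_left h' hx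
        linarith
      · rw [indicator_of_notMem (show ω ∉ M ⁻¹' (Ici (-h1)) from h), abs_zero]; positivity
  · filter_upwards [H.Z_ae T] with ω hz hω
    rw [← Real.exp_add, Real.exp_le_exp]
    obtain ⟨z1, z2⟩ := abs_le.1 hz
    have := mul_le_mul_of_nonneg_left z1 hx
    linarith

end NM
end Cram


namespace Cram
open ProbabilityTheory Set

lemma V_facts {x γ ε δ : ℝ} (hx : 0 ≤ x) (hγ : 0 < γ) (hε : 0 < ε) (hδ : 0 ≤ δ) :
    ∃ V : ℝ, 0 < V ∧ V ^ 4 = (1 + x) * ε ∧ V ≤ 2 * RR x γ ε δ := by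
  obtain ⟨-, -, -, -, -, r6, -, -⟩ := RR_facts hx hγ hε hδ
  have h1x : 0 < 1 + x := by linarith
  refine ⟨((1 + x) * ε) ^ ((1:ℝ) / 4), by positivity, ?_, ?_⟩
  · rw [← Real.rpow_natCast, ← Real.rpow_mul (by positivity)]; norm_num
  · have e1 : ((1 + x) * ε) ^ ((1:ℝ) / 4) = (1 + x) ^ ((1:ℝ) / 4) * ε ^ ((1:ℝ) / 4) := Real.mul_rpow h1x.le hε.le
    have e2 : 1 + x ^ ((3:ℝ) / 4) ≤ 2 * (1 + x) ^ ((3:ℝ) / 4) := by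
      have a1 : 1 ≤ (1 + x) ^ ((3:ℝ) / 4) := Real.one_le_rpow (by linarith) (by norm_num)
      have a2 : x ^ ((3:ℝ) / 4) ≤ (1 + x) ^ ((3:ℝ) / 4) := Real.rpow_le_rpow hx (by linarith) (by norm_num)
      linarith
    have e3 : (1 + x) ^ ((1:ℝ) / 4) * (1 + x) ^ ((3:ℝ) / 4) = 1 + x := by
      rw [← Real.rpow_add h1x]; norm_num
    have p : 0 < 1 + x ^ ((3:ℝ) / 4) := by positivity
    have e4 : (1 + x) ^ ((1:ℝ) / 4) * ε ^ ((1:ℝ) / 4) ≤ 2 * ((1 + x) * (ε ^ ((1 : ℝ) / 4) / (1 + x ^ ((3 : ℝ) / 4)))) := by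
      rw [← mul_div_assoc, ← mul_div_assoc, le_div_iff₀ p]
      calc (1 + x) ^ ((1:ℝ) / 4) * ε ^ ((1:ℝ) / 4) * (1 + x ^ ((3:ℝ) / 4)) ≤ (1 + x) ^ ((1:ℝ) / 4) * ε ^ ((1:ℝ) / 4) * (2 * (1 + x) ^ ((3:ℝ) / 4)) := by gcongr
        _ = 2 * (((1 + x) ^ ((1:ℝ) / 4) * (1 + x) ^ ((3:ℝ) / 4)) * ε ^ ((1:ℝ) / 4)) := by ring
        _ = _ := by rw [e3]
    rw [e1]; linarith

namespace NM
variable {Ω : Type} [mΩ : MeasurableSpace Ω] {P : Measure Ω} [IsProbabilityMeasure P]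
  {F : ℕ → MeasurableSpace Ω} {n : ℕ} {X s b : ℕ → Ω → ℝ} {γ ε δ l θ x : ℝ}

/-- moderate values of `Q` away from one -/
lemma up_b (H : NM P F n X s b γ ε δ) (hx : 0 ≤ x) (hxγ : x * γ ≤ 1 / 1000) {t : ℝ} (ht : 0 < t) :
    P.real {ω | ω ∈ WE X n x ∧ t + 320 * x * ε + δ ^ 2 ≤ |QQ X n ω - 1| ∧ 1 ≤ QQ X n ω ∧ QQ X n ω ≤ 9} ≤
      Real.exp (301 * RR x γ ε δ) * (525 * ((1 + x) * ε) / (t * Real.sqrt t)) * (1 - stdNormalCDF x) := by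
  have mQ := H.QQ_meas
  have mW : MeasurableSet (WE X n x) := H.WE_meas x
  refine H.up2 (l := x) (θ := 1 / 4) ⟨hx, hxγ, le_rfl, by norm_num⟩ hx le_rfl ?_ ht (fun ω hω => hω.2.1) (fun ω hω => hω.1) fun ω hω => ?_
  · have m1 : MeasurableSet {ω | t + 320 * x * ε + δ ^ 2 ≤ |QQ X n ω - 1|} :=
      measurableSet_le measurable_const (continuous_abs.measurable.comp (mQ.sub_const 1))
    have m2 : MeasurableSet {ω | 1 ≤ QQ X n ω} := measurableSet_le measurable_const mQ
    have m3 : MeasurableSet {ω | QQ X n ω ≤ 9} := measurableSet_le mQ measurable_const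
    exact mW.inter (m1.inter (m2.inter m3))
  · have h1 : 1 ≤ Real.sqrt (QQ X n ω) := Real.one_le_sqrt.2 hω.2.2.1
    have h2 : Real.sqrt (QQ X n ω) ≤ 3 := Real.sqrt_le_iff.2 ⟨by norm_num, by linarith [hω.2.2.2]⟩
    set r := Real.sqrt (QQ X n ω)
    have : x ^ 2 * ((r - 1) * (r - 3)) ≤ 0 := mul_nonpos_of_nonneg_of_nonpos (sq_nonneg x) (mul_nonpos_of_nonneg_of_nonpos (by linarith) (by linarith))
    linarith

lemma up_c (H : NM P F n X s b γ ε δ) (hx : 0 ≤ x) (hxγ : x * γ ≤ 1 / 1000) {t : ℝ} (ht : 0 < t) :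
    P.real {ω | ω ∈ WE X n x ∧ t + 320 * x * ε + δ ^ 2 ≤ |QQ X n ω - 1| ∧ QQ X n ω ≤ 1} ≤
      Real.exp (301 * RR x γ ε δ) * (525 * ((1 + x) * ε) / (t * Real.sqrt t)) * (1 - stdNormalCDF x) := by
  have mQ := H.QQ_meas
  have mW : MeasurableSet (WE X n x) := H.WE_meas x
  refine H.up2 (l := x) (θ := 3 / 2) ⟨hx, hxγ, by norm_num, le_rfl⟩ hx le_rfl ?_ ht (fun ω hω => hω.2.1) (fun ω hω => hω.1) fun ω hω => ?_
  · have m1 : MeasurableSet {ω | t + 320 * x * ε + δ ^ 2 ≤ |QQ X n ω - 1|} :=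
      measurableSet_le measurable_const (continuous_abs.measurable.comp (mQ.sub_const 1))
    have m3 : MeasurableSet {ω | QQ X n ω ≤ 1} := measurableSet_le mQ measurable_const
    exact mW.inter (m1.inter m3)
  · have h2 : Real.sqrt (QQ X n ω) ≤ 1 := Real.sqrt_le_one.2 hω.2.2
    have h1 := Real.sqrt_nonneg (QQ X n ω)
    set r := Real.sqrt (QQ X n ω)
    have : x ^ 2 * ((3 * r + 1) * (r - 1)) ≤ 0 := mul_nonpos_of_nonneg_of_nonpos (sq_nonneg x) (mul_nonpos_of_nonneg_of_nonpos (by linarith) (by linarith))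
    linarith

/-- large values of `Q` -/
lemma up_d (H : NM P F n X s b γ ε δ) (hx : 0 ≤ x) (hxγ : x * γ ≤ 1 / 1000) (k : ℕ) :
    P.real {ω | ω ∈ WE X n x ∧ (4:ℝ) ^ (k + 1) ≤ QQ X n ω ∧ QQ X n ω ≤ 9 * 4 ^ (k + 1)} ≤
      Real.exp (301 * RR x γ ε δ) * (525 * ((1 + x) * ε)) * (1 - stdNormalCDF x) * (1 / 2) ^ k := by
  have mQ := H.QQ_meas
  have mW : MeasurableSet (WE X n x) := H.WE_meas x
  have hε := H.ε0; have hγ := H.γ0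
  set u := (1 / 2 : ℝ) ^ (k + 1) with hu
  have u0 : 0 < u := by positivity
  have u1 : u ≤ 1 / 2 := by
    rw [hu, pow_succ]
    have : (1 / 2 : ℝ) ^ k ≤ 1 := pow_le_one₀ (by norm_num) (by norm_num)
    linarith
  have lx : u * x ≤ x := by nlinarith
  have hxe : x * ε ≤ 2 * (x * γ) := by nlinarith [H.εγ]
  have p4 : (1:ℝ) ≤ 4 ^ k := one_le_pow₀ (by norm_num)
  have hδ2 : δ ^ 2 ≤ 1 / 16 := by nlinarith [H.δ0, H.δ1]
  have key := H.up2 (l := u * x) (θ := 1 / 4) ⟨by positivity, by nlinarith, le_rfl, by norm_num⟩ hx lx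
    (E := {ω | ω ∈ WE X n x ∧ (4:ℝ) ^ (k + 1) ≤ QQ X n ω ∧ QQ X n ω ≤ 9 * 4 ^ (k + 1)}) (t := 4 ^ k)
    (mW.inter ((measurableSet_le measurable_const mQ).inter (measurableSet_le mQ measurable_const)))
    (by positivity) ?_ (fun ω hω => hω.1) ?_
  · refine key.trans ?_
    have e : (1:ℝ) / (4 ^ k * Real.sqrt (4 ^ k)) ≤ (1 / 2) ^ k := by
      have e1 : Real.sqrt ((4:ℝ) ^ k) = 2 ^ k := by
        rw [show (4:ℝ) = 2 ^ 2 by norm_num, ← pow_mul, mul_comm 2 k, pow_mul, Real.sqrt_sq (by positivity)]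
      rw [e1, one_div_pow, ]
      apply one_div_le_one_div_of_le (by positivity)
      nlinarith [show (0:ℝ) < 2 ^ k by positivity]
    have tp := (tail_pos x).le
    have h1x : 0 ≤ 1 + x := by linarith
    calc _ = Real.exp (301 * RR x γ ε δ) * (525 * ((1 + x) * ε)) * (1 - stdNormalCDF x) * (1 / (4 ^ k * Real.sqrt (4 ^ k))) := by ring
      _ ≤ _ := mul_le_mul_of_nonneg_left e (by positivity)
  · intro ω hω
    have h1 := hω.2.1
    rw [pow_succ] at h1
    rw [abs_of_nonneg (by linarith)]
    have h2 : u * x * ε ≤ x * ε := by gcongr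
    linarith
  · intro ω hω
    have e4 : (4:ℝ) ^ (k + 1) * u ^ 2 = 1 := by
      rw [hu, ← pow_mul, mul_comm (k + 1) 2, pow_mul, ← mul_pow]; norm_num
    have h1 : 1 ≤ u * Real.sqrt (QQ X n ω) := by
      rw [← Real.sqrt_sq u0.le, ← Real.sqrt_mul (sq_nonneg u)]
      apply Real.one_le_sqrt.2
      have := mul_le_mul_of_nonneg_left hω.2.1 (sq_nonneg u)
      linarith
    have h2 : u * Real.sqrt (QQ X n ω) ≤ 3 := by
      rw [← Real.sqrt_sq u0.le, ← Real.sqrt_mul (sq_nonneg u)]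
      apply Real.sqrt_le_iff.2 ⟨by norm_num, ?_⟩
      have := mul_le_mul_of_nonneg_left hω.2.2 (sq_nonneg u)
      linarith
    set w := u * Real.sqrt (QQ X n ω) with hw
    have e1 : (1 / 2 - 1 / 4) * (u * x) ^ 2 - u * x * x * Real.sqrt (QQ X n ω) + 1 / 4 * (u * x) ^ 2 * Real.sqrt (QQ X n ω) ^ 2
       = x ^ 2 * (u ^ 2 / 4 - w + w ^ 2 / 4) := by rw [hw]; ring
    rw [e1]
    have h3 : (w - 1) * (w - 3) ≤ 0 := mul_nonpos_of_nonneg_of_nonpos (by linarith) (by linarith)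
    have h4 : u ^ 2 ≤ 1 / 4 := by nlinarith
    have h5 : u ^ 2 / 4 - w + w ^ 2 / 4 ≤ - 1 / 2 := by linarith
    have := mul_le_mul_of_nonneg_left h5 (sq_nonneg x)
    linarith

lemma up_d' (H : NM P F n X s b γ ε δ) (hx : 0 ≤ x) (hxγ : x * γ ≤ 1 / 1000) :
    P.real (⋃ k : ℕ, {ω | ω ∈ WE X n x ∧ (4:ℝ) ^ (k + 1) ≤ QQ X n ω ∧ QQ X n ω ≤ 9 * 4 ^ (k + 1)}) ≤
      Real.exp (301 * RR x γ ε δ) * (525 * ((1 + x) * ε)) * (1 - stdNormalCDF x) * 2 := by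
  have tp := (tail_pos x).le
  have h1x : 0 ≤ 1 + x := by linarith
  have hε := H.ε0
  set C := Real.exp (301 * RR x γ ε δ) * (525 * ((1 + x) * ε)) * (1 - stdNormalCDF x) with hC
  have C0 : 0 ≤ C := by positivity
  have sg : Summable fun k : ℕ => C * (1 / 2 : ℝ) ^ k := (summable_geometric_of_lt_one (by norm_num) (by norm_num)).mul_left C
  refine ENNReal.toReal_le_of_le_ofReal (by positivity) ?_
  refine (measure_iUnion_le _).trans ?_
  calc _ ≤ ∑' k : ℕ, ENNReal.ofReal (C * (1 / 2 : ℝ) ^ k) := by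
        refine ENNReal.tsum_le_tsum fun k => ?_
        exact (ENNReal.le_ofReal_iff_toReal_le (measure_ne_top _ _) (by positivity)).2 (H.up_d hx hxγ k)
    _ = ENNReal.ofReal (∑' k : ℕ, C * (1 / 2 : ℝ) ^ k) := (ENNReal.ofReal_tsum_of_nonneg (fun k => by positivity) sg).symm
    _ = ENNReal.ofReal (C * 2) := by rw [tsum_mul_left, tsum_geometric_two]

/-- the upper bound -/
lemma up (H : NM P F n X s b γ ε δ) (hx : 0 ≤ x) (hxγ : x * γ ≤ 1 / 10000) :
    P.real (WE X n x) ≤ Real.exp (10 ^ 12 * RR x γ ε δ) * (1 - stdNormalCDF x) := by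
  have hγ := H.γ0; have hε := H.ε0; have hδ := H.δ0; have hεγ := H.εγ; have hδ1 := H.δ1; have hγ1 := H.γ1; have hε1 := H.ε1
  obtain ⟨r1, r2, r3, r4, r5, -, r0, r7⟩ := RR_facts hx H.γ0 H.ε0 H.δ0
  obtain ⟨V, V0, V4, VR⟩ := V_facts hx H.γ0 H.ε0 H.δ0
  set R := RR x γ ε δ with hR
  have tp := (tail_pos x).le
  have xe : x * ε ≤ 2 * (x * γ) := by nlinarith
  have hδ2 : δ ^ 2 ≤ 1 / 16 := by nlinarith
  have xg0 : 0 ≤ x * γ := by positivity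
  have V1 : V ≤ 1 := by
    by_contra hc
    push Not at hc
    have := one_lt_pow₀ hc (n := 4) (by norm_num)
    linarith
  have V4le : V ^ 4 ≤ V := by
    calc V ^ 4 ≤ V ^ 1 := pow_le_pow_of_le_one V0.le V1 (by norm_num)
      _ = V := pow_one V
  set τ := V ^ 2 + 320 * x * ε + δ ^ 2 with hτ
  have hx3 : x * γ ≤ 1 / 1000 := by linarith
  have Vt : 525 * ((1 + x) * ε) / (V ^ 2 * Real.sqrt (V ^ 2)) = 525 * V := by
    rw [Real.sqrt_sq V0.le, ← V4]; field_simp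
  have k1 := H.up3 hx hx3 (τ := τ)
  have k2 := H.up_b hx hx3 (t := V ^ 2) (by positivity)
  have k3 := H.up_c hx hx3 (t := V ^ 2) (by positivity)
  have k4 := H.up_d' hx hx3
  rw [Vt] at k2 k3
  rw [← V4] at k4
  rw [← hR] at k2 k3 k4
  have cov : WE X n x ⊆ ((({ω | x / 2 - x * τ ^ 2 / 2 ≤ psum X n ω - x * QQ X n ω / 2} ∪
      {ω | ω ∈ WE X n x ∧ V ^ 2 + 320 * x * ε + δ ^ 2 ≤ |QQ X n ω - 1| ∧ 1 ≤ QQ X n ω ∧ QQ X n ω ≤ 9}) ∪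
      {ω | ω ∈ WE X n x ∧ V ^ 2 + 320 * x * ε + δ ^ 2 ≤ |QQ X n ω - 1| ∧ QQ X n ω ≤ 1}) ∪
      (⋃ k : ℕ, {ω | ω ∈ WE X n x ∧ (4:ℝ) ^ (k + 1) ≤ QQ X n ω ∧ QQ X n ω ≤ 9 * 4 ^ (k + 1)})) := by
    intro ω hω
    by_cases c1 : V ^ 2 + 320 * x * ε + δ ^ 2 ≤ |QQ X n ω - 1|
    · by_cases c2 : QQ X n ω ≤ 1
      · exact Or.inl (Or.inr ⟨hω, c1, c2⟩)
      · push Not at c2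
        by_cases c3 : QQ X n ω ≤ 9
        · exact Or.inl (Or.inl (Or.inr ⟨hω, c1, c2.le, c3⟩))
        · push Not at c3
          right
          obtain ⟨m, m1, m2⟩ := exists_nat_pow_near c2.le (show (1:ℝ) < 4 by norm_num)
          obtain ⟨k, rfl⟩ : ∃ k, m = k + 1 := by
            refine Nat.exists_eq_succ_of_ne_zero ?_
            rintro rfl
            norm_num at m2; linarith
          refine mem_iUnion.2 ⟨k, hω, m1, ?_⟩
          rw [pow_succ (4:ℝ) (k + 1)] at m2
          have : (0:ℝ) < 4 ^ (k + 1) := by positivity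
          linarith
    · push Not at c1
      left; left; left
      have h1 := WE_le hω
      have q0 := QQ_nonneg X n ω
      have h2 := Real.sqrt_nonneg (QQ X n ω)
      have h3 := Real.sq_sqrt q0
      set r := Real.sqrt (QQ X n ω) with hr
      rw [← h3] at c1
      have h4 : |r - 1| ≤ τ := by
        have : |r ^ 2 - 1| = |r - 1| * (r + 1) := by
          rw [show r ^ 2 - 1 = (r - 1) * (r + 1) by ring, abs_mul, abs_of_nonneg (by linarith : 0 ≤ r + 1)]
        have h5 : |r - 1| * 1 ≤ |r - 1| * (r + 1) := mul_le_mul_of_nonneg_left (by linarith) (abs_nonneg _)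
        rw [hτ]; linarith
      have h5 : (r - 1) ^ 2 ≤ τ ^ 2 := by
        rw [← sq_abs (r - 1)]; exact pow_le_pow_left₀ (abs_nonneg _) h4 2
      change x / 2 - x * τ ^ 2 / 2 ≤ psum X n ω - x * QQ X n ω / 2
      rw [← h3]
      have := mul_le_mul_of_nonneg_left h5 hx
      linarith
  have sum := (measureReal_mono cov (μ := P)).trans ((measureReal_union_le _ _).trans
    (add_le_add ((measureReal_union_le _ _).trans (add_le_add (measureReal_union_le _ _) le_rfl)) le_rfl))
  have x2e : x ^ 2 * ε ≤ 2 * R := by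
    have := mul_le_mul_of_nonneg_left hεγ (sq_nonneg x)
    linarith
  have xd : x * δ ^ 2 ≤ R := by
    have h1 : x * (δ * δ) ≤ x * (δ * 1) := by gcongr; linarith
    have h2 : x * (δ * 1) = x * δ := by ring
    have h3 : x * (δ * δ) = x * δ ^ 2 := by ring
    linarith
  have eR : ε ≤ 2 * R := by
    have h1 : ε ≤ (1 + x) * ε := by nlinarith
    linarith
  -- exponent of the main part
  have A1 : (1 + x) * hs ε δ x ≤ 3001 * R := by
    have : (1 + x) * hs ε δ x = 1000 * (x ^ 2 * ε) + 1000 * (x ^ 3 * ε) + x * δ ^ 2 / 2 + x ^ 2 * δ ^ 2 / 2 := by unfold hs; ring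
    linarith
  have hh0 : 0 ≤ hs ε δ x := by unfold hs; positivity
  have A2 : (1 + x) * (x * τ ^ 2 / 2) ≤ 1100 * R := by
    set w := 320 * x * ε + δ ^ 2 with hw
    have w0 : 0 ≤ w := by positivity
    have w1 : w ≤ 1 := by rw [hw]; linarith
    have t1 : τ ^ 2 ≤ 2 * ((1 + x) * ε) + 2 * w := by
      have : τ = V ^ 2 + w := by rw [hτ, hw]; ring
      have h1 : w * w ≤ w * 1 := mul_le_mul_of_nonneg_left w1 w0
      rw [this, ← V4]
      have h2 := sq_nonneg (V ^ 2 - w)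
      nlinarith only [h1, h2]
    have t2 : (1 + x) * (x * τ ^ 2 / 2) ≤ (1 + x) * (x * (2 * ((1 + x) * ε) + 2 * w) / 2) := by gcongr
    have t3 : (1 + x) * (x * (2 * ((1 + x) * ε) + 2 * w) / 2) = x * ε + 2 * (x ^ 2 * ε) + x ^ 3 * ε + 320 * (x ^ 2 * ε) + x * δ ^ 2 + 320 * (x ^ 3 * ε) + x ^ 2 * δ ^ 2 := by
      rw [hw]; ring
    have t4 : x * ε ≤ ε + x ^ 2 * ε := by
      have : 0 ≤ (1 + x ^ 2 - x) * ε := mul_nonneg (by nlinarith only [sq_nonneg (x - 1), hx]) hε.le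
      linarith
    linarith
  have A3 : 300 * x ^ 3 * ε + x * hs ε δ x + 15 * (1 + x) * (hs ε δ x + x * τ ^ 2 / 2) ≤ 65000 * R := by
    have : x * hs ε δ x ≤ (1 + x) * hs ε δ x := by gcongr; linarith
    linarith
  have A4 : 30 * ((1 + x) * DD γ δ x) ≤ 300000000000 * R := by
    have : (1 + x) * DD γ δ x = 10000000000 * ((1 + x) * (γ * |Real.log γ| + x * γ + δ)) := by unfold DD; ring
    linarith
  have B1 : Real.exp (300 * x ^ 3 * ε + x * hs ε δ x + 15 * (1 + x) * (hs ε δ x + x * τ ^ 2 / 2)) *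
        (1 + 30 * ((1 + x) * DD γ δ x)) * (1 - stdNormalCDF x) ≤ Real.exp (65000 * R) * (1 + 300000000000 * R) * (1 - stdNormalCDF x) := by
    have : 0 ≤ (1 + x) * DD γ δ x := by unfold DD; positivity
    gcongr
  have B2 : Real.exp (301 * R) ≤ Real.exp (65000 * R) := Real.exp_le_exp.2 (by linarith)
  have B3 : Real.exp (301 * R) * (525 * V) * (1 - stdNormalCDF x) ≤ Real.exp (65000 * R) * (1050 * R) * (1 - stdNormalCDF x) := by
    refine mul_le_mul_of_nonneg_right (mul_le_mul B2 (by linarith) (by positivity) (by positivity)) tp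
  have B4 : Real.exp (301 * R) * (525 * V ^ 4) * (1 - stdNormalCDF x) * 2 ≤ Real.exp (65000 * R) * (1050 * R) * (1 - stdNormalCDF x) * 2 := by
    refine mul_le_mul_of_nonneg_right (mul_le_mul_of_nonneg_right (mul_le_mul B2 (by linarith) (by positivity) (by positivity)) tp) (by norm_num)
  have B5 : 1 + 400000000000 * R ≤ Real.exp (400000000000 * R) := by linarith [Real.add_one_le_exp (400000000000 * R)]
  calc P.real (WE X n x) ≤ Real.exp (65000 * R) * (1 + 300000004200 * R) * (1 - stdNormalCDF x) := by linarith
    _ ≤ Real.exp (65000 * R) * Real.exp (400000000000 * R) * (1 - stdNormalCDF x) := by gcongr; linarith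
    _ = Real.exp (65000 * R + 400000000000 * R) * (1 - stdNormalCDF x) := by rw [Real.exp_add]
    _ ≤ _ := by
      refine mul_le_mul_of_nonneg_right (Real.exp_le_exp.2 ?_) tp
      linarith

end NM
end Cram


namespace Cram
open ProbabilityTheory Set

lemma RR_mono {x γ ε ε' δ : ℝ} (hx : 0 ≤ x) (h0 : 0 ≤ ε') (h : ε' ≤ ε) :
    RR x γ ε' δ ≤ RR x γ ε δ := by
  unfold RR
  have h1 : ε' ^ ((1:ℝ) / 4) ≤ ε ^ ((1:ℝ) / 4) := Real.rpow_le_rpow h0 h (by norm_num)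
  have h2 : 0 ≤ x ^ ((3:ℝ) / 4) := by positivity
  gcongr

lemma sum_shift (f : ℕ → ℝ) (n : ℕ) : ∑ i ∈ Finset.Icc 1 n, f i = ∑ i ∈ Finset.range n, f (i + 1) := by
  induction n with
  | zero => simp
  | succ n ih => rw [Finset.sum_Icc_succ_top (by omega), Finset.sum_range_succ, ih]

lemma cond_jensen {Ω : Type} {mΩ : MeasurableSpace Ω} {P : Measure Ω} [IsProbabilityMeasure P]
    {m : MeasurableSpace Ω} (hm : m ≤ mΩ) {f : Ω → ℝ} (h2 : Integrable (fun ω => f ω ^ 2) P)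
    (h3 : Integrable (fun ω => |f ω| ^ 3) P) :
    ∀ᵐ ω ∂P, 0 ≤ (P[fun ω => f ω ^ 2|m]) ω ∧
      (P[fun ω => f ω ^ 2|m]) ω * Real.sqrt ((P[fun ω => f ω ^ 2|m]) ω) ≤ (P[fun ω => |f ω| ^ 3|m]) ω := by
  have h0 : 0 ≤ᵐ[P] P[fun ω => f ω ^ 2|m] := condExp_nonneg (Eventually.of_forall fun ω => sq_nonneg _)
  have key : ∀ q : ℚ, 0 ≤ q → ∀ᵐ ω ∂P, 3 * (q:ℝ) * (P[fun ω => f ω ^ 2|m]) ω - 2 * (P[fun ω => |f ω| ^ 3|m]) ω ≤ (q:ℝ) ^ 3 := by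
    intro q hq
    have hq' : (0:ℝ) ≤ q := by exact_mod_cast hq
    have a1 := condExp_smul (μ := P) (3 * (q:ℝ)) (fun ω => f ω ^ 2) m
    have a2 := condExp_smul (μ := P) (2:ℝ) (fun ω => |f ω| ^ 3) m
    have a3 := condExp_sub (μ := P) (h2.smul (3 * (q:ℝ))) (h3.smul (2:ℝ)) m
    have a4 : P[((3 * (q:ℝ)) • fun ω => f ω ^ 2) - ((2:ℝ) • fun ω => |f ω| ^ 3)|m] ≤ᵐ[P] P[fun _ => (q:ℝ) ^ 3|m] := by
      refine condExp_mono ((h2.smul (3 * (q:ℝ))).sub (h3.smul (2:ℝ))) (integrable_const _) (Eventually.of_forall fun ω => ?_)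
      simp only [Pi.sub_apply, Pi.smul_apply, smul_eq_mul]
      have e : f ω ^ 2 = |f ω| ^ 2 := (sq_abs _).symm
      rw [e]
      have := mul_nonneg (sq_nonneg (|f ω| - q)) (by positivity : (0:ℝ) ≤ 2 * |f ω| + q)
      linarith
    rw [condExp_const hm] at a4
    filter_upwards [a1, a2, a3, a4] with ω b1 b2 b3 b4
    rw [b3] at b4
    simp only [Pi.sub_apply, b1, b2, Pi.smul_apply, smul_eq_mul] at b4
    exact b4
  have key2 : ∀ᵐ ω ∂P, ∀ q : ℚ, 0 ≤ q → 3 * (q:ℝ) * (P[fun ω => f ω ^ 2|m]) ω - 2 * (P[fun ω => |f ω| ^ 3|m]) ω ≤ (q:ℝ) ^ 3 := by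
    rw [ae_all_iff]; intro q
    by_cases hq : 0 ≤ q
    · filter_upwards [key q hq] with ω h _ using h
    · exact Eventually.of_forall fun ω h => absurd h hq
  filter_upwards [h0, key2] with ω g0 g2
  refine ⟨g0, ?_⟩
  set u := (P[fun ω => f ω ^ 2|m]) ω
  set v := (P[fun ω => |f ω| ^ 3|m]) ω
  have g0' : 0 ≤ u := g0
  have hall : ∀ t : ℝ, 0 < t → 3 * t * u - 2 * v ≤ t ^ 3 := by
    intro t ht
    by_contra hc
    push Not at hc
    have o1 : IsOpen {r : ℝ | 0 < r} := isOpen_lt continuous_const continuous_id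
    have o2 : IsOpen {r : ℝ | r ^ 3 < 3 * r * u - 2 * v} := isOpen_lt (by fun_prop) (by fun_prop)
    have hop : IsOpen {r : ℝ | 0 < r ∧ r ^ 3 < 3 * r * u - 2 * v} := o1.inter o2
    obtain ⟨q, hq1, hq2⟩ := Rat.denseRange_cast.exists_mem_open hop ⟨t, ht, hc⟩
    have := g2 q (by exact_mod_cast hq1.le)
    linarith
  rcases g0'.eq_or_lt with h | h
  · have hv : 0 ≤ v := by
      have := g2 0 le_rfl
      simp at this; linarith
    rw [← h]; simpa using hv
  · have hs := hall (Real.sqrt u) (Real.sqrt_pos.2 h)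
    have e := Real.sq_sqrt g0'
    have : Real.sqrt u ^ 3 = u * Real.sqrt u := by rw [pow_succ, e]
    linarith

lemma toNM {Ω : Type} [mΩ : MeasurableSpace Ω] {P : Measure Ω} [IsProbabilityMeasure P] (A : MDS Ω P)
    {δ ε γ : ℝ} (h1 : A.CondA1 δ) (h2 : A.CondA2 1 ε) (h4 : A.CondA4 1 γ) {k : ℝ} (hk : |k| * Real.sqrt A.Bsq = 1) :
    ∃ s b, NM P A.F A.n (fun i ω => k * A.X (i + 1) ω) s b γ (min ε (2 * γ)) δ := by
  obtain ⟨δ0, δ1, HV⟩ := h1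
  obtain ⟨ε0, ε1, I3, HB⟩ := h2
  obtain ⟨γ0, γ1, -, HG⟩ := h4
  set B := A.Bsq with hB
  set r := Real.sqrt B with hr
  have B0 : 0 ≤ B := Finset.sum_nonneg fun i _ => integral_nonneg fun ω => sq_nonneg _
  have rr : r ^ 2 = B := Real.sq_sqrt B0
  have r0 : 0 ≤ r := Real.sqrt_nonneg B
  have k2 : k ^ 2 * B = 1 := by rw [← rr, ← sq_abs, ← mul_pow, hk, one_pow]
  have k3 : |k| ^ 3 * r ^ 3 = 1 := by rw [← mul_pow, hk, one_pow]
  have B32 : B ^ ((2 + (1:ℝ)) / 2) = r ^ 3 := by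
    rw [hr, Real.sqrt_eq_rpow, ← Real.rpow_natCast, ← Real.rpow_mul B0]; norm_num
  have p3 : ∀ i, (fun ω => |A.X i ω| ^ ((2:ℝ) + 1)) = fun ω => |A.X i ω| ^ 3 := by
    intro i; ext ω; rw [← Real.rpow_natCast]; norm_num
  simp only [p3, Real.rpow_one] at I3 HB HG
  rw [B32] at HB
  have i3 : ∀ i < A.n, Integrable (fun ω => |k * A.X (i + 1) ω| ^ 3) P := fun i hi => by
    simp only [abs_mul, mul_pow]
    exact (I3 (i + 1) (by omega) (by omega)).const_mul _
  have i2 : ∀ i < A.n, Integrable (fun ω => (k * A.X (i + 1) ω) ^ 2) P := fun i hi => by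
    simp only [mul_pow]
    exact (A.sq_int (i + 1) (by omega) (by omega)).const_mul _
  set σ : ℕ → Ω → ℝ := fun i => P[fun ω => (k * A.X (i + 1) ω) ^ 2|A.F i] with hσ
  set β : ℕ → Ω → ℝ := fun i => P[fun ω => |k * A.X (i + 1) ω| ^ 3|A.F i] with hβ
  have σe : ∀ i, σ i =ᵐ[P] fun ω => k ^ 2 * (P[fun ω' => (A.X (i + 1) ω') ^ 2|A.F i]) ω := by
    intro i
    have := condExp_smul (μ := P) (k ^ 2) (fun ω => (A.X (i + 1) ω) ^ 2) (A.F i)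
    have e : (fun ω => (k * A.X (i + 1) ω) ^ 2) = (k ^ 2) • fun ω => (A.X (i + 1) ω) ^ 2 := by
      ext ω; simp [mul_pow]
    rw [hσ]; simp only [e]; exact this
  have βe : ∀ i, β i =ᵐ[P] fun ω => |k| ^ 3 * (P[fun ω' => |A.X (i + 1) ω'| ^ 3|A.F i]) ω := by
    intro i
    have := condExp_smul (μ := P) (|k| ^ 3) (fun ω => |A.X (i + 1) ω| ^ 3) (A.F i)
    have e : (fun ω => |k * A.X (i + 1) ω| ^ 3) = (|k| ^ 3) • fun ω => |A.X (i + 1) ω| ^ 3 := by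
      ext ω; simp [mul_pow, abs_mul]
    rw [hβ]; simp only [e]; exact this
  set G : ℕ → Set Ω := fun i => {ω | 0 ≤ σ i ω ∧ σ i ω ≤ γ ^ 2 ∧ β i ω ≤ γ * σ i ω ∧ σ i ω * Real.sqrt (σ i ω) ≤ β i ω} with hG
  have σm : ∀ i, Measurable[A.F i] (σ i) := fun i => stronglyMeasurable_condExp.measurable
  have βm : ∀ i, Measurable[A.F i] (β i) := fun i => stronglyMeasurable_condExp.measurable
  have Gm : ∀ i, MeasurableSet[A.F i] (G i) := by
    intro i
    have m1 : MeasurableSet[A.F i] {ω | 0 ≤ σ i ω} := measurableSet_le measurable_const (σm i)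
    have m2 : MeasurableSet[A.F i] {ω | σ i ω ≤ γ ^ 2} := measurableSet_le (σm i) measurable_const
    have m3 : MeasurableSet[A.F i] {ω | β i ω ≤ γ * σ i ω} := measurableSet_le (βm i) ((σm i).const_mul γ)
    have m4 : MeasurableSet[A.F i] {ω | σ i ω * Real.sqrt (σ i ω) ≤ β i ω} :=
      measurableSet_le ((σm i).mul (Real.continuous_sqrt.measurable.comp (σm i))) (βm i)
    exact m1.inter (m2.inter (m3.inter m4))
  have Gae : ∀ i < A.n, ∀ᵐ ω ∂P, ω ∈ G i := by
    intro i hi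
    have hJ := cond_jensen (P := P) (A.F_le i) (i2 i hi) (i3 i hi)
    have hg := HG (i + 1) (by omega) (by omega)
    filter_upwards [hJ, hg, σe i, βe i] with ω ⟨j1, j2⟩ g es eb
    have j1' : 0 ≤ σ i ω := j1
    have j2' : σ i ω * Real.sqrt (σ i ω) ≤ β i ω := j2
    have bg : β i ω ≤ γ * σ i ω := by
      have g' : (P[fun ω' => |A.X (i + 1) ω'| ^ 3|A.F i]) ω ≤ γ * r * (P[fun ω' => (A.X (i + 1) ω') ^ 2|A.F i]) ω := g
      rw [eb, es]
      calc |k| ^ 3 * (P[fun ω' => |A.X (i + 1) ω'| ^ 3|A.F i]) ω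
          ≤ |k| ^ 3 * (γ * r * (P[fun ω' => (A.X (i + 1) ω') ^ 2|A.F i]) ω) := by gcongr
        _ = (|k| * r) * (γ * (|k| ^ 2 * (P[fun ω' => (A.X (i + 1) ω') ^ 2|A.F i]) ω)) := by ring
        _ = _ := by rw [hk, sq_abs, one_mul]
    refine ⟨j1', ?_, bg, j2'⟩
    rcases j1'.eq_or_lt with h | h
    · rw [← h]; positivity
    · have : Real.sqrt (σ i ω) ≤ γ := by
        have := j2'.trans bg
        rw [mul_comm] at this
        exact le_of_mul_le_mul_right this h
      calc σ i ω = Real.sqrt (σ i ω) ^ 2 := (Real.sq_sqrt j1').symm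
        _ ≤ γ ^ 2 := by gcongr
  have Gall : ∀ᵐ ω ∂P, ∀ i < A.n, ω ∈ G i := by
    rw [ae_all_iff]; intro i
    by_cases hi : i < A.n
    · filter_upwards [Gae i hi] with ω h _ using h
    · exact Eventually.of_forall fun ω h => absurd h hi
  have esum : ∀ᵐ ω ∂P, (∀ i, σ i ω = k ^ 2 * (P[fun ω' => (A.X (i + 1) ω') ^ 2|A.F i]) ω) ∧
      (∀ i, β i ω = |k| ^ 3 * (P[fun ω' => |A.X (i + 1) ω'| ^ 3|A.F i]) ω) :=
    (ae_all_iff.2 σe).and (ae_all_iff.2 βe)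
  have sig : ∀ᵐ ω ∂P, |∑ i ∈ Finset.range A.n, σ i ω - 1| ≤ δ ^ 2 := by
    filter_upwards [esum, HV] with ω ⟨es, _⟩ hv
    have e1 : ∑ i ∈ Finset.range A.n, σ i ω = k ^ 2 * A.CV ω := by
      unfold MDS.CV
      rw [sum_shift (fun i => (P[fun ω' => (A.X i ω') ^ 2|A.F (i - 1)]) ω), Finset.mul_sum]
      exact Finset.sum_congr rfl fun i _ => es i
    have e2 : k ^ 2 * A.CV ω - 1 = k ^ 2 * (A.CV ω - B) := by linarith
    rw [e1, e2, abs_mul, abs_of_nonneg (sq_nonneg k)]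
    calc k ^ 2 * |A.CV ω - B| ≤ k ^ 2 * (δ ^ 2 * B) := by gcongr
      _ = (k ^ 2 * B) * δ ^ 2 := by ring
      _ = _ := by rw [k2, one_mul]
  have bet : ∀ᵐ ω ∂P, ∑ i ∈ Finset.range A.n, β i ω ≤ min ε (2 * γ) := by
    filter_upwards [esum, HB, sig, Gall] with ω ⟨_, eb⟩ hb hs hg
    refine le_min ?_ ?_
    · have e1 : ∑ i ∈ Finset.range A.n, β i ω = |k| ^ 3 * ∑ i ∈ Finset.Icc 1 A.n, (P[fun ω' => |A.X i ω'| ^ 3|A.F (i - 1)]) ω := by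
        rw [sum_shift (fun i => (P[fun ω' => |A.X i ω'| ^ 3|A.F (i - 1)]) ω), Finset.mul_sum]
        exact Finset.sum_congr rfl fun i _ => eb i
      rw [e1]
      calc |k| ^ 3 * _ ≤ |k| ^ 3 * (ε * r ^ 3) := by gcongr
        _ = (|k| ^ 3 * r ^ 3) * ε := by ring
        _ = ε := by rw [k3, one_mul]
    · have h1 : ∑ i ∈ Finset.range A.n, β i ω ≤ ∑ i ∈ Finset.range A.n, γ * σ i ω :=
        Finset.sum_le_sum fun i hi => (hg i (Finset.mem_range.1 hi)).2.2.1
      rw [← Finset.mul_sum] at h1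
      have h2 : ∑ i ∈ Finset.range A.n, σ i ω ≤ 2 := by
        have := (abs_le.1 hs).2
        have d : δ ^ 2 ≤ 1 := by nlinarith only [δ0, δ1]
        linarith
      have := mul_le_mul_of_nonneg_left h2 γ0.le
      linarith
  have sge : ∀ i < A.n, σ i =ᵐ[P] (G i).indicator (σ i) := fun i hi => by
    filter_upwards [Gae i hi] with ω h
    rw [indicator_of_mem h]
  have bge : ∀ i < A.n, β i =ᵐ[P] (G i).indicator (β i) := fun i hi => by
    filter_upwards [Gae i hi] with ω h
    rw [indicator_of_mem h]
  refine ⟨fun i => (G i).indicator (σ i), fun i => (G i).indicator (β i), ?_⟩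
  refine ⟨A.F_mono, A.F_le, γ0, γ1, lt_min ε0 (by linarith), (min_le_left _ _).trans ε1, min_le_right _ _, δ0, δ1, ?_, ?_, ?_, ?_, ?_, ?_, ?_, ?_, i3, ?_, sge, bge, ?_, ?_⟩
  · intro i hi
    exact (A.meas (i + 1) (by omega) (by omega)).measurable.const_mul k
  · intro i hi; exact (σm i).indicator (Gm i)
  · intro i hi; exact (βm i).indicator (Gm i)
  · intro i hi ω; exact indicator_nonneg (fun ω h => h.1) ω
  · intro i hi ω
    by_cases h : ω ∈ G i
    · simp only [indicator_of_mem h]; exact h.2.1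
    · simp only [indicator_of_notMem h]; positivity
  · intro i hi ω
    refine indicator_nonneg (fun ω h => le_trans ?_ h.2.2.2) ω
    exact mul_nonneg h.1 (Real.sqrt_nonneg _)
  · intro i hi ω
    by_cases h : ω ∈ G i
    · simp only [indicator_of_mem h]; exact h.2.2.1
    · simp only [indicator_of_notMem h]; simp
  · intro i hi ω
    by_cases h : ω ∈ G i
    · simp only [indicator_of_mem h]; exact h.2.2.2
    · simp only [indicator_of_notMem h]; simp
  · intro i hi
    have a := condExp_smul (μ := P) k (A.X (i + 1)) (A.F i)
    have z := A.mean_zero (i + 1) (by omega) (by omega)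
    filter_upwards [a, z] with ω a z
    have z' : (P[A.X (i + 1)|A.F i]) ω = 0 := z
    have a' : (P[fun ω => k * A.X (i + 1) ω|A.F i]) ω = k * (P[A.X (i + 1)|A.F i]) ω := a
    rw [a', z']; simp
  · filter_upwards [sig, Gall] with ω h g
    rw [Finset.sum_congr rfl fun i hi => indicator_of_mem (g i (Finset.mem_range.1 hi)) (σ i)]
    exact h
  · filter_upwards [bet, Gall] with ω h g
    rw [Finset.sum_congr rfl fun i hi => indicator_of_mem (g i (Finset.mem_range.1 hi)) (β i)]
    exact h

lemma Bsq_pos {Ω : Type} [mΩ : MeasurableSpace Ω] {P : Measure Ω} (A : MDS Ω P) : 0 < A.Bsq :=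
  Finset.sum_pos (fun i hi => A.var_pos i (Finset.mem_Icc.1 hi).1 (Finset.mem_Icc.1 hi).2)
    ⟨1, Finset.mem_Icc.2 ⟨le_rfl, A.npos⟩⟩

lemma W_scale {Ω : Type} [mΩ : MeasurableSpace Ω] {P : Measure Ω} (A : MDS Ω P) {k : ℝ} (ω : Ω) :
    psum (fun i ω => k * A.X (i + 1) ω) A.n ω / Real.sqrt (QQ (fun i ω => k * A.X (i + 1) ω) A.n ω) = (k / |k|) * A.W ω := by
  unfold MDS.W MDS.S MDS.QV
  rw [sum_shift (fun i => A.X i ω), sum_shift (fun i => A.X i ω ^ 2)]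
  have e1 : psum (fun i ω => k * A.X (i + 1) ω) A.n ω = k * ∑ i ∈ Finset.range A.n, A.X (i + 1) ω := by
    unfold psum; rw [Finset.mul_sum]
  have e2 : QQ (fun i ω => k * A.X (i + 1) ω) A.n ω = k ^ 2 * ∑ i ∈ Finset.range A.n, A.X (i + 1) ω ^ 2 := by
    unfold QQ; rw [Finset.mul_sum]; exact Finset.sum_congr rfl fun i _ => by ring
  rw [e1, e2, Real.sqrt_mul (sq_nonneg k), Real.sqrt_sq_eq_abs, mul_div_mul_comm]

lemma theta_exists {p q R : ℝ} (hq : 0 < q) (hR : 0 < R)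
    (hl : Real.exp (-(10 ^ 27 * R)) * q ≤ p) (hu : p ≤ Real.exp (10 ^ 12 * R) * q) :
    ∃ θ : ℝ, |θ| ≤ 1 ∧ p / q = Real.exp (θ * 10 ^ 27 * R) := by
  have p0 : 0 < p := lt_of_lt_of_le (by positivity) hl
  have hd : 0 < p / q := by positivity
  have hc : (0:ℝ) < 10 ^ 27 * R := by positivity
  refine ⟨Real.log (p / q) / (10 ^ 27 * R), ?_, ?_⟩
  · rw [abs_div, abs_of_pos hc, div_le_one hc, abs_le]
    constructor
    · rw [Real.le_log_iff_exp_le hd, le_div_iff₀ hq]; exact hl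
    · rw [Real.log_le_iff_le_exp hd, div_le_iff₀ hq]
      refine hu.trans (mul_le_mul_of_nonneg_right (Real.exp_le_exp.2 ?_) hq.le)
      gcongr <;> norm_num
  · rw [mul_assoc, div_mul_cancel₀ _ hc.ne', Real.exp_log hd]

lemma one_side {Ω : Type} [mΩ : MeasurableSpace Ω] {P : Measure Ω} [IsProbabilityMeasure P] (A : MDS Ω P)
    {δ ε γ x : ℝ} (h1 : A.CondA1 δ) (h2 : A.CondA2 1 ε) (h4 : A.CondA4 1 γ) {k : ℝ}
    (hk : |k| * Real.sqrt A.Bsq = 1) (hx : 0 ≤ x) (hxγ : x * γ ≤ 1 / 10 ^ 24) :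
    ∃ θ : ℝ, |θ| ≤ 1 ∧ P.real {ω | x ≤ (k / |k|) * A.W ω} / (1 - stdNormalCDF x) = Real.exp (θ * 10 ^ 27 * RR x γ ε δ) := by
  obtain ⟨s, b, H⟩ := toNM A h1 h2 h4 hk
  have e : WE (fun i ω => k * A.X (i + 1) ω) A.n x = {ω | x ≤ (k / |k|) * A.W ω} := by
    ext ω; show x ≤ _ ↔ x ≤ _; rw [W_scale A]
  have lo := H.low hx hxγ
  have up := H.up hx (hxγ.trans (by norm_num))
  rw [e] at lo up
  have hm := RR_mono (γ := γ) (δ := δ) hx H.ε0.le (min_le_left ε (2 * γ))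
  have R0 := (RR_facts hx H.γ0 H.ε0 H.δ0).2.2.2.2.2.2.1
  have tp : 0 < 1 - stdNormalCDF x := tail_pos x
  refine theta_exists tp (R0.trans_le hm) (le_trans ?_ lo) (up.trans ?_)
  · gcongr
  · gcongr

end Cram

/-- Theorem 2.4 [ii]: Cramér type expansion under (A1), (A2), (A4), for `ρ = 1`. -/
theorem cramer_expansion_A1A2A4_rho_eq_one :
    ∃ c : ℝ, 0 < c ∧
      ∀ (Ω : Type) [MeasurableSpace Ω] (P : Measure Ω), IsProbabilityMeasure P →
        ∀ (A : ℕ → MDS Ω P) (δ ε γ x : ℕ → ℝ),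
          (∀ n, (A n).CondA1 (δ n)) →
          (∀ n, (A n).CondA2 1 (ε n)) →
          (∀ n, (A n).CondA4 1 (γ n)) →
          (∀ n, 0 ≤ x n) →
          Tendsto (fun n => x n * γ n) atTop (nhds 0) →
          ∀ᶠ n in atTop,
            (∃ θ : ℝ, |θ| ≤ 1 ∧
                (P {ω | x n ≤ (A n).W ω}).toReal / (1 - stdNormalCDF (x n)) =
                  Real.exp (θ * c * (x n ^ 3 * ε n + x n ^ 2 * δ n ^ 2 + (1 + x n) * (x n * γ n + γ n * |Real.log (γ n)| + δ n + ε n ^ ((1 : ℝ) / 4) / (1 + x n ^ ((3 : ℝ) / 4)))))) ∧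
            (∃ θ : ℝ, |θ| ≤ 1 ∧
                (P {ω | (A n).W ω ≤ -x n}).toReal / stdNormalCDF (-x n) =
                  Real.exp (θ * c * (x n ^ 3 * ε n + x n ^ 2 * δ n ^ 2 + (1 + x n) * (x n * γ n + γ n * |Real.log (γ n)| + δ n + ε n ^ ((1 : ℝ) / 4) / (1 + x n ^ ((3 : ℝ) / 4)))))) := by
  refine ⟨10 ^ 27, by norm_num, ?_⟩
  intro Ω _ P hP A δ ε γ x h1 h2 h4 hx ht
  have hev : ∀ᶠ n in atTop, x n * γ n < 1 / 10 ^ 24 :=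
    ht.eventually (gt_mem_nhds (by norm_num))
  filter_upwards [hev] with n hn
  have hB := Cram.Bsq_pos (A n)
  have hr : 0 < Real.sqrt (A n).Bsq := Real.sqrt_pos.2 hB
  have hpos : 0 < (Real.sqrt (A n).Bsq)⁻¹ := inv_pos.2 hr
  constructor
  · have hk : |(Real.sqrt (A n).Bsq)⁻¹| * Real.sqrt (A n).Bsq = 1 := by
      rw [abs_of_pos hpos, inv_mul_cancel₀ hr.ne']
    have := Cram.one_side (A n) (h1 n) (h2 n) (h4 n) hk (hx n) hn.le
    rw [abs_of_pos hpos, div_self hpos.ne'] at this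
    simp only [one_mul] at this
    exact this
  · have hk : |-(Real.sqrt (A n).Bsq)⁻¹| * Real.sqrt (A n).Bsq = 1 := by
      rw [abs_neg, abs_of_pos hpos, inv_mul_cancel₀ hr.ne']
    have := Cram.one_side (A n) (h1 n) (h2 n) (h4 n) hk (hx n) hn.le
    rw [abs_neg, abs_of_pos hpos, neg_div, div_self hpos.ne'] at this
    have e : {ω | x n ≤ -1 * (A n).W ω} = {ω | (A n).W ω ≤ -x n} := by
      ext ω
      show x n ≤ -1 * (A n).W ω ↔ (A n).W ω ≤ -x n
      constructor <;> intro h <;> linarith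
    rw [e] at this
    rw [Cram.Phi_neg]
    exact this
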